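/- There exist absolute constants a, c > 0 such that the following holds. Let n, m, k, ℓ be positive integers with 2 ≤ k and a·k⁴ ≤ n, let δ ∈ (0, 1/2), and suppose 2k ≤ ℓ ≤ n/8 and ℓ^{k/2 − 1} ≥ 2^{a·k} · (n^{k/2}/m) · (log n)/δ⁴. Let H be a multiset of m tuples sampled independently and uniformly at random from K := [n]^k. Then with probability at least 1 − n^{−c} over the draw of H, every pseudo-expectation Ẽ of degree at least 2ℓ over {−1,1}^n satisfies Ẽ[ (1/m) Σ_{C∈H} x_C − (1/n^k) Σ_{C∈[n]^k} x_C ] ≤ δ + a/√n. -/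

import Mathlib

open MvPolynomial Finset

/-- A degree-`d` pseudo-expectation over the hypercube `{−1,1}ⁿ`. -/
structure PseudoExpectation (n d : ℕ) where
  toFun : MvPolynomial (Fin n) ℝ →ₗ[ℝ] ℝ
  normalized : toFun 1 = 1
  boolean : ∀ (i : Fin n) (f : MvPolynomial (Fin n) ℝ),
      f.totalDegree + 2 ≤ d → toFun (X i ^ 2 * f) = toFun f
  posSq : ∀ f : MvPolynomial (Fin n) ℝ, 2 * f.totalDegree ≤ d → 0 ≤ toFun (f ^ 2)

/-- Sum of a function over all lists of length `s` with entries in `J`. -/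
def listSum {J R : Type*} [Fintype J] [AddCommMonoid R] : ℕ → (List J → R) → R
  | 0, F => F []
  | s + 1, F => ∑ j, listSum s (fun l => F (j :: l))

theorem listSum_pow {J R : Type*} [Fintype J] [Semiring R] (a : J → R) (s : ℕ) :
    (∑ j, a j) ^ s = listSum s (fun l : List J => (l.map a).prod) := by
  have hmul : ∀ (s : ℕ) (c : R) (F : List J → R),
      listSum s (fun l => c * F l) = c * listSum s F := by
    intro s
    induction s with
    | zero => intro c F; rfl
    | succ s ih =>
      intro c F
      simp only [listSum]
      rw [Finset.mul_sum]
      exact Finset.sum_congr rfl fun j _ => ih c _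
  induction s with
  | zero => simp [listSum]
  | succ s ih =>
    rw [pow_succ', Finset.sum_mul]
    simp only [listSum, List.map_cons, List.prod_cons]
    refine Finset.sum_congr rfl fun j _ => ?_
    rw [hmul, ih]

theorem listSum_le {J : Type*} [Fintype J] (s : ℕ) (F G : List J → ℝ)
    (h : ∀ l : List J, l.length = s → F l ≤ G l) : listSum s F ≤ listSum s G := by
  induction s generalizing F G with
  | zero => exact h [] rfl
  | succ s ih =>
    simp only [listSum]
    exact Finset.sum_le_sum fun j _ => ih _ _ fun l hl => h _ (by simp [hl])

theorem listSum_map {J R S : Type*} [Fintype J] [AddCommMonoid R] [AddCommMonoid S]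
    (φ : R →+ S) (s : ℕ) (F : List J → R) : φ (listSum s F) = listSum s (fun l => φ (F l)) := by
  induction s generalizing F with
  | zero => rfl
  | succ s ih =>
    simp only [listSum, map_sum]
    exact Finset.sum_congr rfl fun j _ => ih _

theorem listSum_comm {J R ι : Type*} [Fintype J] [AddCommMonoid R] (t : Finset ι)
    (s : ℕ) (F : ι → List J → R) :
    ∑ x ∈ t, listSum s (F x) = listSum s (fun l => ∑ x ∈ t, F x l) := by
  induction s generalizing F with
  | zero => rfl
  | succ s ih =>
    simp only [listSum]
    rw [Finset.sum_comm]
    exact Finset.sum_congr rfl fun j _ => ih _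

theorem listSum_const_mul {J : Type*} [Fintype J] (s : ℕ) (c : ℝ) (F : List J → ℝ) :
    listSum s (fun l => c * F l) = c * listSum s F :=
  (listSum_map (AddMonoidHom.mulLeft c) s F).symm

/-- resampling one coordinate -/
theorem sum_update {J Ω R : Type*} [Fintype J] [DecidableEq J] [Fintype Ω] [AddCommMonoid R]
    (j : J) (g : (J → Ω) → R) :
    ∑ ω : J → Ω, ∑ x : Ω, g (Function.update ω j x) = Fintype.card Ω • ∑ ω : J → Ω, g ω := by
  have e : ∑ y : (J → Ω) × Ω, g (Function.update y.1 j y.2) = ∑ y : (J → Ω) × Ω, g y.1 := by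
    let f : (J → Ω) × Ω → (J → Ω) × Ω := fun y => (Function.update y.1 j y.2, y.1 j)
    have hf : Function.Involutive f := by
      intro y
      simp [f]
    exact Fintype.sum_equiv hf.toPerm _ _ (fun y => rfl)
  rw [Fintype.sum_prod_type, Fintype.sum_prod_type] at e
  rw [e, Finset.smul_sum]
  simp [Finset.sum_const]

theorem list_prod_sum_zero {J Ω R : Type*} [Fintype J] [DecidableEq J] [Fintype Ω] [Ring R]
    (M : J → Ω → R) (hM : ∀ j, ∑ x, M j x = 0) (ω : J → Ω) (j : J) (l : List J)
    (hl : l.count j = 1) :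
    ∑ x, (l.map (fun i => M i (Function.update ω j x i))).prod = 0 := by
  induction l with
  | nil => simp at hl
  | cons i l ih =>
    by_cases hij : i = j
    · subst hij
      have h0 : l.count i = 0 := by simpa using hl
      have h1 : i ∉ l := List.count_eq_zero.mp h0
      have h2 : ∀ x, (l.map (fun i' => M i' (Function.update ω i x i'))).prod
          = (l.map (fun i' => M i' (ω i'))).prod := by
        intro x
        congr 1
        apply List.map_congr_left
        intro a ha
        rw [Function.update_of_ne]
        rintro rfl; exact h1 ha
      simp only [List.map_cons, List.prod_cons, Function.update_self, h2]
      rw [← Finset.sum_mul, hM, zero_mul]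
    · have h0 : l.count j = 1 := by
        rw [List.count_cons_of_ne hij] at hl; exact hl
      simp only [List.map_cons, List.prod_cons, Function.update_of_ne hij]
      rw [← Finset.mul_sum, ih h0, mul_zero]

/-- weight of a label sequence -/
def lwt {J : Type*} [DecidableEq J] (q b : ℝ) : List J → ℝ
  | [] => 1
  | j :: l => (if j ∈ l then b else q) * lwt q b l

theorem lwt_nonneg {J : Type*} [DecidableEq J] (q b : ℝ) (hq : 0 ≤ q) (hb : 0 ≤ b) (l : List J) :
    0 ≤ lwt q b l := by
  induction l with
  | nil => simp [lwt]
  | cons j l ih =>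
    simp only [lwt]
    split_ifs <;> positivity

theorem colsum_bound {J Ω V : Type*} [Fintype J] [DecidableEq J] [Fintype Ω] [Nonempty Ω]
    [Fintype V] [DecidableEq V]
    (M : J → Ω → Matrix V V ℝ) (q b : ℝ) (hq : 0 ≤ q) (hb : 0 ≤ b)
    (hMb : ∀ j x T, ∑ v, |M j x v T| ≤ b)
    (hMq : ∀ j T, ∑ x, ∑ v, |M j x v T| ≤ q * Fintype.card Ω) (T : V) (l : List J) :
    ∑ ω : J → Ω, ∑ v, |(l.map (fun j => M j (ω j))).prod v T| ≤
      (Fintype.card (J → Ω) : ℝ) * lwt q b l := by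
  induction l with
  | nil =>
    simp only [List.map_nil, List.prod_nil, lwt, mul_one]
    have : ∀ ω : J → Ω, ∑ v, |(1 : Matrix V V ℝ) v T| = 1 := by
      intro ω
      rw [Finset.sum_eq_single T]
      · simp
      · intro b _ hb; simp [Matrix.one_apply_ne hb]
      · simp
    rw [Finset.sum_congr rfl fun ω _ => this ω]
    simp
  | cons j l ih =>
    set P : (J → Ω) → Matrix V V ℝ := fun ω => (l.map (fun j => M j (ω j))).prod with hP
    have hstep : ∀ ω : J → Ω, ∑ v, |((j :: l).map (fun j => M j (ω j))).prod v T| ≤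
        ∑ U, (∑ v, |M j (ω j) v U|) * |P ω U T| := by
      intro ω
      simp only [List.map_cons, List.prod_cons, Matrix.mul_apply]
      calc ∑ v, |∑ U, M j (ω j) v U * P ω U T|
          ≤ ∑ v, ∑ U, |M j (ω j) v U| * |P ω U T| := by
            refine Finset.sum_le_sum fun v _ => ?_
            refine (Finset.abs_sum_le_sum_abs _ _).trans (le_of_eq ?_)
            exact Finset.sum_congr rfl fun U _ => abs_mul _ _
        _ = _ := by
            rw [Finset.sum_comm]
            exact Finset.sum_congr rfl fun U _ => (Finset.sum_mul _ _ _).symm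
    refine (Finset.sum_le_sum fun ω _ => hstep ω).trans ?_
    by_cases hj : j ∈ l
    · simp only [lwt, if_pos hj]
      calc _ ≤ ∑ ω : J → Ω, ∑ U, b * |P ω U T| := by
            refine Finset.sum_le_sum fun ω _ => Finset.sum_le_sum fun U _ => ?_
            exact mul_le_mul_of_nonneg_right (hMb _ _ _) (abs_nonneg _)
        _ = b * ∑ ω : J → Ω, ∑ U, |P ω U T| := by
            rw [Finset.mul_sum]
            exact Finset.sum_congr rfl fun ω _ => (Finset.mul_sum _ _ _).symm
        _ ≤ b * (Fintype.card (J → Ω) * lwt q b l) := mul_le_mul_of_nonneg_left ih hb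
        _ = _ := by ring
    · simp only [lwt, if_neg hj]
      have hcard : (0 : ℝ) < Fintype.card Ω := by exact_mod_cast Fintype.card_pos
      have hu := sum_update j (fun ω : J → Ω => ∑ U, (∑ v, |M j (ω j) v U|) * |P ω U T|)
      have hPu : ∀ ω x, P (Function.update ω j x) = P ω := by
        intro ω x
        simp only [hP]
        congr 1
        apply List.map_congr_left
        intro a ha
        rw [Function.update_of_ne]
        rintro rfl; exact hj ha
      simp only [Function.update_self, hPu] at hu
      rw [nsmul_eq_mul] at hu
      refine le_of_mul_le_mul_left ?_ hcard
      rw [← hu]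
      calc _ = ∑ ω : J → Ω, ∑ U, (∑ x, ∑ v, |M j x v U|) * |P ω U T| := by
            refine Finset.sum_congr rfl fun ω _ => ?_
            rw [Finset.sum_comm]
            exact Finset.sum_congr rfl fun U _ => (Finset.sum_mul _ _ _).symm
        _ ≤ ∑ ω : J → Ω, ∑ U, (q * Fintype.card Ω) * |P ω U T| := by
            refine Finset.sum_le_sum fun ω _ => Finset.sum_le_sum fun U _ => ?_
            exact mul_le_mul_of_nonneg_right (hMq _ _) (abs_nonneg _)
        _ = (q * Fintype.card Ω) * ∑ ω : J → Ω, ∑ U, |P ω U T| := by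
            rw [Finset.mul_sum]
            exact Finset.sum_congr rfl fun ω _ => (Finset.mul_sum _ _ _).symm
        _ ≤ (q * Fintype.card Ω) * (Fintype.card (J → Ω) * lwt q b l) :=
            mul_le_mul_of_nonneg_left ih (by positivity)
        _ = _ := by ring

theorem lwt_eq {J : Type*} [DecidableEq J] (θ b c : ℝ) (l : List J) :
    lwt (θ * b * c) b l = θ ^ l.toFinset.card * b ^ l.length * lwt c 1 l := by
  induction l with
  | nil => simp [lwt]
  | cons j l ih =>
    simp only [lwt, ih, List.toFinset_cons, List.length_cons]
    by_cases hj : j ∈ l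
    · rw [if_pos hj, if_pos hj, Finset.insert_eq_of_mem (by simpa using hj)]
      ring
    · rw [if_neg hj, if_neg hj, Finset.card_insert_of_notMem (by simpa using hj)]
      ring

theorem listSum_lwt {J : Type*} [Fintype J] [DecidableEq J] (c : ℝ) (hc : 0 ≤ c) (K : ℝ)
    (s : ℕ) (hK : Fintype.card J * c + s ≤ K) :
    listSum s (fun l : List J => lwt c 1 l) ≤ K ^ s := by
  induction s with
  | zero => simp [listSum, lwt]
  | succ s ih =>
    have hK' : Fintype.card J * c + s ≤ K := by push_cast at hK; linarith
    have hK0 : 0 ≤ K := le_trans (by positivity) hK'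
    simp only [listSum]
    rw [listSum_comm, pow_succ']
    refine le_trans ?_ (mul_le_mul_of_nonneg_left (ih hK') hK0)
    rw [← listSum_const_mul]
    apply listSum_le
    intro l hl
    simp only [lwt]
    rw [← Finset.sum_mul]
    refine mul_le_mul_of_nonneg_right ?_ (lwt_nonneg _ _ hc zero_le_one _)
    calc ∑ j, (if j ∈ l then (1 : ℝ) else c) ≤ ∑ j, ((if j ∈ l then (1 : ℝ) else 0) + c) := by
          refine Finset.sum_le_sum fun j _ => ?_
          split_ifs <;> linarith
      _ = (l.toFinset.card : ℝ) + Fintype.card J * c := by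
          rw [Finset.sum_add_distrib]
          congr 1
          · rw [← Finset.sum_filter, Finset.sum_const, nsmul_eq_mul, mul_one]
            congr 2
            ext j; simp
          · simp
      _ ≤ (s : ℝ) + Fintype.card J * c := by
          have : l.toFinset.card ≤ s := hl ▸ List.toFinset_card_le l
          have : (l.toFinset.card : ℝ) ≤ s := by exact_mod_cast this
          linarith
      _ ≤ K := by linarith

theorem distinct_le {J : Type*} [DecidableEq J] (l : List J) (p : ℕ) (hl : l.length = 2 * p)
    (h : ∀ j, l.count j ≠ 1) : l.toFinset.card ≤ p := by
  have h1 : ∑ j ∈ l.toFinset, l.count j = l.length := by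
    simp
  have h2 : l.toFinset.card * 2 ≤ ∑ j ∈ l.toFinset, l.count j := by
    rw [← smul_eq_mul]
    apply Finset.card_nsmul_le_sum
    intro j hj
    have : 0 < l.count j := List.count_pos_iff.mpr (by simpa using hj)
    have := h j
    omega
  omega

/-- Trace moment bound for sums of independent centred random matrices. -/
theorem moment_centered {J Ω V : Type*} [Fintype J] [DecidableEq J] [Nonempty J]
    [Fintype Ω] [Nonempty Ω]
    [Fintype V] [DecidableEq V]
    (M : J → Ω → Matrix V V ℝ) (q b : ℝ) (hq : 0 ≤ q) (hb : 0 < b)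
    (hM0 : ∀ j, ∑ x, M j x = 0)
    (hMb : ∀ j x T, ∑ v, |M j x v T| ≤ b)
    (hMq : ∀ j T, ∑ x, ∑ v, |M j x v T| ≤ q * Fintype.card Ω)
    (p : ℕ) (hp : 0 < p) (hpb : p * b ≤ Fintype.card J * q) :
    ∑ ω : J → Ω, ((∑ j, M j (ω j)) ^ (2 * p)).trace ≤
      (Fintype.card (J → Ω) : ℝ) * Fintype.card V * (9 * (Fintype.card J * q) * b * p) ^ p := by
  have hm : (0 : ℝ) < Fintype.card J := by exact_mod_cast Fintype.card_pos
  have hp' : (0 : ℝ) < p := by exact_mod_cast hp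
  set m : ℝ := (Fintype.card J : ℝ) with hmdef
  set θ : ℝ := m * q / (p * b) with hθ
  have hθ1 : 1 ≤ θ := by rw [hθ, le_div_iff₀ (by positivity)]; linarith
  have hqθ : q = θ * b * (p / m) := by rw [hθ]; field_simp
  have e1 : ∀ ω : J → Ω, ((∑ j, M j (ω j)) ^ (2 * p)).trace =
      listSum (2 * p) (fun l : List J => ((l.map (fun j => M j (ω j))).prod).trace) := by
    intro ω
    rw [listSum_pow]
    exact listSum_map (Matrix.traceAddMonoidHom V ℝ) _ _
  rw [Finset.sum_congr rfl fun ω _ => e1 ω, listSum_comm]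
  have key : ∀ l : List J, l.length = 2 * p →
      ∑ ω : J → Ω, ((l.map (fun j => M j (ω j))).prod).trace ≤
      ((Fintype.card (J → Ω) : ℝ) * Fintype.card V * (θ ^ p * b ^ (2 * p))) *
        lwt ((p : ℝ) / m) 1 l := by
    intro l hl
    have hw : 0 ≤ lwt ((p : ℝ) / m) 1 l := lwt_nonneg _ _ (by positivity) zero_le_one _
    by_cases h : ∃ j, l.count j = 1
    · obtain ⟨j, hj⟩ := h
      have hu := sum_update j (fun ω : J → Ω => ((l.map (fun j => M j (ω j))).prod))
      have hz : ∀ ω : J → Ω, ∑ x, (l.map (fun i => M i (Function.update ω j x i))).prod = 0 :=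
        fun ω => list_prod_sum_zero M hM0 ω j l hj
      simp only [hz, Finset.sum_const_zero] at hu
      have h0 : ∑ ω : J → Ω, ((l.map (fun j => M j (ω j))).prod) = 0 := by
        have := hu.symm
        ext S T
        have h2 := congrFun (congrFun this S) T
        rw [Matrix.smul_apply, nsmul_eq_mul, Matrix.zero_apply] at h2
        rcases mul_eq_zero.mp h2 with h | h
        · exact absurd (by exact_mod_cast h) (Fintype.card_ne_zero (α := Ω))
        · exact h
      rw [← Matrix.trace_sum, h0, Matrix.trace_zero]
      positivity
    · push Not at h
      have hr := distinct_le l p hl h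
      calc ∑ ω : J → Ω, ((l.map (fun j => M j (ω j))).prod).trace
          ≤ ∑ ω : J → Ω, ∑ T, ∑ v, |((l.map (fun j => M j (ω j))).prod) v T| := by
            refine Finset.sum_le_sum fun ω _ => ?_
            rw [Matrix.trace]
            refine Finset.sum_le_sum fun T _ => ?_
            rw [Matrix.diag_apply]
            refine (le_abs_self _).trans ?_
            exact Finset.single_le_sum
              (f := fun v => |((l.map (fun j => M j (ω j))).prod) v T|)
              (fun v _ => abs_nonneg _) (Finset.mem_univ T)
        _ = ∑ T, ∑ ω : J → Ω, ∑ v, |((l.map (fun j => M j (ω j))).prod) v T| :=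
            Finset.sum_comm
        _ ≤ ∑ T : V, (Fintype.card (J → Ω) : ℝ) * lwt q b l :=
            Finset.sum_le_sum fun T _ => colsum_bound M q b hq hb.le hMb hMq T l
        _ = (Fintype.card (J → Ω) : ℝ) * Fintype.card V * lwt q b l := by
            rw [Finset.sum_const, nsmul_eq_mul, Finset.card_univ]; ring
        _ = (Fintype.card (J → Ω) : ℝ) * Fintype.card V *
            (θ ^ l.toFinset.card * b ^ (2 * p) * lwt ((p : ℝ) / m) 1 l) := by
            rw [hqθ, lwt_eq, hl]
        _ ≤ (Fintype.card (J → Ω) : ℝ) * Fintype.card V *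
            (θ ^ p * b ^ (2 * p) * lwt ((p : ℝ) / m) 1 l) := by
            gcongr
        _ = _ := by ring
  refine (listSum_le _ _ _ key).trans ?_
  rw [listSum_const_mul]
  have hls := listSum_lwt (J := J) ((p : ℝ) / m) (by positivity) (3 * p) (2 * p) (by
    rw [← hmdef]
    push_cast
    have : m * ((p : ℝ) / m) = p := by field_simp
    rw [this]; linarith)
  refine (mul_le_mul_of_nonneg_left hls (by positivity)).trans (le_of_eq ?_)
  have : θ ^ p * b ^ (2 * p) * (3 * (p : ℝ)) ^ (2 * p) = (9 * (m * q) * b * p) ^ p := by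
    rw [pow_mul, pow_mul, ← mul_pow, ← mul_pow]
    congr 1
    rw [hθ]; field_simp; ring
  rw [← this]; ring

theorem moment_uncentered {J Ω V : Type*} [Fintype J] [DecidableEq J] [Nonempty J]
    [Fintype Ω] [Nonempty Ω] [Fintype V] [DecidableEq V]
    (M : Ω → Matrix V V ℝ) (Mbar : Matrix V V ℝ) (R : Finset J) (q b : ℝ) (hq : 0 ≤ q) (hb : 0 < b)
    (hMbar : ∀ S T, Mbar S T = (∑ x, M x S T) / Fintype.card Ω)
    (hMb : ∀ x T, ∑ v, |M x v T| ≤ b)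
    (hMq : ∀ T, ∑ x, ∑ v, |M x v T| ≤ q * Fintype.card Ω)
    (p : ℕ) (hp : 0 < p) (hpb : p * b ≤ Fintype.card J * q) :
    ∑ ω : J → Ω, ((∑ j ∈ R, (M (ω j) - Mbar)) ^ (2 * p)).trace ≤
      (Fintype.card (J → Ω) : ℝ) * Fintype.card V * (36 * (Fintype.card J * q) * b * p) ^ p := by
  classical
  have hc : (0 : ℝ) < Fintype.card Ω := by exact_mod_cast Fintype.card_pos
  have hbar_q : ∀ T, ∑ v, |Mbar v T| ≤ q := by
    intro T
    calc ∑ v, |Mbar v T| ≤ ∑ v, (∑ x, |M x v T|) / Fintype.card Ω := by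
          refine Finset.sum_le_sum fun v _ => ?_
          rw [hMbar, abs_div, abs_of_pos hc]
          gcongr
          exact Finset.abs_sum_le_sum_abs _ _
      _ = (∑ x, ∑ v, |M x v T|) / Fintype.card Ω := by
          rw [← Finset.sum_div, Finset.sum_comm]
      _ ≤ q := by rw [div_le_iff₀ hc]; exact hMq T
  have hbar_b : ∀ T, ∑ v, |Mbar v T| ≤ b := by
    intro T
    calc ∑ v, |Mbar v T| ≤ ∑ v, (∑ x, |M x v T|) / Fintype.card Ω := by
          refine Finset.sum_le_sum fun v _ => ?_
          rw [hMbar, abs_div, abs_of_pos hc]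
          gcongr
          exact Finset.abs_sum_le_sum_abs _ _
      _ = (∑ x, ∑ v, |M x v T|) / Fintype.card Ω := by
          rw [← Finset.sum_div, Finset.sum_comm]
      _ ≤ (∑ x : Ω, b) / Fintype.card Ω := by
          gcongr with x _; exact hMb x T
      _ = b := by
          rw [Finset.sum_const, nsmul_eq_mul, Finset.card_univ]; field_simp
  have hd : ∀ x T, ∑ v, |(M x - Mbar) v T| ≤ ∑ v, |M x v T| + ∑ v, |Mbar v T| := by
    intro x T
    rw [← Finset.sum_add_distrib]
    exact Finset.sum_le_sum fun v _ => by rw [Matrix.sub_apply]; exact abs_sub _ _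
  have h := moment_centered (J := J) (fun j x => if j ∈ R then M x - Mbar else 0) (2 * q) (2 * b)
    (by positivity) (by positivity) ?_ ?_ ?_ p hp (by nlinarith)
  · refine le_trans (le_of_eq ?_) (h.trans (le_of_eq ?_))
    · refine Finset.sum_congr rfl fun ω _ => ?_
      congr 2
      rw [Finset.sum_ite_mem, Finset.univ_inter]
    · congr 2; ring
  · intro j
    by_cases hj : j ∈ R
    · simp only [if_pos hj]
      ext S T
      rw [Finset.sum_sub_distrib, Matrix.sub_apply, Matrix.sum_apply, Matrix.sum_apply]
      rw [Finset.sum_const, nsmul_eq_mul, Finset.card_univ, hMbar]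
      rw [mul_div_cancel₀ _ hc.ne']; simp
    · simp [hj]
  · intro j x T
    by_cases hj : j ∈ R
    · simp only [if_pos hj]
      have := hd x T; have := hMb x T; have := hbar_b T; linarith
    · simp [hj]; positivity
  · intro j T
    by_cases hj : j ∈ R
    · simp only [if_pos hj]
      refine (Finset.sum_le_sum fun x _ => hd x T).trans ?_
      rw [Finset.sum_add_distrib, Finset.sum_const, nsmul_eq_mul, Finset.card_univ]
      have := hMq T; have := hbar_q T
      nlinarith
    · simp [hj]; positivity

theorem eig_pow_le_trace {V : Type*} [Fintype V] [DecidableEq V] (A : Matrix V V ℝ)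
    (hA : A.transpose = A) (p : ℕ) (v : V → ℝ) (hv : v ≠ 0) (μ : ℝ)
    (h : A.mulVec v = μ • v) : μ ^ (2 * p) ≤ (A ^ (2 * p)).trace := by
  have hpow : (A ^ p).mulVec v = μ ^ p • v := by
    induction p with
    | zero => simp
    | succ s ih =>
      rw [pow_succ', ← Matrix.mulVec_mulVec, ih, Matrix.mulVec_smul, h, smul_smul, pow_succ]
  have hT : (A ^ p).transpose = A ^ p := by rw [Matrix.transpose_pow, hA]
  have htr : (A ^ (2 * p)).trace = ∑ i, ∑ j, (A ^ p) i j ^ 2 := by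
    rw [two_mul, pow_add, Matrix.trace]
    refine Finset.sum_congr rfl fun i _ => ?_
    rw [Matrix.diag_apply, Matrix.mul_apply]
    refine Finset.sum_congr rfl fun j _ => ?_
    have : (A ^ p) j i = (A ^ p) i j := by
      conv_lhs => rw [← hT]
      rfl
    rw [this, sq]
  have hpos : 0 < ∑ i, v i ^ 2 := by
    obtain ⟨i, hi⟩ := Function.ne_iff.mp hv
    exact Finset.sum_pos' (fun _ _ => sq_nonneg _) ⟨i, Finset.mem_univ _, by
      have : v i ≠ 0 := hi
      positivity⟩
  refine le_of_mul_le_mul_right ?_ hpos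
  rw [htr]
  calc μ ^ (2 * p) * ∑ i, v i ^ 2 = ∑ i, ((A ^ p).mulVec v i) ^ 2 := by
        rw [hpow, Finset.mul_sum]
        refine Finset.sum_congr rfl fun i _ => ?_
        simp only [Pi.smul_apply, smul_eq_mul]; ring
    _ ≤ ∑ i, (∑ j, (A ^ p) i j ^ 2) * ∑ j, v j ^ 2 := by
        refine Finset.sum_le_sum fun i _ => ?_
        exact Finset.sum_mul_sq_le_sq_mul_sq _ _ _
    _ = _ := by rw [Finset.sum_mul]

open scoped MatrixOrder in
theorem psd_factor {V : Type*} [Fintype V] [DecidableEq V] (M : Matrix V V ℝ)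
    (h : M.PosSemidef) : ∃ B : Matrix V V ℝ, M = B.conjTranspose * B :=
  CStarAlgebra.nonneg_iff_eq_star_mul_self.mp h.nonneg

theorem cert {n : ℕ} {V : Type*} [Fintype V] [DecidableEq V] (A : Matrix V V ℝ)
    (hA : A.transpose = A) (p : ℕ) (hp : 0 < p) (t : ℝ) (ht : 0 < t)
    (E : MvPolynomial (Fin n) ℝ →ₗ[ℝ] ℝ) (f : V → MvPolynomial (Fin n) ℝ)
    (hE : ∀ c : V → ℝ, 0 ≤ E ((∑ S, c S • f S) ^ 2)) :
    ∑ S, ∑ T, A S T * E (f S * f T) ≤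
      t * (1 + (A ^ (2 * p)).trace / t ^ (2 * p)) * ∑ S, E (f S * f S) := by
  classical
  set lam : ℝ := t * (1 + (A ^ (2 * p)).trace / t ^ (2 * p)) with hlam
  have heig : ∀ μ : ℝ, μ ^ (2 * p) ≤ (A ^ (2 * p)).trace → μ ≤ lam := by
    intro μ hμ
    have htr : 0 ≤ (A ^ (2 * p)).trace := le_trans (by rw [pow_mul]; positivity) hμ
    rcases le_total μ t with h | h
    · refine h.trans ?_
      rw [hlam]
      have : 0 ≤ t * ((A ^ (2 * p)).trace / t ^ (2 * p)) := by positivity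
      linarith
    · have h1 : 1 ≤ μ / t := by rwa [le_div_iff₀ ht, one_mul]
      have h2 : μ / t ≤ (μ / t) ^ (2 * p) := le_self_pow₀ h1 (by omega)
      have h3 : (μ / t) ^ (2 * p) ≤ (A ^ (2 * p)).trace / t ^ (2 * p) := by
        rw [div_pow]; gcongr
      calc μ = t * (μ / t) := by field_simp
        _ ≤ t * (1 + (A ^ (2 * p)).trace / t ^ (2 * p)) := by
          gcongr; linarith
  have hB : (lam • (1 : Matrix V V ℝ) - A).IsHermitian := by
    rw [Matrix.IsHermitian, Matrix.conjTranspose_eq_transpose_of_trivial, Matrix.transpose_sub,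
      hA, Matrix.transpose_smul, Matrix.transpose_one]
  have hpsd : (lam • (1 : Matrix V V ℝ) - A).PosSemidef := by
    rw [hB.posSemidef_iff_eigenvalues_nonneg]
    intro i
    have hm := hB.mulVec_eigenvectorBasis i
    set v : V → ℝ := ⇑(hB.eigenvectorBasis i) with hv
    have hv0 : v ≠ 0 := by
      intro h0
      have h1 := hB.eigenvectorBasis.orthonormal.ne_zero i
      apply h1
      ext x
      exact congrFun h0 x
    have hAv : A.mulVec v = (lam - hB.eigenvalues i) • v := by
      rw [Matrix.sub_mulVec, Matrix.smul_mulVec, Matrix.one_mulVec] at hm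
      rw [sub_smul]
      have : A.mulVec v = lam • v - (lam • v - A.mulVec v) := by abel
      rw [this, hm]
    have := heig _ (eig_pow_le_trace A hA p v hv0 _ hAv)
    simp only [Pi.zero_apply]
    linarith
  obtain ⟨B, hBB⟩ := psd_factor _ hpsd
  have h0 : 0 ≤ ∑ r, E ((∑ S, B r S • f S) ^ 2) := Finset.sum_nonneg fun r _ => hE _
  have h1 : ∑ r, E ((∑ S, B r S • f S) ^ 2) =
      ∑ S, ∑ T, (lam • (1 : Matrix V V ℝ) - A) S T * E (f S * f T) := by
    rw [hBB]
    simp only [sq, Finset.sum_mul_sum, map_sum, smul_mul_smul_comm, map_smul, smul_eq_mul]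
    rw [Finset.sum_comm]
    refine Finset.sum_congr rfl fun S _ => ?_
    rw [Finset.sum_comm]
    refine Finset.sum_congr rfl fun T _ => ?_
    rw [← Finset.sum_mul, Matrix.mul_apply]
    rfl
  rw [h1] at h0
  have h2 : ∑ S, ∑ T, (lam • (1 : Matrix V V ℝ) - A) S T * E (f S * f T) =
      lam * ∑ S, E (f S * f S) - ∑ S, ∑ T, A S T * E (f S * f T) := by
    rw [Finset.mul_sum, ← Finset.sum_sub_distrib]
    refine Finset.sum_congr rfl fun S _ => ?_
    simp only [Matrix.sub_apply, Matrix.smul_apply, smul_eq_mul, sub_mul, Finset.sum_sub_distrib]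
    congr 1
    rw [Finset.sum_eq_single S]
    · simp
    · intro T _ hT; rw [Matrix.one_apply_ne hT.symm]; simp
    · simp
  linarith


/-- monomial indexed by a family of variables -/
noncomputable def fmon {n : ℕ} {ι : Type*} (s : Finset ι) (c : ι → Fin n) :
    MvPolynomial (Fin n) ℝ := ∏ i ∈ s, X (c i)

theorem fmon_deg {n : ℕ} {ι : Type*} (s : Finset ι) (c : ι → Fin n) :
    (fmon s c).totalDegree ≤ s.card := by
  unfold fmon
  refine (MvPolynomial.totalDegree_finsetProd _ _).trans ?_
  simp [MvPolynomial.totalDegree_X]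

theorem PE_sq_mul {n d : ℕ} (E : PseudoExpectation n d) {ι : Type*} (s : Finset ι) (c : ι → Fin n)
    (f : MvPolynomial (Fin n) ℝ) (h : 2 * s.card + f.totalDegree ≤ d) :
    E.toFun (fmon s c ^ 2 * f) = E.toFun f := by
  classical
  induction s using Finset.induction_on with
  | empty => simp [fmon]
  | insert a s ha ih =>
    rw [Finset.card_insert_of_notMem ha] at h
    have e : fmon (insert a s) c ^ 2 * f = X (c a) ^ 2 * (fmon s c ^ 2 * f) := by
      unfold fmon
      rw [Finset.prod_insert ha]; ring
    rw [e, E.boolean, ih (by omega)]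
    have h1 := MvPolynomial.totalDegree_mul (fmon s c ^ 2) f
    have h2 := MvPolynomial.totalDegree_pow (fmon s c) 2
    have h3 := fmon_deg s c
    omega

theorem PE_sq {n d : ℕ} (E : PseudoExpectation n d) {ι : Type*} (s : Finset ι) (c : ι → Fin n)
    (h : 2 * s.card ≤ d) : E.toFun (fmon s c ^ 2) = 1 := by
  have := PE_sq_mul E s c 1 (by simpa using h)
  rwa [mul_one, E.normalized] at this

theorem PE_abs {n d : ℕ} (E : PseudoExpectation n d) (a b : MvPolynomial (Fin n) ℝ)
    (ha : 2 * a.totalDegree ≤ d) (hb : 2 * b.totalDegree ≤ d)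
    (ha1 : E.toFun (a ^ 2) ≤ 1) (hb1 : E.toFun (b ^ 2) ≤ 1) : |E.toFun (a * b)| ≤ 1 := by
  have h1 := E.posSq (a - b) (by
    have := MvPolynomial.totalDegree_sub a b; omega)
  have h2 := E.posSq (a + b) (by
    have := MvPolynomial.totalDegree_add a b; omega)
  have e1 : (a - b) ^ 2 = a ^ 2 + b ^ 2 - (a * b + a * b) := by ring
  have e2 : (a + b) ^ 2 = a ^ 2 + b ^ 2 + (a * b + a * b) := by ring
  rw [e1, map_sub, map_add, map_add] at h1
  rw [e2, map_add, map_add, map_add] at h2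
  rw [abs_le]; constructor <;> linarith

/-- set monomial -/
noncomputable def mon {n : ℕ} (S : Finset (Fin n)) : MvPolynomial (Fin n) ℝ := fmon S id

theorem mon_deg {n : ℕ} (S : Finset (Fin n)) : (mon S).totalDegree ≤ S.card := fmon_deg _ _

theorem mon_mul {n : ℕ} (S T : Finset (Fin n)) :
    mon S * mon T = mon (S ∩ T) ^ 2 * mon (symmDiff S T) := by
  unfold mon fmon
  have hS : ∏ i ∈ S, (X (id i) : MvPolynomial (Fin n) ℝ) =
      (∏ i ∈ S \ T, X (id i)) * ∏ i ∈ S ∩ T, X (id i) := by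
    rw [mul_comm]
    exact (Finset.prod_inter_mul_prod_sdiff S T _).symm
  have hT : ∏ i ∈ T, (X (id i) : MvPolynomial (Fin n) ℝ) =
      (∏ i ∈ T \ S, X (id i)) * ∏ i ∈ S ∩ T, X (id i) := by
    rw [mul_comm, Finset.inter_comm]
    exact (Finset.prod_inter_mul_prod_sdiff T S _).symm
  have hD : ∏ i ∈ symmDiff S T, (X (id i) : MvPolynomial (Fin n) ℝ) =
      (∏ i ∈ S \ T, X (id i)) * ∏ i ∈ T \ S, X (id i) := by
    rw [symmDiff_def, Finset.sup_eq_union, Finset.prod_union]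
    exact disjoint_sdiff_sdiff
  rw [hS, hT, hD]; ring

theorem card_symm {n : ℕ} (S T : Finset (Fin n)) :
    2 * (S ∩ T).card + (symmDiff S T).card = S.card + T.card := by
  have h1 := Finset.card_inter_add_card_sdiff S T
  have h2 := Finset.card_inter_add_card_sdiff T S
  rw [symmDiff_def, Finset.sup_eq_union, Finset.card_union_of_disjoint disjoint_sdiff_sdiff]
  rw [Finset.inter_comm] at h2
  omega

theorem PE_symm {n d : ℕ} (E : PseudoExpectation n d) (S T : Finset (Fin n))
    (g : MvPolynomial (Fin n) ℝ) (h : S.card + T.card + g.totalDegree ≤ d) :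
    E.toFun (mon S * mon T * g) = E.toFun (mon (symmDiff S T) * g) := by
  rw [mon_mul, mul_assoc]
  have h1 := MvPolynomial.totalDegree_mul (mon (symmDiff S T)) g
  have h2 := mon_deg (symmDiff S T)
  have h3 := card_symm S T
  exact PE_sq_mul E _ _ _ (by omega)

theorem PE_quad {n d r : ℕ} (E : PseudoExpectation n d) (S1 S2 T1 T2 : Finset (Fin n))
    (h1 : S1.card = r) (h2 : S2.card = r) (h3 : T1.card = r) (h4 : T2.card = r) (h : 4 * r ≤ d) :
    E.toFun ((mon S1 * mon S2) * (mon T1 * mon T2)) =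
      E.toFun (mon (symmDiff S1 T1) * mon (symmDiff S2 T2)) := by
  have e : (mon S1 * mon S2) * (mon T1 * mon T2) = mon S1 * mon T1 * (mon S2 * mon T2) := by ring
  rw [e, PE_symm, mul_comm, PE_symm, mul_comm]
  · have := mon_deg (symmDiff S1 T1)
    have := card_symm S1 T1
    omega
  · have := MvPolynomial.totalDegree_mul (mon S2) (mon T2)
    have := mon_deg S2
    have := mon_deg T2
    omega

/-- vertices of the Kikuchi graph -/
abbrev KV (n r : ℕ) : Type := {S : Finset (Fin n) // S.card = r}

open Classical in
/-- Kikuchi matrix of a tuple (zero for tuples with repeated entries) -/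
noncomputable def Kik {n : ℕ} (r : ℕ) {w : ℕ} (C : Fin w → Fin n) : Matrix (KV n r) (KV n r) ℝ :=
  fun S T => if Function.Injective C ∧ symmDiff S.1 T.1 = univ.image C then 1 else 0

/-- the tuple `C` is applicable at `T` -/
def Match {n : ℕ} (h : ℕ) {w : ℕ} (C : Fin w → Fin n) (T : Finset (Fin n)) : Prop :=
  Function.Injective C ∧ (T ∩ univ.image C).card = h

theorem Kik_nonneg {n r w : ℕ} (C : Fin w → Fin n) (S T : KV n r) : 0 ≤ Kik r C S T := by
  unfold Kik; split_ifs <;> norm_num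

theorem Kik_symm {n r w : ℕ} (C : Fin w → Fin n) (S T : KV n r) : Kik r C S T = Kik r C T S := by
  unfold Kik; rw [symmDiff_comm]

theorem card_image_inj {n w : ℕ} (C : Fin w → Fin n) (hC : Function.Injective C) :
    (univ.image C).card = w := by
  rw [Finset.card_image_of_injective _ hC]; simp

open Classical in
theorem Kik_colsum {n r h : ℕ} (C : Fin (2 * h) → Fin n) (T : KV n r) :
    ∑ S, Kik r C S T = if Match h C T.1 then 1 else 0 := by
  by_cases hm : Match h C T.1
  · rw [if_pos hm]
    have hc : (symmDiff T.1 (univ.image C)).card = r := by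
      have h1 := card_symm T.1 (univ.image C)
      rw [hm.2, card_image_inj C hm.1, T.2] at h1
      omega
    rw [Finset.sum_eq_single (⟨symmDiff T.1 (univ.image C), hc⟩ : KV n r)]
    · unfold Kik
      rw [if_pos]
      refine ⟨hm.1, ?_⟩
      simp only
      rw [symmDiff_comm, symmDiff_symmDiff_cancel_left]
    · intro S _ hS
      unfold Kik
      rw [if_neg]
      rintro ⟨_, h2⟩
      apply hS
      apply Subtype.ext
      simp only
      rw [← h2, symmDiff_comm S.1 T.1, symmDiff_symmDiff_cancel_left]
    · simp
  · rw [if_neg hm]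
    refine Finset.sum_eq_zero fun S _ => ?_
    unfold Kik
    rw [if_neg]
    rintro ⟨h1, h2⟩
    apply hm
    refine ⟨h1, ?_⟩
    have h3 := card_symm T.1 (univ.image C)
    have h4 : symmDiff T.1 (univ.image C) = S.1 := by
      rw [← h2, symmDiff_comm S.1 T.1, symmDiff_symmDiff_cancel_left]
    rw [h4, S.2, T.2, card_image_inj C h1] at h3
    omega

/-- number of edges per injective tuple -/
def KD (n r h : ℕ) : ℕ := (2 * h).choose h * (n - 2 * h).choose (r - h)

open Classical in
theorem match_count {n r h : ℕ} (hrh : h ≤ r) (I : Finset (Fin n)) (hI : I.card = 2 * h) :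
    (univ.filter (fun T : KV n r => (T.1 ∩ I).card = h)).card = KD n r h := by
  have e : KD n r h = (powersetCard h I ×ˢ powersetCard (r - h) Iᶜ).card := by
    rw [Finset.card_product, Finset.card_powersetCard, Finset.card_powersetCard, hI,
      Finset.card_compl, hI, Fintype.card_fin]; rfl
  rw [e]
  have hd : ∀ a b : Finset (Fin n), a ⊆ I → b ⊆ Iᶜ → Disjoint a b := fun a b ha hb =>
    Finset.disjoint_of_subset_left ha (Finset.disjoint_of_subset_right hb disjoint_compl_right)
  refine Finset.card_bij (fun T _ => (T.1 ∩ I, T.1 \ I)) ?_ ?_ ?_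
  · intro T hT
    rw [Finset.mem_filter] at hT
    rw [Finset.mem_product, Finset.mem_powersetCard, Finset.mem_powersetCard]
    refine ⟨⟨Finset.inter_subset_right, hT.2⟩, ?_, ?_⟩
    · intro x hx
      simp at hx ⊢; exact hx.2
    · have := Finset.card_inter_add_card_sdiff T.1 I
      have h2 := T.2
      have := hT.2
      simp only
      omega
  · intro S _ T _ hST
    rw [Prod.mk.injEq] at hST
    apply Subtype.ext
    ext x
    have a1 := congrArg (fun A => x ∈ A) hST.1
    have a2 := congrArg (fun A => x ∈ A) hST.2
    simp only [Finset.mem_inter, Finset.mem_sdiff, eq_iff_iff] at a1 a2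
    tauto
  · rintro ⟨a, b⟩ hab
    rw [Finset.mem_product, Finset.mem_powersetCard, Finset.mem_powersetCard] at hab
    obtain ⟨⟨ha1, ha2⟩, hb1, hb2⟩ := hab
    simp only at ha1 ha2 hb1 hb2
    have hdis := hd a b ha1 hb1
    have hbI : Disjoint b I := Finset.disjoint_of_subset_left hb1 disjoint_compl_left
    have e1 : (a ∪ b) ∩ I = a := by
      rw [Finset.union_inter_distrib_right, Finset.inter_eq_left.mpr ha1,
        Finset.disjoint_iff_inter_eq_empty.mp hbI, Finset.union_empty]
    have e2 : (a ∪ b) \ I = b := by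
      rw [Finset.union_sdiff_distrib, Finset.sdiff_eq_empty_iff_subset.mpr ha1,
        Finset.empty_union, Finset.sdiff_eq_self_of_disjoint hbI]
    refine ⟨⟨a ∪ b, ?_⟩, ?_, ?_⟩
    · rw [Finset.card_union_of_disjoint hdis, ha2, hb2]; omega
    · rw [Finset.mem_filter]
      exact ⟨Finset.mem_univ _, by simp only; rw [e1, ha2]⟩
    · simp only; rw [e1, e2]

theorem Kik_total {n r h : ℕ} (hrh : h ≤ r) (C : Fin (2 * h) → Fin n)
    (hC : Function.Injective C) : ∑ T, ∑ S, Kik r C S T = KD n r h := by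
  classical
  simp only [Kik_colsum]
  rw [← match_count hrh (univ.image C) (card_image_inj C hC), Finset.sum_boole]
  congr 2
  ext T
  simp [Match, hC]

theorem choose_step (m s : ℕ) (hs : s ≤ m) :
    ((m + 2).choose (s + 1) : ℝ) * ((s + 1) * (m + 1 - s)) = (m + 2) * (m + 1) * m.choose s := by
  have h1 := Nat.choose_mul_succ_eq m s
  have h2 := Nat.add_one_mul_choose_eq (m + 1) s
  have h1' : (m.choose s : ℝ) * (m + 1) = (m + 1).choose s * (m + 1 - s) := by
    have : ((m + 1 - s : ℕ) : ℝ) = m + 1 - s := by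
      rw [Nat.cast_sub (by omega)]; push_cast; ring
    rw [← this]; exact_mod_cast h1
  have h2' : ((m : ℝ) + 1 + 1) * (m + 1).choose s = (m + 2).choose (s + 1) * (s + 1) := by
    exact_mod_cast h2
  calc ((m + 2).choose (s + 1) : ℝ) * ((s + 1) * (m + 1 - s))
      = ((m + 2).choose (s + 1) * (s + 1)) * (m + 1 - s) := by ring
    _ = (m + 2) * ((m + 1).choose s * (m + 1 - s)) := by rw [← h2']; ring
    _ = _ := by rw [← h1']; ring

theorem choose_lower (n r h : ℕ) (hr : 2 * h ≤ r) (hn : 4 * r ≤ n) (hn0 : 0 < n) :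
    ((r : ℝ) / (4 * n)) ^ h * n.choose r ≤ (n - 2 * h).choose (r - h) := by
  have hn0' : (0 : ℝ) < n := by exact_mod_cast hn0
  have key : ∀ i : ℕ, i ≤ h →
      ((r : ℝ) / (4 * n)) ^ i * n.choose r ≤ (n - 2 * i).choose (r - i) := by
    intro i
    induction i with
    | zero => intro _; simp
    | succ i ih =>
      intro hi
      have ih := ih (by omega)
      obtain ⟨M, hM⟩ : ∃ M, n - 2 * i = M + 2 := ⟨n - 2 * i - 2, by omega⟩
      obtain ⟨s, hs⟩ : ∃ s, r - i = s + 1 := ⟨r - i - 1, by omega⟩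
      have e1 : n - 2 * (i + 1) = M := by omega
      have e2 : r - (i + 1) = s := by omega
      rw [hM, hs] at ih
      rw [e1, e2]
      have hst := choose_step M s (by omega)
      have b1 : (r : ℝ) ≤ 2 * (s + 1) := by
        have : r ≤ 2 * (s + 1) := by omega
        exact_mod_cast this
      have b2 : (n : ℝ) ≤ 2 * (M + 1 - s) := by
        have : n + 2 * s ≤ 2 * (M + 1) := by omega
        have : (n : ℝ) + 2 * s ≤ 2 * (M + 1) := by exact_mod_cast this
        linarith
      have b3 : ((M : ℝ) + 2) ≤ n := by
        have : M + 2 ≤ n := by omega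
        exact_mod_cast this
      have hr0 : (0 : ℝ) ≤ r := Nat.cast_nonneg _
      have hM0 : (0 : ℝ) ≤ M := Nat.cast_nonneg _
      have hc0 : (0 : ℝ) ≤ (M + 2).choose (s + 1) := Nat.cast_nonneg _
      rw [pow_succ']
      calc (r : ℝ) / (4 * n) * ((r : ℝ) / (4 * n)) ^ i * n.choose r
          = (r : ℝ) / (4 * n) * (((r : ℝ) / (4 * n)) ^ i * n.choose r) := by ring
        _ ≤ (r : ℝ) / (4 * n) * (M + 2).choose (s + 1) := by gcongr
        _ ≤ M.choose s := by
          rw [div_mul_eq_mul_div, div_le_iff₀ (by positivity)]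
          have hP : (r : ℝ) * n ≤ 4 * ((s + 1) * (M + 1 - s)) := by nlinarith
          have hQ : ((M : ℝ) + 2) * (M + 1) ≤ n * n := by nlinarith
          have hm0 : (0 : ℝ) ≤ M.choose s := Nat.cast_nonneg _
          have : ((r : ℝ) * n) * (M + 2).choose (s + 1) ≤ 4 * (n * n) * M.choose s := by
            calc ((r : ℝ) * n) * (M + 2).choose (s + 1)
                ≤ (4 * ((s + 1) * (M + 1 - s))) * (M + 2).choose (s + 1) := by gcongr
              _ = 4 * (((M : ℝ) + 2) * (M + 1)) * M.choose s := by linear_combination 4 * hst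
              _ ≤ _ := by gcongr
          refine le_of_mul_le_mul_right ?_ hn0'
          nlinarith
  exact key h le_rfl

theorem KD_lower (n r h : ℕ) (hr : 2 * h ≤ r) (hn : 4 * r ≤ n) (hn0 : 0 < n) :
    ((r : ℝ) / (4 * n)) ^ h * Fintype.card (KV n r) ≤ KD n r h := by
  rw [Fintype.card_finset_len, Fintype.card_fin]
  refine (choose_lower n r h hr hn hn0).trans ?_
  unfold KD
  have : (n - 2 * h).choose (r - h) ≤ (2 * h).choose h * (n - 2 * h).choose (r - h) :=
    Nat.le_mul_of_pos_left _ (Nat.choose_pos (by omega))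
  exact_mod_cast this

open Classical in
theorem match_avg {n r h : ℕ} (T : KV n r) :
    ((univ.filter (fun C : Fin (2 * h) → Fin n => Match h C T.1)).card : ℝ) ≤
      4 ^ h * r ^ h * n ^ h := by
  have hsub : univ.filter (fun C : Fin (2 * h) → Fin n => Match h C T.1) ⊆
      (powersetCard h (univ : Finset (Fin (2 * h)))).biUnion
        (fun J => Fintype.piFinset (fun j => if j ∈ J then T.1 else univ)) := by
    intro C hC
    rw [Finset.mem_filter] at hC
    obtain ⟨_, hinj, hcard⟩ := hC
    rw [Finset.mem_biUnion]
    refine ⟨univ.filter (fun j => C j ∈ T.1), ?_, ?_⟩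
    · rw [Finset.mem_powersetCard]
      refine ⟨Finset.subset_univ _, ?_⟩
      refine Eq.trans ?_ hcard
      rw [← Finset.card_image_of_injective _ hinj]
      congr 1
      ext x
      simp only [Finset.mem_image, Finset.mem_filter, Finset.mem_univ, true_and,
        Finset.mem_inter]
      constructor
      · rintro ⟨j, hj, rfl⟩; exact ⟨hj, j, rfl⟩
      · rintro ⟨hx, j, rfl⟩; exact ⟨j, hx, rfl⟩
    · rw [Fintype.mem_piFinset]
      intro j
      split_ifs with hj
      · simpa using hj
      · simp
  have h1 := (Finset.card_le_card hsub).trans Finset.card_biUnion_le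
  have h2 : ∀ J ∈ powersetCard h (univ : Finset (Fin (2 * h))),
      (Fintype.piFinset (fun j => if j ∈ J then T.1 else univ)).card = r ^ h * n ^ h := by
    intro J hJ
    rw [Finset.mem_powersetCard] at hJ
    rw [Fintype.card_piFinset]
    have : ∀ j, (if j ∈ J then T.1 else univ).card = if j ∈ J then r else n := by
      intro j; split_ifs
      · exact T.2
      · simp
    rw [Finset.prod_congr rfl fun j _ => this j, Finset.prod_ite, Finset.prod_const,
      Finset.prod_const]
    congr 2
    · simpa using hJ.2
    · have hf : (univ.filter (fun x => x ∉ J)) = Jᶜ := by ext; simp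
      rw [hf, Finset.card_compl, hJ.2, Fintype.card_fin]; omega
  rw [Finset.sum_congr rfl h2, Finset.sum_const, Finset.card_powersetCard, Finset.card_univ,
    Fintype.card_fin, smul_eq_mul] at h1
  have h3 : (2 * h).choose h ≤ 4 ^ h := by
    have := Nat.choose_le_two_pow (2 * h) h
    rwa [pow_mul] at this
  have h4 : (2 * h).choose h * (r ^ h * n ^ h) ≤ 4 ^ h * (r ^ h * n ^ h) :=
    Nat.mul_le_mul_right _ h3
  have h5 := h1.trans h4
  have : ((univ.filter (fun C : Fin (2 * h) → Fin n => Match h C T.1)).card : ℝ) ≤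
      4 ^ h * (r ^ h * n ^ h) := by exact_mod_cast h5
  linarith

theorem Kik_avg {n r h : ℕ} (hn : 0 < n) (T : KV n r) :
    ∑ C : Fin (2 * h) → Fin n, ∑ S, Kik r C S T ≤
      (4 * (r : ℝ) / n) ^ h * Fintype.card (Fin (2 * h) → Fin n) := by
  classical
  simp only [Kik_colsum]
  rw [Finset.sum_boole]
  refine (match_avg T).trans (le_of_eq ?_)
  have hn' : (n : ℝ) ≠ 0 := by exact_mod_cast hn.ne'
  rw [Fintype.card_fun, Fintype.card_fin, Fintype.card_fin, div_pow, mul_pow]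
  push_cast
  field_simp
  ring

open Classical in
theorem noninj_count {n w : ℕ} :
    (n : ℝ) * (univ.filter (fun C : Fin w → Fin n => ¬ Function.Injective C)).card ≤
      (w : ℝ) ^ 2 * Fintype.card (Fin w → Fin n) := by
  have hsub : univ.filter (fun C : Fin w → Fin n => ¬ Function.Injective C) ⊆
      (univ.filter (fun ij : Fin w × Fin w => ij.1 ≠ ij.2)).biUnion
        (fun ij => univ.filter (fun C : Fin w → Fin n => C ij.1 = C ij.2)) := by
    intro C hC
    rw [Finset.mem_filter] at hC
    have := hC.2
    simp only [Function.Injective, not_forall] at this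
    obtain ⟨i, j, hij, hne⟩ := this
    rw [Finset.mem_biUnion]
    exact ⟨(i, j), by simp [hne], by simp [hij]⟩
  have h1 := (Finset.card_le_card hsub).trans Finset.card_biUnion_le
  have h2 : ∀ ij ∈ univ.filter (fun ij : Fin w × Fin w => ij.1 ≠ ij.2),
      n * (univ.filter (fun C : Fin w → Fin n => C ij.1 = C ij.2)).card =
        Fintype.card (Fin w → Fin n) := by
    rintro ⟨i, j⟩ hij
    have hne : i ≠ j := by simpa using hij
    have hu := sum_update (R := ℕ) j (fun C : Fin w → Fin n => if C i = C j then 1 else 0)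
    simp only [Function.update_self, Function.update_of_ne hne] at hu
    rw [Fintype.card_fin, smul_eq_mul, ← Finset.card_filter] at hu
    rw [← hu]
    simp
  have h3 : n * (univ.filter (fun C : Fin w → Fin n => ¬ Function.Injective C)).card ≤
      w ^ 2 * Fintype.card (Fin w → Fin n) := by
    refine (Nat.mul_le_mul_left n h1).trans ?_
    rw [Finset.mul_sum, Finset.sum_congr rfl h2, Finset.sum_const, smul_eq_mul]
    refine Nat.mul_le_mul_right _ ?_
    refine (Finset.card_le_univ _).trans ?_
    simp [sq]
  exact_mod_cast h3

/-- combine two assignments along a set -/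
noncomputable def mixf {J Ω : Type*} [DecidableEq J] (L : Finset J) (a b : J → Ω) : J → Ω :=
  fun j => if j ∈ L then a j else b j

theorem resample {J Ω : Type*} [Fintype J] [DecidableEq J] [Fintype Ω] (L : Finset J)
    (F : (J → Ω) → (J → Ω) → ℝ)
    (h1 : ∀ a a' b, (∀ j ∈ L, a j = a' j) → F a b = F a' b)
    (h2 : ∀ a b b', (∀ j, j ∉ L → b j = b' j) → F a b = F a b') :
    (Fintype.card (J → Ω) : ℝ) * ∑ a, F a a = ∑ a, ∑ b, F a b := by
  have hinv : Function.Involutive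
      (fun x : (J → Ω) × (J → Ω) => (mixf L x.1 x.2, mixf L x.2 x.1)) := by
    rintro ⟨a, b⟩
    ext j <;> simp only [mixf] <;> split_ifs <;> rfl
  have e1 : ∑ x : (J → Ω) × (J → Ω), F x.1 x.2 =
      ∑ x : (J → Ω) × (J → Ω), F (mixf L x.1 x.2) (mixf L x.1 x.2) := by
    refine Finset.sum_congr rfl fun x _ => ?_
    rw [h1 x.1 (mixf L x.1 x.2) x.2 (fun j hj => by simp [mixf, hj]),
      h2 _ x.2 (mixf L x.1 x.2) (fun j hj => by simp [mixf, hj])]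
  have e2 : ∑ x : (J → Ω) × (J → Ω), F (mixf L x.1 x.2) (mixf L x.1 x.2) =
      ∑ x : (J → Ω) × (J → Ω), F x.1 x.1 :=
    Equiv.sum_comp hinv.toPerm (fun x => F x.1 x.1)
  rw [← Fintype.sum_prod_type' (f := fun a b => F a b), e1, e2, Fintype.sum_prod_type]
  simp only [Finset.sum_const, Finset.card_univ, nsmul_eq_mul]
  rw [Finset.mul_sum]

open Classical in
/-- number of elements of `L` satisfying `P` -/
noncomputable def cnt {J : Type*} (L : Finset J) (P : J → Prop) : ℕ := (L.filter P).card

theorem cnt_eq {J : Type*} (L : Finset J) (P : J → Prop) [DecidablePred P] :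
    cnt L P = (L.filter P).card := by
  unfold cnt; congr

theorem cnt_congr {J : Type*} (L : Finset J) (P Q : J → Prop) (h : ∀ j ∈ L, P j ↔ Q j) :
    cnt L P = cnt L Q := by
  classical
  rw [cnt_eq, cnt_eq, Finset.filter_congr h]

theorem two_pow_count {J Ω : Type*} [Fintype J] [DecidableEq J] [Fintype Ω] (L : Finset J)
    (P : Ω → Prop) (θ : ℝ) (_hθ0 : 0 ≤ θ)
    (hθ : (cnt univ P : ℝ) ≤ θ * Fintype.card Ω) :
    ∑ ω : J → Ω, (2 : ℝ) ^ cnt L (fun j => P (ω j)) ≤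
      Fintype.card (J → Ω) * Real.exp (Fintype.card J * θ) := by
  classical
  rw [cnt_eq] at hθ
  have e1 : ∀ ω : J → Ω, (2 : ℝ) ^ cnt L (fun j => P (ω j)) =
      ∏ j, (if j ∈ L ∧ P (ω j) then 2 else 1) := by
    intro ω
    rw [cnt_eq, Finset.prod_ite, Finset.prod_const, Finset.prod_const_one, mul_one]
    congr 2
    ext j; simp
  simp only [e1]
  rw [← Fintype.prod_sum (f := fun j x => if j ∈ L ∧ P x then (2 : ℝ) else 1)]
  have e2 : (Fintype.card (J → Ω) * Real.exp (Fintype.card J * θ) : ℝ) =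
      ∏ _j : J, (Fintype.card Ω * Real.exp θ) := by
    rw [Finset.prod_const, mul_pow, Fintype.card_fun, Finset.card_univ, ← Real.exp_nat_mul]
    push_cast; rfl
  rw [e2]
  refine Finset.prod_le_prod (fun j _ => Finset.sum_nonneg fun x _ => by split_ifs <;> norm_num)
    fun j _ => ?_
  have h3 : ∑ x : Ω, (if j ∈ L ∧ P x then (2 : ℝ) else 1) ≤
      ∑ x : Ω, (1 + if P x then (1 : ℝ) else 0) := by
    refine Finset.sum_le_sum fun x _ => ?_
    by_cases hx : P x <;> by_cases hj : j ∈ L <;> simp [hx, hj] <;> norm_num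
  refine h3.trans ?_
  rw [Finset.sum_add_distrib, Finset.sum_boole]
  simp only [Finset.sum_const, Finset.card_univ, nsmul_eq_mul, mul_one]
  have := Real.add_one_le_exp θ
  have hc : (0 : ℝ) ≤ Fintype.card Ω := Nat.cast_nonneg _
  nlinarith

theorem count_tail {J Ω : Type*} [Fintype J] [DecidableEq J] [Fintype Ω] (L : Finset J)
    (P : Ω → Prop) (θ : ℝ) (hθ0 : 0 ≤ θ)
    (hθ : (cnt univ P : ℝ) ≤ θ * Fintype.card Ω) (s : ℝ) :
    ∑ ω : J → Ω, (if s < cnt L (fun j => P (ω j)) then (1 : ℝ) else 0) ≤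
      Fintype.card (J → Ω) * (Real.exp (Fintype.card J * θ) * (2 : ℝ) ^ (-s)) := by
  have h1 := two_pow_count (J := J) L P θ hθ0 hθ
  have h2 : (0 : ℝ) < (2 : ℝ) ^ (-s) := by positivity
  rw [← mul_assoc]
  refine le_trans ?_ (mul_le_mul_of_nonneg_right h1 h2.le)
  rw [Finset.sum_mul]
  refine Finset.sum_le_sum fun ω _ => ?_
  split_ifs with h
  · rw [← Real.rpow_natCast, ← Real.rpow_add (by norm_num)]
    exact Real.one_le_rpow (by norm_num) (by linarith)
  · positivity

open Classical in
/-- monomial of an injective tuple -/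
noncomputable def Gp {n w : ℕ} (C : Fin w → Fin n) : MvPolynomial (Fin n) ℝ :=
  if Function.Injective C then fmon univ C else 0

theorem Gp_deg {n w : ℕ} (C : Fin w → Fin n) : (Gp C).totalDegree ≤ w := by
  unfold Gp; split_ifs
  · simpa using fmon_deg univ C
  · simp

theorem PE_Gp_sq {n d w : ℕ} (E : PseudoExpectation n d) (C : Fin w → Fin n) (h : 2 * w ≤ d) :
    E.toFun (Gp C ^ 2) ≤ 1 := by
  unfold Gp; split_ifs
  · exact (PE_sq E univ C (by simpa using h)).le
  · simp

theorem Kik_repr {n r h : ℕ} (hrh : h ≤ r) (C : Fin (2 * h) → Fin n) :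
    ∑ S : KV n r, ∑ T : KV n r, Kik r C S T • mon (symmDiff S.1 T.1) = (KD n r h : ℝ) • Gp C := by
  classical
  by_cases hC : Function.Injective C
  · have e : ∀ S T : KV n r, Kik r C S T • mon (symmDiff S.1 T.1) = Kik r C S T • Gp C := by
      intro S T
      unfold Kik Gp
      split_ifs with h1
      · rw [h1.2]
        unfold mon fmon
        rw [Finset.prod_image (fun a _ b _ hab => hC hab)]; rfl
      · simp
    simp only [e, ← Finset.sum_smul]
    congr 1
    rw [← Kik_total hrh C hC]
    exact Finset.sum_comm
  · unfold Kik Gp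
    simp [hC]

/-- pruned tensor matrix -/
noncomputable def prA {U W : Type*} [Fintype U] (g : W → ℝ) (P Q : U → Matrix W W ℝ) :
    Matrix (W × W) (W × W) ℝ :=
  fun S T => ∑ u, (g S.1 * g T.1 * P u S.1 T.1) * Q u S.2 T.2

theorem core {n d r : ℕ} {U : Type*} [Fintype U] (E : PseudoExpectation n d) (hrd : 4 * r ≤ d)
    (P Q : U → Matrix (KV n r) (KV n r) ℝ) (zP zQ : U → MvPolynomial (Fin n) ℝ) (D : ℝ)
    (hP : ∀ u S T, P u S T = P u T S) (hQ : ∀ u S T, Q u S T = Q u T S)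
    (hzP : ∀ u, ∑ S, ∑ T, P u S T • mon (symmDiff S.1 T.1) = D • zP u)
    (hzQ : ∀ u, ∑ S, ∑ T, Q u S T • mon (symmDiff S.1 T.1) = D • zQ u)
    (g : KV n r → ℝ) (hg : ∀ S, g S = 0 ∨ g S = 1)
    (p : ℕ) (hp : 0 < p) (t : ℝ) (ht : 0 < t) :
    D ^ 2 * ∑ u, E.toFun (zP u * zQ u) ≤
      (Fintype.card (KV n r) : ℝ) ^ 2 * (t * (1 + ((prA g P Q) ^ (2 * p)).trace / t ^ (2 * p)))
      + ∑ u, (∑ S, ∑ T, (1 - g S * g T) * |P u S T|) * (∑ S, ∑ T, |Q u S T|) := by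
  set f : KV n r × KV n r → MvPolynomial (Fin n) ℝ := fun S => mon S.1.1 * mon S.2.1 with hf
  have hfd : ∀ S, (f S).totalDegree ≤ 2 * r := by
    intro S
    refine (MvPolynomial.totalDegree_mul _ _).trans ?_
    have h1 := mon_deg S.1.1
    have h2 := mon_deg S.2.1
    rw [S.1.2] at h1; rw [S.2.2] at h2
    omega
  have hE : ∀ c : KV n r × KV n r → ℝ, 0 ≤ E.toFun ((∑ S, c S • f S) ^ 2) := by
    intro c
    apply E.posSq
    have : (∑ S, c S • f S).totalDegree ≤ 2 * r :=
      MvPolynomial.totalDegree_finsetSum_le fun S _ =>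
        (MvPolynomial.totalDegree_smul_le _ _).trans (hfd S)
    omega
  have hsymm : (prA g P Q).transpose = prA g P Q := by
    ext S T
    simp only [Matrix.transpose_apply, prA]
    refine Finset.sum_congr rfl fun u _ => ?_
    rw [hP u T.1 S.1, hQ u T.2 S.2]; ring
  have hff : ∀ S T, E.toFun (f S * f T) =
      E.toFun (mon (symmDiff S.1.1 T.1.1) * mon (symmDiff S.2.1 T.2.1)) := fun S T =>
    PE_quad E _ _ _ _ S.1.2 S.2.2 T.1.2 T.2.2 hrd
  have hc := cert (prA g P Q) hsymm p hp t ht E.toFun f hE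
  have hfS : ∀ S, E.toFun (f S * f S) = 1 := by
    intro S
    rw [hff, symmDiff_self, symmDiff_self]
    simp [mon, fmon, E.normalized]
  have habs : ∀ S T, |E.toFun (f S * f T)| ≤ 1 := by
    intro S T
    refine PE_abs E _ _ ?_ ?_ ?_ ?_
    · have := hfd S; omega
    · have := hfd T; omega
    · rw [sq, hfS]
    · rw [sq, hfS]
  simp only [hfS, Finset.sum_const, Finset.card_univ, Fintype.card_prod, nsmul_eq_mul] at hc
  have e1 : D ^ 2 * ∑ u, E.toFun (zP u * zQ u) =
      ∑ S, ∑ T, (∑ u, P u S.1 T.1 * Q u S.2 T.2) * E.toFun (f S * f T) := by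
    have : ∀ u, D ^ 2 * E.toFun (zP u * zQ u) =
        ∑ S1, ∑ T1, ∑ S2, ∑ T2, P u S1 T1 * Q u S2 T2 * E.toFun (f (S1, S2) * f (T1, T2)) := by
      intro u
      have : D ^ 2 * E.toFun (zP u * zQ u) = E.toFun ((D • zP u) * (D • zQ u)) := by
        rw [smul_mul_smul_comm, map_smul, smul_eq_mul, sq]
      rw [this, ← hzP, ← hzQ]
      simp only [Finset.sum_mul]
      simp only [Finset.mul_sum, map_sum]
      refine Finset.sum_congr rfl fun S1 _ => ?_
      refine Finset.sum_congr rfl fun T1 _ => ?_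
      refine Finset.sum_congr rfl fun S2 _ => ?_
      refine Finset.sum_congr rfl fun T2 _ => ?_
      rw [hff, smul_mul_smul_comm, map_smul, smul_eq_mul]
    rw [Finset.mul_sum]
    simp only [this, Fintype.sum_prod_type, Finset.sum_mul]
    rw [Finset.sum_comm]
    refine Finset.sum_congr rfl fun S1 _ => ?_
    conv_rhs => rw [Finset.sum_comm]
    rw [Finset.sum_comm]
    refine Finset.sum_congr rfl fun T1 _ => ?_
    rw [Finset.sum_comm]
    refine Finset.sum_congr rfl fun S2 _ => ?_
    rw [Finset.sum_comm]
  have e2 : ∑ S, ∑ T, (∑ u, P u S.1 T.1 * Q u S.2 T.2) * E.toFun (f S * f T) =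
      (∑ S, ∑ T, prA g P Q S T * E.toFun (f S * f T)) +
      ∑ S, ∑ T, (∑ u, ((1 - g S.1 * g T.1) * P u S.1 T.1) * Q u S.2 T.2) * E.toFun (f S * f T) := by
    rw [← Finset.sum_add_distrib]
    refine Finset.sum_congr rfl fun S _ => ?_
    rw [← Finset.sum_add_distrib]
    refine Finset.sum_congr rfl fun T _ => ?_
    rw [← add_mul]
    congr 1
    unfold prA
    rw [← Finset.sum_add_distrib]
    refine Finset.sum_congr rfl fun u _ => ?_
    ring
  have hg1 : ∀ S T, 0 ≤ 1 - g S * g T := by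
    intro S T
    rcases hg S with h | h <;> rcases hg T with h' | h' <;> rw [h, h'] <;> norm_num
  have e3 : ∑ S, ∑ T, (∑ u, ((1 - g S.1 * g T.1) * P u S.1 T.1) * Q u S.2 T.2) *
        E.toFun (f S * f T) ≤
      ∑ u, (∑ S, ∑ T, (1 - g S * g T) * |P u S T|) * (∑ S, ∑ T, |Q u S T|) := by
    have : ∀ S T : KV n r × KV n r,
        (∑ u, ((1 - g S.1 * g T.1) * P u S.1 T.1) * Q u S.2 T.2) * E.toFun (f S * f T) ≤
        ∑ u, ((1 - g S.1 * g T.1) * |P u S.1 T.1|) * |Q u S.2 T.2| := by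
      intro S T
      refine (le_abs_self _).trans ?_
      rw [abs_mul]
      refine (mul_le_of_le_one_right (abs_nonneg _) (habs S T)).trans ?_
      refine (Finset.abs_sum_le_sum_abs _ _).trans (Finset.sum_le_sum fun u _ => ?_)
      rw [abs_mul, abs_mul, abs_of_nonneg (hg1 _ _)]
    refine (Finset.sum_le_sum fun S _ => Finset.sum_le_sum fun T _ => this S T).trans
      (le_of_eq ?_)
    simp only [Fintype.sum_prod_type, Finset.sum_mul]
    conv_rhs => rw [Finset.sum_comm]
    refine Finset.sum_congr rfl fun S1 _ => ?_
    conv_lhs => rw [Finset.sum_comm]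
    conv_rhs => rw [Finset.sum_comm]
    refine Finset.sum_congr rfl fun T1 _ => ?_
    simp only [Finset.mul_sum]
    conv_rhs => rw [Finset.sum_comm]
    refine Finset.sum_congr rfl fun S2 _ => ?_
    rw [Finset.sum_comm]
  rw [e1, e2]
  refine add_le_add (hc.trans (le_of_eq ?_)) e3
  push_cast; ring

/-- average Kikuchi matrix -/
noncomputable def Kbar (n r h : ℕ) : Matrix (KV n r) (KV n r) ℝ :=
  fun S T => (∑ C : Fin (2 * h) → Fin n, Kik r C S T) / Fintype.card (Fin (2 * h) → Fin n)

/-- average monomial -/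
noncomputable def Gbar (n h : ℕ) : MvPolynomial (Fin n) ℝ :=
  ((Fintype.card (Fin (2 * h) → Fin n) : ℝ)⁻¹) • ∑ C : Fin (2 * h) → Fin n, Gp C

/-- sample space -/
abbrev Om (U : Type*) (n h : ℕ) : Type _ := U × (Fin (2 * h) → Fin n)

/-- centered Kikuchi matrix -/
noncomputable def PK {n h : ℕ} {U : Type*} [Fintype U] [DecidableEq U] (r : ℕ) (u : U)
    (x : Om U n h) : Matrix (KV n r) (KV n r) ℝ :=
  fun S T => (if x.1 = u then Kik r x.2 S T else 0) - (Fintype.card U : ℝ)⁻¹ * Kbar n r h S T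

/-- centered monomial -/
noncomputable def zeta {n h : ℕ} {U : Type*} [Fintype U] [DecidableEq U] (u : U)
    (x : Om U n h) : MvPolynomial (Fin n) ℝ :=
  (if x.1 = u then Gp x.2 else 0) - (Fintype.card U : ℝ)⁻¹ • Gbar n h

/-- sum of centered matrices -/
noncomputable def PL {n h : ℕ} {U J : Type*} [Fintype U] [DecidableEq U] (r : ℕ) (L : Finset J)
    (ω : J → Om U n h) (u : U) :
    Matrix (KV n r) (KV n r) ℝ := fun S T => ∑ i ∈ L, PK r u (ω i) S T

/-- sum of centered monomials -/
noncomputable def zL {n h : ℕ} {U J : Type*} [Fintype U] [DecidableEq U] (L : Finset J)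
    (ω : J → Om U n h) (u : U) :
    MvPolynomial (Fin n) ℝ := ∑ i ∈ L, zeta u (ω i)

theorem Kbar_nonneg {n r h : ℕ} (S T : KV n r) : 0 ≤ Kbar n r h S T :=
  div_nonneg (Finset.sum_nonneg fun C _ => Kik_nonneg C S T) (Nat.cast_nonneg _)

theorem Kbar_symm {n r h : ℕ} (S T : KV n r) : Kbar n r h S T = Kbar n r h T S := by
  unfold Kbar
  simp only [Kik_symm _ S T]

theorem PL_symm {n h : ℕ} {U J : Type*} [Fintype U] [DecidableEq U] (r : ℕ) (L : Finset J)
    (ω : J → Om U n h) (u : U) (S T : KV n r) : PL r L ω u S T = PL r L ω u T S := by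
  unfold PL PK
  simp only [Kik_symm _ S T, Kbar_symm S T]

theorem Kbar_repr {n r h : ℕ} (hrh : h ≤ r) :
    ∑ S : KV n r, ∑ T : KV n r, Kbar n r h S T • mon (symmDiff S.1 T.1) =
      (KD n r h : ℝ) • Gbar n h := by
  unfold Kbar Gbar
  rw [smul_comm, Finset.smul_sum]
  simp only [← Kik_repr hrh]
  simp only [div_eq_inv_mul, mul_smul, ← Finset.smul_sum, Finset.sum_smul]
  congr 1
  conv_rhs => rw [Finset.sum_comm]
  refine Finset.sum_congr rfl fun S _ => ?_
  rw [Finset.sum_comm]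

theorem PK_repr {n r h : ℕ} {U : Type*} [Fintype U] [DecidableEq U] (hrh : h ≤ r) (u : U)
    (x : Om U n h) :
    ∑ S : KV n r, ∑ T : KV n r, PK r u x S T • mon (symmDiff S.1 T.1) =
      (KD n r h : ℝ) • zeta u x := by
  unfold PK zeta
  simp only [sub_smul, Finset.sum_sub_distrib, mul_smul, ← Finset.smul_sum, Kbar_repr hrh,
    smul_sub]
  rw [smul_comm (Fintype.card U : ℝ)⁻¹]
  congr 1
  split_ifs
  · exact Kik_repr hrh _
  · simp

theorem PL_repr {n r h : ℕ} {U J : Type*} [Fintype U] [DecidableEq U] (hrh : h ≤ r) (L : Finset J)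
    (ω : J → Om U n h) (u : U) :
    ∑ S : KV n r, ∑ T : KV n r, PL r L ω u S T • mon (symmDiff S.1 T.1) =
      (KD n r h : ℝ) • zL L ω u := by
  unfold PL zL
  rw [Finset.smul_sum]
  simp only [← PK_repr hrh, Finset.sum_smul]
  conv_rhs => rw [Finset.sum_comm]
  refine Finset.sum_congr rfl fun S _ => ?_
  rw [Finset.sum_comm]

theorem Kik_col_le {n r h : ℕ} (C : Fin (2 * h) → Fin n) (T : KV n r) :
    ∑ S, Kik r C S T ≤ 1 := by
  classical
  rw [Kik_colsum]; split_ifs <;> norm_num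

theorem Kik_tot_le {n r h : ℕ} (hrh : h ≤ r) (C : Fin (2 * h) → Fin n) :
    ∑ S : KV n r, ∑ T : KV n r, Kik r C S T ≤ KD n r h := by
  by_cases hC : Function.Injective C
  · rw [← Kik_total hrh C hC, Finset.sum_comm]
  · unfold Kik
    simp [hC]

theorem Kbar_tot_le {n r h : ℕ} (hn : 0 < n) (hrh : h ≤ r) :
    ∑ S : KV n r, ∑ T : KV n r, Kbar n r h S T ≤ KD n r h := by
  have : Nonempty (Fin n) := ⟨⟨0, hn⟩⟩
  have hc : (0 : ℝ) < Fintype.card (Fin (2 * h) → Fin n) := by exact_mod_cast Fintype.card_pos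
  unfold Kbar
  simp only [← Finset.sum_div]
  rw [div_le_iff₀ hc]
  have : ∑ S : KV n r, ∑ T : KV n r, ∑ C : Fin (2 * h) → Fin n, Kik r C S T =
      ∑ C : Fin (2 * h) → Fin n, ∑ S : KV n r, ∑ T : KV n r, Kik r C S T := by
    conv_rhs => rw [Finset.sum_comm]
    refine Finset.sum_congr rfl fun S _ => ?_
    rw [Finset.sum_comm]
  rw [this]
  refine (Finset.sum_le_sum fun C _ => Kik_tot_le hrh C).trans (le_of_eq ?_)
  simp [mul_comm]

theorem Kbar_col {n r h : ℕ} (T : KV n r) :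
    ∑ S, Kbar n r h S T =
      (∑ C : Fin (2 * h) → Fin n, ∑ S, Kik r C S T) / Fintype.card (Fin (2 * h) → Fin n) := by
  unfold Kbar
  rw [← Finset.sum_div, Finset.sum_comm]

theorem Kbar_col_le {n r h : ℕ} (hn : 0 < n) (T : KV n r) : ∑ S, Kbar n r h S T ≤ 1 := by
  have : Nonempty (Fin n) := ⟨⟨0, hn⟩⟩
  have hc : (0 : ℝ) < Fintype.card (Fin (2 * h) → Fin n) := by exact_mod_cast Fintype.card_pos
  rw [Kbar_col, div_le_iff₀ hc]
  refine (Finset.sum_le_sum fun C _ => Kik_col_le C T).trans (le_of_eq ?_)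
  simp

theorem Kbar_col_le' {n r h : ℕ} (hn : 0 < n) (T : KV n r) :
    ∑ S, Kbar n r h S T ≤ (4 * (r : ℝ) / n) ^ h := by
  have : Nonempty (Fin n) := ⟨⟨0, hn⟩⟩
  have hc : (0 : ℝ) < Fintype.card (Fin (2 * h) → Fin n) := by exact_mod_cast Fintype.card_pos
  rw [Kbar_col, div_le_iff₀ hc]
  exact Kik_avg hn T

/-- entrywise bound for centered matrices -/
noncomputable def PKa {n h : ℕ} {U : Type*} [Fintype U] [DecidableEq U] (r : ℕ) (u : U)
    (x : Om U n h) (S T : KV n r) : ℝ :=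
  (if x.1 = u then Kik r x.2 S T else 0) + (Fintype.card U : ℝ)⁻¹ * Kbar n r h S T

theorem PK_abs {n h : ℕ} {U : Type*} [Fintype U] [DecidableEq U] (r : ℕ) (u : U)
    (x : Om U n h) (S T : KV n r) : |PK r u x S T| ≤ PKa r u x S T := by
  unfold PK PKa
  refine (abs_sub _ _).trans (le_of_eq ?_)
  congr 1
  · split_ifs
    · exact abs_of_nonneg (Kik_nonneg _ _ _)
    · simp
  · exact abs_of_nonneg (mul_nonneg (by positivity) (Kbar_nonneg _ _))

theorem PL_abs {n h : ℕ} {U J : Type*} [Fintype U] [DecidableEq U] (r : ℕ) (L : Finset J)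
    (ω : J → Om U n h) (u : U) (S T : KV n r) :
    |PL r L ω u S T| ≤ ∑ i ∈ L, PKa r u (ω i) S T :=
  (Finset.abs_sum_le_sum_abs _ _).trans (Finset.sum_le_sum fun _ _ => PK_abs _ _ _ _ _)

theorem PL_tot {n r h : ℕ} {U J : Type*} [Fintype U] [DecidableEq U] [Nonempty U] [Fintype J]
    (hn : 0 < n) (hrh : h ≤ r)
    (L : Finset J) (ω : J → Om U n h) (u : U) :
    ∑ S : KV n r, ∑ T : KV n r, |PL r L ω u S T| ≤ Fintype.card J * (2 * KD n r h) := by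
  have h1 : ∑ S : KV n r, ∑ T : KV n r, |PL r L ω u S T| ≤
      ∑ i ∈ L, ∑ S : KV n r, ∑ T : KV n r, PKa r u (ω i) S T := by
    refine (Finset.sum_le_sum fun S _ => Finset.sum_le_sum fun T _ => PL_abs _ _ _ _ _ _).trans
      (le_of_eq ?_)
    conv_rhs => rw [Finset.sum_comm]
    refine Finset.sum_congr rfl fun S _ => ?_
    rw [Finset.sum_comm]
  have hD : (0 : ℝ) ≤ KD n r h := Nat.cast_nonneg _
  have hν : (1 : ℝ) ≤ Fintype.card U := by exact_mod_cast Fintype.card_pos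
  have h2 : ∀ i ∈ L, ∑ S : KV n r, ∑ T : KV n r, PKa r u (ω i) S T ≤ 2 * KD n r h := by
    intro i _
    unfold PKa
    simp only [Finset.sum_add_distrib, ← Finset.mul_sum]
    have a1 : ∑ S : KV n r, ∑ T : KV n r, (if (ω i).1 = u then Kik r (ω i).2 S T else 0) ≤
        KD n r h := by
      split_ifs
      · exact Kik_tot_le hrh _
      · simp
    have a2 := Kbar_tot_le (r := r) (h := h) hn hrh
    have a3 : (Fintype.card U : ℝ)⁻¹ ≤ 1 := inv_le_one_of_one_le₀ hν
    have a4 : 0 ≤ ∑ S : KV n r, ∑ T : KV n r, Kbar n r h S T :=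
      Finset.sum_nonneg fun S _ => Finset.sum_nonneg fun T _ => Kbar_nonneg _ _
    have a5 := mul_le_of_le_one_left a4 a3
    linarith
  refine h1.trans ((Finset.sum_le_sum h2).trans ?_)
  rw [Finset.sum_const, nsmul_eq_mul]
  have : (L.card : ℝ) ≤ Fintype.card J := by exact_mod_cast Finset.card_le_univ L
  gcongr

theorem PL_col_all {n r h : ℕ} {U J : Type*} [Fintype U] [DecidableEq U] [Nonempty U] [Fintype J]
    (hn : 0 < n)
    (L : Finset J) (ω : J → Om U n h) (T : KV n r) :
    ∑ u, ∑ S : KV n r, |PL r L ω u S T| ≤ Fintype.card J * 2 := by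
  have h1 : ∑ u, ∑ S : KV n r, |PL r L ω u S T| ≤
      ∑ i ∈ L, ∑ u, ∑ S : KV n r, PKa r u (ω i) S T := by
    refine (Finset.sum_le_sum fun S _ => Finset.sum_le_sum fun T _ => PL_abs _ _ _ _ _ _).trans
      (le_of_eq ?_)
    conv_rhs => rw [Finset.sum_comm]
    refine Finset.sum_congr rfl fun S _ => ?_
    rw [Finset.sum_comm]
  have hν : (1 : ℝ) ≤ Fintype.card U := by exact_mod_cast Fintype.card_pos
  have h2 : ∀ i ∈ L, ∑ u, ∑ S : KV n r, PKa r u (ω i) S T ≤ 2 := by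
    intro i _
    unfold PKa
    simp only [Finset.sum_add_distrib, ← Finset.mul_sum]
    have a1 : ∑ u, ∑ S : KV n r, (if (ω i).1 = u then Kik r (ω i).2 S T else 0) ≤ 1 := by
      rw [Finset.sum_comm]
      simp only [Finset.sum_ite_eq, Finset.mem_univ, if_true]
      exact Kik_col_le _ _
    have a2 := Kbar_col_le (h := h) hn T
    simp only [Finset.sum_const, Finset.card_univ, nsmul_eq_mul]
    rw [← mul_assoc, inv_mul_cancel₀ (by positivity), one_mul]
    linarith
  refine h1.trans ((Finset.sum_le_sum h2).trans ?_)
  rw [Finset.sum_const, nsmul_eq_mul]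
  have : (L.card : ℝ) ≤ Fintype.card J := by exact_mod_cast Finset.card_le_univ L
  gcongr

open Classical in
theorem PL_col {n r h : ℕ} {U J : Type*} [Fintype U] [DecidableEq U] [Nonempty U] [Fintype J]
    (hn : 0 < n) (L : Finset J) (ω : J → Om U n h) (u : U) (T : KV n r) :
    ∑ S : KV n r, |PL r L ω u S T| ≤
      cnt L (fun i => (ω i).1 = u ∧ Match h (ω i).2 T.1) +
        Fintype.card J * (4 * (r : ℝ) / n) ^ h / Fintype.card U := by
  have h1 : ∑ S : KV n r, |PL r L ω u S T| ≤
      ∑ i ∈ L, ∑ S : KV n r, PKa r u (ω i) S T := by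
    refine (Finset.sum_le_sum fun S _ => PL_abs _ _ _ _ _ _).trans (le_of_eq ?_)
    rw [Finset.sum_comm]
  refine h1.trans ?_
  have h2 : ∀ i ∈ L, ∑ S : KV n r, PKa r u (ω i) S T ≤
      (if (ω i).1 = u ∧ Match h (ω i).2 T.1 then 1 else 0) +
        (4 * (r : ℝ) / n) ^ h / Fintype.card U := by
    intro i _
    unfold PKa
    simp only [Finset.sum_add_distrib, ← Finset.mul_sum]
    refine add_le_add (le_of_eq ?_) ?_
    · by_cases hu : (ω i).1 = u
      · simp only [hu, if_true, true_and]
        exact Kik_colsum _ _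
      · simp [hu]
    · rw [div_eq_inv_mul]
      exact mul_le_mul_of_nonneg_left (Kbar_col_le' hn T) (by positivity)
  refine (Finset.sum_le_sum h2).trans ?_
  rw [cnt_eq, Finset.sum_add_distrib, Finset.sum_boole, Finset.sum_const, nsmul_eq_mul,
    mul_div_assoc (Fintype.card J : ℝ)]
  have : (L.card : ℝ) ≤ Fintype.card J := by exact_mod_cast Finset.card_le_univ L
  gcongr

open Classical in
theorem PL_col_sum {n r h : ℕ} {U J : Type*} [Fintype U] [DecidableEq U] [Nonempty U] [Fintype J]
    (hn : 0 < n) (L : Finset J) (ω : J → Om U n h) (T : KV n r) :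
    ∑ u, ∑ S : KV n r, |PL r L ω u S T| ≤
      cnt L (fun i => Match h (ω i).2 T.1) +
        Fintype.card J * (4 * (r : ℝ) / n) ^ h := by
  refine (Finset.sum_le_sum fun u _ => PL_col hn L ω u T).trans (le_of_eq ?_)
  have hν : (Fintype.card U : ℝ) ≠ 0 := by exact_mod_cast Fintype.card_ne_zero
  rw [Finset.sum_add_distrib]
  congr 1
  · have : ∀ u, (cnt L (fun i => (ω i).1 = u ∧ Match h (ω i).2 T.1) : ℝ) =
        ∑ i ∈ L, if (ω i).1 = u then (if Match h (ω i).2 T.1 then 1 else 0) else 0 := by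
      intro u
      simp only [← ite_and]
      rw [cnt_eq, Finset.sum_boole]
    simp only [this]
    rw [Finset.sum_comm]
    simp only [Finset.sum_ite_eq, Finset.mem_univ, if_true]
    rw [cnt_eq, Finset.sum_boole]
  · simp only [Finset.sum_const, Finset.card_univ, nsmul_eq_mul]
    field_simp

/-- a vertex with too many matching tuples -/
def BadV {n h r : ℕ} {U J : Type*} (B dm : ℝ) (L : Finset J)
    (ω : J → Om U n h) (T : KV n r) : Prop :=
  (∃ u, B < cnt L (fun i => (ω i).1 = u ∧ Match h (ω i).2 T.1)) ∨
    dm < cnt L (fun i => Match h (ω i).2 T.1)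

open Classical in
/-- indicator of good vertices -/
noncomputable def gd {n h r : ℕ} {U J : Type*} (B dm : ℝ) (L : Finset J)
    (ω : J → Om U n h) (T : KV n r) : ℝ := if BadV B dm L ω T then 0 else 1

theorem gd_or {n h r : ℕ} {U J : Type*} (B dm : ℝ) (L : Finset J)
    (ω : J → Om U n h) (T : KV n r) : gd B dm L ω T = 0 ∨ gd B dm L ω T = 1 := by
  unfold gd; split_ifs <;> simp

/-- normalized trace moment -/
noncomputable def tau {n h : ℕ} (r : ℕ) {U J : Type*} [Fintype U] [DecidableEq U] [Fintype J]
    [DecidableEq J] (B dm : ℝ) (p : ℕ) (t : ℝ) (L : Finset J) (ω : J → Om U n h) : ℝ :=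
  ((prA (gd B dm L ω) (PL r L ω) (PL r Lᶜ ω)) ^ (2 * p)).trace / t ^ (2 * p)

/-- number of bad vertices -/
noncomputable def nbad {n h : ℕ} (r : ℕ) {U J : Type*} (B dm : ℝ) (L : Finset J)
    (ω : J → Om U n h) : ℝ := ∑ T : KV n r, (1 - gd B dm L ω T)

theorem rem_bound {n r h : ℕ} {U J : Type*} [Fintype U] [DecidableEq U] [Nonempty U] [Fintype J]
    [DecidableEq J] (hn : 0 < n) (hrh : h ≤ r) (L : Finset J) (ω : J → Om U n h) (B dm : ℝ) :
    ∑ u, (∑ S : KV n r, ∑ T : KV n r, (1 - gd B dm L ω S * gd B dm L ω T) * |PL r L ω u S T|) *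
      (∑ S : KV n r, ∑ T : KV n r, |PL r Lᶜ ω u S T|) ≤
      8 * (Fintype.card J : ℝ) ^ 2 * KD n r h * nbad r B dm L ω := by
  set g := gd (r := r) B dm L ω with hgdef
  have hg : ∀ S, g S = 0 ∨ g S = 1 := gd_or B dm L ω
  have hm : (0 : ℝ) ≤ Fintype.card J := Nat.cast_nonneg _
  have hD : (0 : ℝ) ≤ KD n r h := Nat.cast_nonneg _
  have hg1 : ∀ S T, 0 ≤ 1 - g S * g T := by
    intro S T
    rcases hg S with h | h <;> rcases hg T with h' | h' <;> rw [h, h'] <;> norm_num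
  have hg2 : ∀ S T, 1 - g S * g T ≤ (1 - g S) + (1 - g T) := by
    intro S T
    rcases hg S with h | h <;> rcases hg T with h' | h' <;> rw [h, h'] <;> norm_num
  have hg3 : ∀ S, 0 ≤ 1 - g S := by
    intro S
    rcases hg S with h | h <;> rw [h] <;> norm_num
  have step1 : ∑ u, (∑ S : KV n r, ∑ T : KV n r, (1 - g S * g T) * |PL r L ω u S T|) *
      (∑ S : KV n r, ∑ T : KV n r, |PL r Lᶜ ω u S T|) ≤
      (∑ u, ∑ S : KV n r, ∑ T : KV n r, (1 - g S * g T) * |PL r L ω u S T|) *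
        (Fintype.card J * (2 * KD n r h)) := by
    rw [Finset.sum_mul]
    refine Finset.sum_le_sum fun u _ => ?_
    refine mul_le_mul_of_nonneg_left (PL_tot hn hrh _ _ _) ?_
    exact Finset.sum_nonneg fun S _ => Finset.sum_nonneg fun T _ =>
      mul_nonneg (hg1 S T) (abs_nonneg _)
  have step2 : ∑ u, ∑ S : KV n r, ∑ T : KV n r, (1 - g S * g T) * |PL r L ω u S T| ≤
      2 * (∑ T, (1 - g T) * ∑ u, ∑ S, |PL r L ω u S T|) := by
    have a1 : ∑ u, ∑ S : KV n r, ∑ T : KV n r, (1 - g S * g T) * |PL r L ω u S T| ≤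
        ∑ u, ∑ S : KV n r, ∑ T : KV n r,
          ((1 - g S) * |PL r L ω u S T| + (1 - g T) * |PL r L ω u S T|) := by
      refine Finset.sum_le_sum fun u _ => Finset.sum_le_sum fun S _ =>
        Finset.sum_le_sum fun T _ => ?_
      rw [← add_mul]
      exact mul_le_mul_of_nonneg_right (hg2 S T) (abs_nonneg _)
    refine a1.trans (le_of_eq ?_)
    simp only [Finset.sum_add_distrib]
    rw [two_mul]
    have b2 : ∑ u, ∑ S : KV n r, ∑ T : KV n r, (1 - g T) * |PL r L ω u S T| =
        ∑ T, (1 - g T) * ∑ u, ∑ S, |PL r L ω u S T| := by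
      simp only [Finset.mul_sum]
      conv_rhs => rw [Finset.sum_comm]
      refine Finset.sum_congr rfl fun u _ => ?_
      rw [Finset.sum_comm]
    have b1 : ∑ u, ∑ S : KV n r, ∑ T : KV n r, (1 - g S) * |PL r L ω u S T| =
        ∑ T, (1 - g T) * ∑ u, ∑ S, |PL r L ω u S T| := by
      rw [← b2]
      refine Finset.sum_congr rfl fun u _ => ?_
      rw [Finset.sum_comm]
      refine Finset.sum_congr rfl fun S _ => Finset.sum_congr rfl fun T _ => ?_
      rw [PL_symm r L ω u T S]
    rw [b1, b2]
  have step3 : ∑ T, (1 - g T) * ∑ u, ∑ S, |PL r L ω u S T| ≤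
      (Fintype.card J * 2) * nbad r B dm L ω := by
    unfold nbad
    rw [mul_comm, Finset.sum_mul]
    exact Finset.sum_le_sum fun T _ =>
      mul_le_mul_of_nonneg_left (PL_col_all hn L ω T) (hg3 T)
  refine step1.trans ?_
  calc _ ≤ (2 * ((Fintype.card J * 2) * nbad r B dm L ω)) * (Fintype.card J * (2 * KD n r h)) := by
        refine mul_le_mul_of_nonneg_right (step2.trans ?_) (by positivity)
        linarith
    _ = _ := by ring

theorem certL {n d r h : ℕ} {U J : Type*} [Fintype U] [DecidableEq U] [Nonempty U] [Fintype J]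
    [DecidableEq J] (E : PseudoExpectation n d) (hrd : 4 * r ≤ d) (hn : 0 < n) (hrh : h ≤ r)
    (L : Finset J) (ω : J → Om U n h) (B dm : ℝ) (p : ℕ) (hp : 0 < p) (t : ℝ) (ht : 0 < t) :
    (KD n r h : ℝ) ^ 2 * ∑ u, E.toFun (zL L ω u * zL Lᶜ ω u) ≤
      (Fintype.card (KV n r) : ℝ) ^ 2 * (t * (1 + tau r B dm p t L ω))
      + 8 * (Fintype.card J : ℝ) ^ 2 * KD n r h * nbad r B dm L ω := by
  have h1 := core E hrd (PL r L ω) (PL r Lᶜ ω) (zL L ω) (zL Lᶜ ω) (KD n r h)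
    (PL_symm r L ω) (PL_symm r Lᶜ ω) (PL_repr hrh L ω) (PL_repr hrh Lᶜ ω) (gd B dm L ω)
    (gd_or B dm L ω) p hp t ht
  refine h1.trans (add_le_add le_rfl (rem_bound hn hrh L ω B dm))

theorem split_sum {J R : Type*} [DecidableEq J] [CommRing R] (s : Finset J) (a : J → R) :
    4 * ∑ L ∈ s.powerset, (∑ i ∈ L, a i) * (∑ i ∈ s \ L, a i) =
      2 ^ s.card * ((∑ i ∈ s, a i) ^ 2 - ∑ i ∈ s, a i ^ 2) := by
  induction s using Finset.induction_on with
  | empty => simp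
  | insert x s hx ih =>
    rw [Finset.sum_powerset_insert hx, Finset.card_insert_of_notMem hx, Finset.sum_insert hx,
      Finset.sum_insert hx]
    have e1 : ∀ L ∈ s.powerset, (∑ i ∈ L, a i) * (∑ i ∈ insert x s \ L, a i) =
        (∑ i ∈ L, a i) * (∑ i ∈ s \ L, a i) + a x * ∑ i ∈ L, a i := by
      intro L hL
      rw [Finset.mem_powerset] at hL
      have hxL : x ∉ L := fun h => hx (hL h)
      rw [Finset.insert_sdiff_of_notMem _ hxL, Finset.sum_insert (by simp [hx])]
      ring
    have e2 : ∀ L ∈ s.powerset, (∑ i ∈ insert x L, a i) * (∑ i ∈ insert x s \ insert x L, a i) =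
        (∑ i ∈ L, a i) * (∑ i ∈ s \ L, a i) + a x * ∑ i ∈ s \ L, a i := by
      intro L hL
      rw [Finset.mem_powerset] at hL
      have hxL : x ∉ L := fun h => hx (hL h)
      have : insert x s \ insert x L = s \ L := by
        ext y; simp only [Finset.mem_sdiff, Finset.mem_insert]
        constructor
        · rintro ⟨h1, h2⟩; tauto
        · rintro ⟨h1, h2⟩
          refine ⟨Or.inr h1, ?_⟩
          rintro (h3 | h3)
          · exact hx (h3 ▸ h1)
          · exact h2 h3
      rw [this, Finset.sum_insert hxL]
      ring
    rw [Finset.sum_congr rfl e1, Finset.sum_congr rfl e2]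
    simp only [Finset.sum_add_distrib]
    have e3 : ∑ L ∈ s.powerset, a x * ∑ i ∈ L, a i + ∑ L ∈ s.powerset, a x * ∑ i ∈ s \ L, a i =
        2 ^ s.card * (a x * ∑ i ∈ s, a i) := by
      rw [← Finset.sum_add_distrib]
      have : ∀ L ∈ s.powerset, a x * ∑ i ∈ L, a i + a x * ∑ i ∈ s \ L, a i =
          a x * ∑ i ∈ s, a i := by
        intro L hL
        rw [Finset.mem_powerset] at hL
        rw [← mul_add, add_comm, Finset.sum_sdiff hL]
      rw [Finset.sum_congr rfl this, Finset.sum_const, Finset.card_powerset]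
      simp
    linear_combination 2 * ih + 4 * e3

theorem PE_Gbar_sq {n d h : ℕ} (hn : 0 < n) (E : PseudoExpectation n d) (hd : 4 * h ≤ d) :
    E.toFun (Gbar n h ^ 2) ≤ 1 := by
  have : Nonempty (Fin n) := ⟨⟨0, hn⟩⟩
  have hc : (0 : ℝ) < Fintype.card (Fin (2 * h) → Fin n) := by exact_mod_cast Fintype.card_pos
  unfold Gbar
  rw [smul_pow, map_smul, sq (∑ C, Gp C), Finset.sum_mul_sum, map_sum]
  simp only [map_sum]
  have : ∑ C : Fin (2 * h) → Fin n, ∑ C' : Fin (2 * h) → Fin n, E.toFun (Gp C * Gp C') ≤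
      ∑ C : Fin (2 * h) → Fin n, ∑ C' : Fin (2 * h) → Fin n, 1 := by
    refine Finset.sum_le_sum fun C _ => Finset.sum_le_sum fun C' _ => ?_
    refine (le_abs_self _).trans (PE_abs E _ _ ?_ ?_ (PE_Gp_sq E C (by omega))
      (PE_Gp_sq E C' (by omega)))
    · have := Gp_deg C; omega
    · have := Gp_deg C'; omega
  simp only [Finset.sum_const, Finset.card_univ, nsmul_eq_mul, mul_one] at this
  rw [smul_eq_mul, inv_pow, inv_mul_le_iff₀ (by positivity)]
  linarith

theorem Gbar_deg {n h : ℕ} : (Gbar n h).totalDegree ≤ 2 * h := by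
  unfold Gbar
  exact (MvPolynomial.totalDegree_smul_le _ _).trans
    (MvPolynomial.totalDegree_finsetSum_le fun C _ => Gp_deg C)

theorem zeta_deg {n h : ℕ} {U : Type*} [Fintype U] [DecidableEq U] (u : U) (x : Om U n h) :
    (zeta u x).totalDegree ≤ 2 * h := by
  unfold zeta
  refine (MvPolynomial.totalDegree_sub _ _).trans (max_le ?_ ?_)
  · split_ifs
    · exact Gp_deg _
    · simp
  · exact (MvPolynomial.totalDegree_smul_le _ _).trans Gbar_deg

theorem zL_deg {n h : ℕ} {U J : Type*} [Fintype U] [DecidableEq U] (L : Finset J)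
    (ω : J → Om U n h) (u : U) : (zL L ω u).totalDegree ≤ 2 * h :=
  MvPolynomial.totalDegree_finsetSum_le fun _ _ => zeta_deg _ _

theorem diag_bound {n d h : ℕ} {U : Type*} [Fintype U] [DecidableEq U] [Nonempty U]
    (hn : 0 < n) (E : PseudoExpectation n d) (hd : 4 * h ≤ d) (x : Om U n h) :
    ∑ u, E.toFun (zeta u x ^ 2) ≤ 4 := by
  have hν : (1 : ℝ) ≤ Fintype.card U := by exact_mod_cast Fintype.card_pos
  have key : ∀ u, E.toFun (zeta u x ^ 2) ≤
      2 * (if x.1 = u then 1 else 0) + 2 * ((Fintype.card U : ℝ)⁻¹) := by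
    intro u
    set a : MvPolynomial (Fin n) ℝ := if x.1 = u then Gp x.2 else 0 with ha
    set b : MvPolynomial (Fin n) ℝ := (Fintype.card U : ℝ)⁻¹ • Gbar n h with hb
    have hz : zeta u x = a - b := rfl
    have had : a.totalDegree ≤ 2 * h := by
      rw [ha]; split_ifs
      · exact Gp_deg _
      · simp
    have hbd : b.totalDegree ≤ 2 * h := (MvPolynomial.totalDegree_smul_le _ _).trans Gbar_deg
    have h1 := E.posSq (a + b) (by have := MvPolynomial.totalDegree_add a b; omega)
    have e1 : (a - b) ^ 2 = (2 : ℝ) • a ^ 2 + (2 : ℝ) • b ^ 2 - (a + b) ^ 2 := by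
      rw [two_smul, two_smul]; ring
    rw [hz, e1, map_sub, map_add, map_smul, map_smul, smul_eq_mul, smul_eq_mul]
    have ha1 : E.toFun (a ^ 2) ≤ if x.1 = u then 1 else 0 := by
      rw [ha]; split_ifs
      · exact PE_Gp_sq E _ (by omega)
      · simp
    have hb1 : E.toFun (b ^ 2) ≤ (Fintype.card U : ℝ)⁻¹ := by
      rw [hb, smul_pow, map_smul, smul_eq_mul]
      have h2 := PE_Gbar_sq hn E hd
      have h3 : (Fintype.card U : ℝ)⁻¹ ≤ 1 := inv_le_one_of_one_le₀ hν
      have h4 : 0 ≤ (Fintype.card U : ℝ)⁻¹ := by positivity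
      calc _ ≤ (Fintype.card U : ℝ)⁻¹ ^ 2 * 1 := by gcongr
        _ ≤ _ := by rw [mul_one, sq]; exact mul_le_of_le_one_left h4 h3
    linarith
  refine (Finset.sum_le_sum fun u _ => key u).trans ?_
  rw [Finset.sum_add_distrib, ← Finset.mul_sum]
  simp only [Finset.sum_ite_eq, Finset.mem_univ, if_true, Finset.sum_const, Finset.card_univ,
    nsmul_eq_mul]
  have : (Fintype.card U : ℝ) * (2 * (Fintype.card U : ℝ)⁻¹) = 2 := by
    field_simp
  rw [this]; norm_num

theorem cert_all {n d r h : ℕ} {U J : Type*} [Fintype U] [DecidableEq U] [Nonempty U] [Fintype J]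
    [DecidableEq J] [Nonempty J]
    (E : PseudoExpectation n d) (hrd : 4 * r ≤ d) (hn : 0 < n) (hh : 1 ≤ h) (hrh : h ≤ r)
    (ω : J → Om U n h) (B dm : ℝ) (p : ℕ) (hp : 0 < p) (t : ℝ) (ht : 0 < t)
    (f : U → MvPolynomial (Fin n) ℝ) (hf : ∀ u, (f u).totalDegree ≤ 1)
    (hf1 : ∀ u, E.toFun (f u ^ 2) ≤ 1) (η : ℝ) (hη : 0 < η)
    (hD : 0 < KD n r h) :
    E.toFun (∑ i, f (ω i).1 * Gp (ω i).2) -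
      Fintype.card J * E.toFun (∑ u, (Fintype.card U : ℝ)⁻¹ • (f u * Gbar n h)) ≤
    η * Fintype.card J / 2 + Fintype.card U / (2 * η * Fintype.card J) *
      (4 * Fintype.card J + 4 * ((2 : ℝ) ^ Fintype.card J)⁻¹ * ∑ L : Finset J,
        ((Fintype.card (KV n r) : ℝ) ^ 2 * (t * (1 + tau r B dm p t L ω))
          + 8 * (Fintype.card J : ℝ) ^ 2 * KD n r h * nbad r B dm L ω) / (KD n r h : ℝ) ^ 2) := by
  have hν : (0 : ℝ) < Fintype.card U := by exact_mod_cast Fintype.card_pos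
  have hm : (0 : ℝ) < Fintype.card J := by exact_mod_cast Fintype.card_pos
  have hD' : (0 : ℝ) < KD n r h := by exact_mod_cast hD
  have e1 : E.toFun (∑ i, f (ω i).1 * Gp (ω i).2) -
      Fintype.card J * E.toFun (∑ u, (Fintype.card U : ℝ)⁻¹ • (f u * Gbar n h)) =
      ∑ u, E.toFun (f u * zL univ ω u) := by
    have hs : (Fintype.card J : ℝ) * E.toFun (∑ u, (Fintype.card U : ℝ)⁻¹ • (f u * Gbar n h)) =
        E.toFun ((Fintype.card J : ℝ) • ∑ u, (Fintype.card U : ℝ)⁻¹ • (f u * Gbar n h)) := by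
      rw [map_smul, smul_eq_mul]
    rw [hs, ← map_sum, ← map_sub]
    congr 1
    unfold zL zeta
    simp only [Finset.sum_sub_distrib, mul_sub, Finset.mul_sum]
    congr 1
    · rw [Finset.sum_comm]
      refine Finset.sum_congr rfl fun i _ => ?_
      simp
    · rw [Finset.smul_sum]
      refine Finset.sum_congr rfl fun u _ => ?_
      rw [← Finset.mul_sum, Finset.sum_const, Finset.card_univ, mul_smul_comm, mul_smul_comm,
        Nat.cast_smul_eq_nsmul]
  have e2 : ∀ u, E.toFun (f u * zL univ ω u) ≤
      η * Fintype.card J / (2 * Fintype.card U) +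
        Fintype.card U / (2 * η * Fintype.card J) * E.toFun (zL univ ω u ^ 2) := by
    intro u
    set z := zL univ ω u with hz
    set α : ℝ := η * Fintype.card J / Fintype.card U with hα
    have hα0 : 0 < α := by positivity
    have h1 := E.posSq (α • f u - z) (by
      have h2 := MvPolynomial.totalDegree_sub (α • f u) z
      have h3 := MvPolynomial.totalDegree_smul_le α (f u)
      have h4 := zL_deg univ ω u
      have h5 := hf u
      rw [← hz] at h4
      have : (α • f u - z).totalDegree ≤ 2 * h := by
        refine h2.trans (max_le ?_ h4); omega
      omega)
    have e : (α • f u - z) ^ 2 = (α ^ 2) • (f u ^ 2) + z ^ 2 - (2 * α) • (f u * z) := by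
      simp only [MvPolynomial.smul_eq_C_mul, map_mul, map_pow, map_ofNat]
      ring
    rw [e, map_sub, map_add, map_smul, map_smul, smul_eq_mul, smul_eq_mul] at h1
    have h6 := hf1 u
    have h7 : 2 * α * E.toFun (f u * z) ≤ α ^ 2 + E.toFun (z ^ 2) := by nlinarith
    have h8 : E.toFun (f u * z) ≤ (α ^ 2 + E.toFun (z ^ 2)) / (2 * α) := by
      rw [le_div_iff₀ (by positivity)]; linarith
    refine h8.trans (le_of_eq ?_)
    rw [hα]; field_simp
  have e3 : ∑ u, E.toFun (zL univ ω u ^ 2) ≤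
      4 * Fintype.card J + 4 * ((2 : ℝ) ^ Fintype.card J)⁻¹ * ∑ L : Finset J,
        ((Fintype.card (KV n r) : ℝ) ^ 2 * (t * (1 + tau r B dm p t L ω))
          + 8 * (Fintype.card J : ℝ) ^ 2 * KD n r h * nbad r B dm L ω) / (KD n r h : ℝ) ^ 2 := by
    have a1 : ∀ u, E.toFun (zL univ ω u ^ 2) = ∑ i, E.toFun (zeta u (ω i) ^ 2) +
        4 * ((2 : ℝ) ^ Fintype.card J)⁻¹ * ∑ L : Finset J, E.toFun (zL L ω u * zL Lᶜ ω u) := by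
      intro u
      have h1 := split_sum univ (fun i => zeta u (ω i))
      rw [Finset.powerset_univ, Finset.card_univ] at h1
      have h2 := congrArg E.toFun h1
      have e4 : (4 : MvPolynomial (Fin n) ℝ) = MvPolynomial.C 4 := (map_ofNat _ _).symm
      have e5 : (2 : MvPolynomial (Fin n) ℝ) ^ Fintype.card J =
          MvPolynomial.C ((2 : ℝ) ^ Fintype.card J) := by
        rw [map_pow, map_ofNat]
      rw [e4, e5, ← MvPolynomial.smul_eq_C_mul, ← MvPolynomial.smul_eq_C_mul, map_smul, map_smul,
        smul_eq_mul, smul_eq_mul, map_sub, map_sum, map_sum] at h2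
      have h3 : ∑ L : Finset J, E.toFun (zL L ω u * zL Lᶜ ω u) =
          ∑ L : Finset J, E.toFun ((∑ i ∈ L, zeta u (ω i)) * ∑ i ∈ univ \ L, zeta u (ω i)) := by
        refine Finset.sum_congr rfl fun L _ => ?_
        rw [← Finset.compl_eq_univ_sdiff]; rfl
      rw [h3, mul_assoc, mul_left_comm, h2]
      unfold zL
      field_simp
      ring
    simp only [a1]
    rw [Finset.sum_add_distrib, Finset.sum_comm, ← Finset.mul_sum]
    refine add_le_add ?_ ?_
    · refine (Finset.sum_le_sum fun i _ => diag_bound hn E (by omega) (ω i)).trans (le_of_eq ?_)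
      simp [mul_comm]
    · refine mul_le_mul_of_nonneg_left ?_ (by positivity)
      rw [Finset.sum_comm]
      refine Finset.sum_le_sum fun L _ => ?_
      rw [le_div_iff₀ (by positivity), mul_comm]
      exact certL E hrd hn hrh L ω B dm p hp t ht
  rw [e1]
  refine (Finset.sum_le_sum fun u _ => e2 u).trans ?_
  rw [Finset.sum_add_distrib, ← Finset.mul_sum, Finset.sum_const, Finset.card_univ, nsmul_eq_mul]
  refine add_le_add (le_of_eq ?_) (mul_le_mul_of_nonneg_left e3 (by positivity))
  field_simp

theorem PL_congr {n h : ℕ} {U J : Type*} [Fintype U] [DecidableEq U] (r : ℕ) (L : Finset J)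
    (a a' : J → Om U n h) (hh : ∀ j ∈ L, a j = a' j) : PL r L a = PL r L a' := by
  funext u S T
  exact Finset.sum_congr rfl fun i hi => by rw [hh i hi]

theorem gd_congr {n h r : ℕ} {U J : Type*} (B dm : ℝ) (L : Finset J)
    (a a' : J → Om U n h) (hh : ∀ j ∈ L, a j = a' j) :
    (gd B dm L a : KV n r → ℝ) = gd B dm L a' := by
  classical
  funext T
  have : BadV B dm L a T ↔ BadV B dm L a' T := by
    have h1 : ∀ u, cnt L (fun i => (a i).1 = u ∧ Match h (a i).2 T.1) =
        cnt L (fun i => (a' i).1 = u ∧ Match h (a' i).2 T.1) := fun u =>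
      cnt_congr _ _ _ fun i hi => by rw [hh i hi]
    have h2 : cnt L (fun i => Match h (a i).2 T.1) =
        cnt L (fun i => Match h (a' i).2 T.1) :=
      cnt_congr _ _ _ fun i hi => by rw [hh i hi]
    unfold BadV
    rw [h2]
    simp only [h1]
  unfold gd
  simp only [this]

theorem gd_good {n h r : ℕ} {U J : Type*} (B dm : ℝ) (L : Finset J)
    (ω : J → Om U n h) (T : KV n r) (hg : gd B dm L ω T ≠ 0) :
    (∀ u, (cnt L (fun i => (ω i).1 = u ∧ Match h (ω i).2 T.1) : ℝ) ≤ B) ∧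
    (cnt L (fun i => Match h (ω i).2 T.1) : ℝ) ≤ dm := by
  have : ¬ BadV B dm L ω T := by
    intro hb; apply hg; unfold gd; rw [if_pos hb]
  unfold BadV at this
  push Not at this
  exact this

theorem prA_moment {n r h : ℕ} {U J : Type*} [Fintype U] [DecidableEq U] [Nonempty U] [Fintype J]
    [DecidableEq J] [Nonempty J] (hn : 0 < n) (L : Finset J) (a : J → Om U n h) (B dm qb : ℝ)
    (hqb : qb = (4 * (r : ℝ) / n) ^ h) (hqb0 : 0 < qb)
    (hB : 0 ≤ B) (hdm : 0 ≤ dm) (p : ℕ) (hp : 0 < p)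
    (hpb : p * (B + Fintype.card J * qb / Fintype.card U) ≤
      Fintype.card J * ((dm + Fintype.card J * qb) * qb / Fintype.card U)) :
    ∑ ω : J → Om U n h, ((prA (gd (r := r) B dm L a) (PL r L a) (PL r Lᶜ ω)) ^ (2 * p)).trace ≤
      Fintype.card (J → Om U n h) * (Fintype.card (KV n r)) ^ 2 *
      (36 * (Fintype.card J * ((dm + Fintype.card J * qb) * qb / Fintype.card U)) *
        (B + Fintype.card J * qb / Fintype.card U) * p) ^ p := by
  have : Nonempty (Fin n) := ⟨⟨0, hn⟩⟩
  have hν : (0 : ℝ) < Fintype.card U := by exact_mod_cast Fintype.card_pos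
  have hm : (0 : ℝ) < Fintype.card J := by exact_mod_cast Fintype.card_pos
  have hc : (0 : ℝ) < Fintype.card (Fin (2 * h) → Fin n) := by exact_mod_cast Fintype.card_pos
  set g := gd (r := r) B dm L a with hgdef
  have hg : ∀ S, g S = 0 ∨ g S = 1 := gd_or B dm L a
  set M : Om U n h → Matrix (KV n r × KV n r) (KV n r × KV n r) ℝ := fun x S T =>
    (g S.1 * g T.1 * PL r L a x.1 S.1 T.1) * Kik r x.2 S.2 T.2 with hM
  set Mbar : Matrix (KV n r × KV n r) (KV n r × KV n r) ℝ := fun S T =>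
    (∑ x, M x S T) / Fintype.card (Om U n h) with hMbar
  have hcardΩ : (Fintype.card (Om U n h) : ℝ) =
      Fintype.card U * Fintype.card (Fin (2 * h) → Fin n) := by
    rw [Fintype.card_prod]; push_cast; rfl
  have eMb : ∀ S T, Mbar S T =
      ∑ u, (g S.1 * g T.1 * PL r L a u S.1 T.1) *
        ((Fintype.card U : ℝ)⁻¹ * Kbar n r h S.2 T.2) := by
    intro S T
    simp only [hMbar, hM]
    rw [hcardΩ, Fintype.sum_prod_type, Finset.sum_div]
    refine Finset.sum_congr rfl fun u _ => ?_
    simp only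
    rw [← Finset.mul_sum]
    unfold Kbar
    field_simp
  have eA : ∀ ω : J → Om U n h, prA g (PL r L a) (PL r Lᶜ ω) =
      ∑ j ∈ Lᶜ, (M (ω j) - Mbar) := by
    intro ω
    ext S T
    rw [Matrix.sum_apply]
    simp only [Matrix.sub_apply, eMb]
    unfold prA
    have : ∀ u, PL r Lᶜ ω u S.2 T.2 = ∑ j ∈ Lᶜ, PK r u (ω j) S.2 T.2 := fun u => rfl
    simp only [this, Finset.mul_sum]
    rw [Finset.sum_comm]
    refine Finset.sum_congr rfl fun j _ => ?_
    unfold PK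
    simp only [mul_sub, Finset.sum_sub_distrib]
    congr 1
    simp only [hM, mul_ite, mul_zero, Finset.sum_ite_eq, Finset.mem_univ, if_true]
  simp only [eA]
  have hcol : ∀ u (T : KV n r), ∑ S, |g S * g T * PL r L a u S T| ≤
      |g T| * ∑ S, |PL r L a u S T| := by
    intro u T
    rw [Finset.mul_sum]
    refine Finset.sum_le_sum fun S _ => ?_
    rw [abs_mul, abs_mul]
    refine mul_le_mul_of_nonneg_right ?_ (abs_nonneg _)
    refine mul_le_of_le_one_left (abs_nonneg _) ?_
    rcases hg S with h | h <;> rw [h] <;> norm_num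
  have hMsum : ∀ x T, ∑ v, |M x v T| =
      (∑ S, |g S * g T.1 * PL r L a x.1 S T.1|) * ∑ S, Kik r x.2 S T.2 := by
    intro x T
    rw [Fintype.sum_prod_type, Finset.sum_mul_sum]
    refine Finset.sum_congr rfl fun S _ => Finset.sum_congr rfl fun S' _ => ?_
    simp only [hM]
    rw [abs_mul _ (Kik r x.2 S' T.2), abs_of_nonneg (Kik_nonneg _ _ _)]
  have hK0 : ∀ C (T : KV n r), 0 ≤ ∑ S, Kik r (C : Fin (2 * h) → Fin n) S T := fun C T =>
    Finset.sum_nonneg fun S _ => Kik_nonneg _ _ _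
  have hb0 : 0 < B + Fintype.card J * qb / Fintype.card U := by positivity
  have h1 : ∀ x T, ∑ v, |M x v T| ≤ B + Fintype.card J * qb / Fintype.card U := by
    intro x T
    rw [hMsum]
    refine (mul_le_of_le_one_right (Finset.sum_nonneg fun _ _ => abs_nonneg _)
      (Kik_col_le _ _)).trans ((hcol _ _).trans ?_)
    by_cases hT : g T.1 = 0
    · rw [hT, abs_zero, zero_mul]; exact hb0.le
    · have h2 := (gd_good B dm L a T.1 hT).1 x.1
      have h3 := PL_col (r := r) hn L a x.1 T.1
      have : |g T.1| = 1 := by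
        rcases hg T.1 with h | h
        · exact absurd h hT
        · rw [h]; norm_num
      rw [this, one_mul]
      rw [← hqb] at h3
      linarith
  have h2 : ∀ T, ∑ x, ∑ v, |M x v T| ≤
      ((dm + Fintype.card J * qb) * qb / Fintype.card U) * Fintype.card (Om U n h) := by
    intro T
    simp only [hMsum]
    rw [Fintype.sum_prod_type]
    simp only
    have e : ∀ u, ∑ C : Fin (2 * h) → Fin n,
        (∑ S, |g S * g T.1 * PL r L a u S T.1|) * ∑ S, Kik r C S T.2 =
        (∑ S, |g S * g T.1 * PL r L a u S T.1|) *
          ∑ C : Fin (2 * h) → Fin n, ∑ S, Kik r C S T.2 := fun u => by rw [Finset.mul_sum]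
    simp only [e]
    rw [← Finset.sum_mul]
    have hA : ∑ u, ∑ S, |g S * g T.1 * PL r L a u S T.1| ≤ dm + Fintype.card J * qb := by
      refine (Finset.sum_le_sum fun u _ => hcol u T.1).trans ?_
      rw [← Finset.mul_sum]
      by_cases hT : g T.1 = 0
      · rw [hT, abs_zero, zero_mul]; positivity
      · have h2 := (gd_good B dm L a T.1 hT).2
        have h3 := PL_col_sum (r := r) hn L a T.1
        have : |g T.1| = 1 := by
          rcases hg T.1 with h | h
          · exact absurd h hT
          · rw [h]; norm_num
        rw [this, one_mul]
        rw [← hqb] at h3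
        linarith
    have hBB := Kik_avg (h := h) hn T.2
    rw [← hqb] at hBB
    calc _ ≤ (dm + Fintype.card J * qb) * (qb * Fintype.card (Fin (2 * h) → Fin n)) :=
          mul_le_mul hA hBB (Finset.sum_nonneg fun C _ => hK0 C _) (by positivity)
      _ = _ := by rw [hcardΩ]; field_simp
  have hfin := moment_uncentered M Mbar Lᶜ ((dm + Fintype.card J * qb) * qb / Fintype.card U)
    (B + Fintype.card J * qb / Fintype.card U) (by positivity) hb0 (fun S T => rfl) h1 h2 p hp hpb
  refine hfin.trans (le_of_eq ?_)
  rw [Fintype.card_prod]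
  push_cast
  ring

theorem tau_avg {n r h : ℕ} {U J : Type*} [Fintype U] [DecidableEq U] [Nonempty U] [Fintype J]
    [DecidableEq J] [Nonempty J] (hn : 0 < n) (L : Finset J) (B dm qb : ℝ)
    (hqb : qb = (4 * (r : ℝ) / n) ^ h) (hqb0 : 0 < qb)
    (hB : 0 ≤ B) (hdm : 0 ≤ dm) (p : ℕ) (hp : 0 < p) (t : ℝ) (ht : 0 < t)
    (hpb : p * (B + Fintype.card J * qb / Fintype.card U) ≤
      Fintype.card J * ((dm + Fintype.card J * qb) * qb / Fintype.card U)) :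
    ∑ ω : J → Om U n h, tau r B dm p t L ω ≤
      Fintype.card (J → Om U n h) * ((Fintype.card (KV n r)) ^ 2 *
      (36 * (Fintype.card J * ((dm + Fintype.card J * qb) * qb / Fintype.card U)) *
        (B + Fintype.card J * qb / Fintype.card U) * p / t ^ 2) ^ p) := by
  have : Nonempty (Fin n) := ⟨⟨0, hn⟩⟩
  have hΩ : (0 : ℝ) < Fintype.card (J → Om U n h) := by exact_mod_cast Fintype.card_pos
  unfold tau
  rw [← Finset.sum_div, div_pow, ← pow_mul, ← mul_div_assoc, ← mul_div_assoc]
  refine div_le_div_of_nonneg_right ?_ (by positivity)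
  have hr := resample L (fun a b : J → Om U n h =>
    ((prA (gd (r := r) B dm L a) (PL r L a) (PL r Lᶜ b)) ^ (2 * p)).trace)
    (fun a a' b hh => by simp only [gd_congr B dm L a a' hh, PL_congr r L a a' hh])
    (fun a b b' hh => by
      simp only [PL_congr r Lᶜ b b' (fun j hj => hh j (by simpa using hj))])
  have hs := Finset.sum_le_sum (s := univ) fun (a : J → Om U n h) _ =>
    prA_moment hn L a B dm qb hqb hqb0 hB hdm p hp hpb
  rw [← hr, Finset.sum_const, Finset.card_univ, nsmul_eq_mul] at hs
  have := le_of_mul_le_mul_left hs hΩ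
  refine this.trans (le_of_eq ?_)
  ring

theorem nbad_avg {n r h : ℕ} {U J : Type*} [Fintype U] [DecidableEq U] [Nonempty U] [Fintype J]
    [DecidableEq J]
    (hn : 0 < n) (L : Finset J) (B dm qb : ℝ)
    (hqb : qb = (4 * (r : ℝ) / n) ^ h) (hqb0 : 0 < qb) :
    ∑ ω : J → Om U n h, nbad r B dm L ω ≤
      Fintype.card (J → Om U n h) * (Fintype.card (KV n r) *
        (Fintype.card U * (Real.exp (Fintype.card J * (qb / Fintype.card U)) * 2 ^ (-B)) +
          Real.exp (Fintype.card J * qb) * 2 ^ (-dm))) := by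
  have hν : (0 : ℝ) < Fintype.card U := by exact_mod_cast Fintype.card_pos
  have hcardΩ : (Fintype.card (Om U n h) : ℝ) =
      Fintype.card U * Fintype.card (Fin (2 * h) → Fin n) := by
    rw [Fintype.card_prod]; push_cast; rfl
  classical
  unfold nbad
  rw [Finset.sum_comm]
  have key : ∀ T : KV n r, ∑ ω : J → Om U n h, (1 - gd B dm L ω T) ≤
      Fintype.card (J → Om U n h) *
        (Fintype.card U * (Real.exp (Fintype.card J * (qb / Fintype.card U)) * 2 ^ (-B)) +
          Real.exp (Fintype.card J * qb) * 2 ^ (-dm)) := by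
    intro T
    have hmatch : ((univ.filter (fun C : Fin (2 * h) → Fin n => Match h C T.1)).card : ℝ) ≤
        qb * Fintype.card (Fin (2 * h) → Fin n) := by
      have := Kik_avg (h := h) hn T
      simp only [Kik_colsum] at this
      rw [Finset.sum_boole, ← hqb] at this
      exact this
    have c1 : ∀ u : U, (cnt univ (fun x : Om U n h => x.1 = u ∧ Match h x.2 T.1) : ℝ) ≤
        (qb / Fintype.card U) * Fintype.card (Om U n h) := by
      intro u
      rw [cnt_eq]
      have : univ.filter (fun x : Om U n h => x.1 = u ∧ Match h x.2 T.1) =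
          ({u} : Finset U) ×ˢ univ.filter (fun C : Fin (2 * h) → Fin n => Match h C T.1) := by
        ext ⟨v, C⟩; simp [and_comm, eq_comm]
      rw [this, Finset.card_product, Finset.card_singleton, one_mul, hcardΩ]
      refine hmatch.trans (le_of_eq ?_)
      field_simp
    have c2 : (cnt univ (fun x : Om U n h => Match h x.2 T.1) : ℝ) ≤
        qb * Fintype.card (Om U n h) := by
      rw [cnt_eq]
      have : univ.filter (fun x : Om U n h => Match h x.2 T.1) =
          (univ : Finset U) ×ˢ univ.filter (fun C : Fin (2 * h) → Fin n => Match h C T.1) := by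
        ext ⟨v, C⟩; simp
      rw [this, Finset.card_product, Finset.card_univ, hcardΩ]
      push_cast
      calc _ ≤ (Fintype.card U : ℝ) * (qb * Fintype.card (Fin (2 * h) → Fin n)) := by gcongr
        _ = _ := by ring
    have t1 : ∀ u : U, _ := fun u => count_tail (J := J) L
      (fun x : Om U n h => x.1 = u ∧ Match h x.2 T.1) (qb / Fintype.card U) (by positivity)
      (c1 u) B
    have t2 := count_tail (J := J) L
      (fun x : Om U n h => Match h x.2 T.1) qb hqb0.le c2 dm
    have hle : ∀ ω : J → Om U n h, 1 - gd B dm L ω T ≤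
        (∑ u, if B < cnt L (fun i => (ω i).1 = u ∧ Match h (ω i).2 T.1)
          then (1 : ℝ) else 0) +
        (if dm < cnt L (fun i => Match h (ω i).2 T.1) then (1 : ℝ) else 0) := by
      intro ω
      have hs0 : (0 : ℝ) ≤ ∑ u,
          if B < cnt L (fun i => (ω i).1 = u ∧ Match h (ω i).2 T.1)
          then (1 : ℝ) else 0 := Finset.sum_nonneg fun u _ => by split_ifs <;> norm_num
      by_cases hb : BadV B dm L ω T
      · have : gd B dm L ω T = 0 := by unfold gd; rw [if_pos hb]
        rw [this]
        rcases hb with ⟨u, hu⟩ | hd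
        · have : (1 : ℝ) ≤ ∑ u,
              if B < cnt L (fun i => (ω i).1 = u ∧ Match h (ω i).2 T.1)
              then (1 : ℝ) else 0 := by
            have h5 := Finset.single_le_sum (f := fun u =>
              if B < cnt L (fun i => (ω i).1 = u ∧ Match h (ω i).2 T.1)
              then (1 : ℝ) else 0) (fun u _ => by split_ifs <;> norm_num)
              (Finset.mem_univ u)
            refine le_trans ?_ h5
            rw [if_pos hu]
          have : (0 : ℝ) ≤ if dm < cnt L (fun i => Match h (ω i).2 T.1)
            then (1 : ℝ) else 0 := by split_ifs <;> norm_num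
          linarith
        · rw [if_pos hd]; linarith
      · have : gd B dm L ω T = 1 := by unfold gd; rw [if_neg hb]
        rw [this, sub_self]
        refine add_nonneg hs0 ?_
        split_ifs <;> norm_num
    refine (Finset.sum_le_sum fun ω _ => hle ω).trans ?_
    rw [Finset.sum_add_distrib, Finset.sum_comm]
    refine (add_le_add (Finset.sum_le_sum fun u _ => t1 u) t2).trans (le_of_eq ?_)
    simp only [Finset.sum_const, Finset.card_univ, nsmul_eq_mul]
    ring
  refine (Finset.sum_le_sum fun T _ => key T).trans (le_of_eq ?_)
  simp only [Finset.sum_const, Finset.card_univ, nsmul_eq_mul]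
  ring

theorem trace_even_nonneg {V : Type*} [Fintype V] [DecidableEq V] (A : Matrix V V ℝ)
    (hA : A.transpose = A) (p : ℕ) : 0 ≤ (A ^ (2 * p)).trace := by
  have h1 : A ^ (2 * p) = (A ^ p).conjTranspose * A ^ p := by
    rw [Matrix.conjTranspose_eq_transpose_of_trivial, Matrix.transpose_pow, hA, two_mul, pow_add]
  rw [h1]
  exact (Matrix.posSemidef_conjTranspose_mul_self (A ^ p)).trace_nonneg

theorem tau_nonneg {n h : ℕ} (r : ℕ) {U J : Type*} [Fintype U] [DecidableEq U] [Fintype J]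
    [DecidableEq J] (B dm : ℝ) (p : ℕ) (t : ℝ) (ht : 0 < t) (L : Finset J) (ω : J → Om U n h) :
    0 ≤ tau r B dm p t L ω := by
  unfold tau
  refine div_nonneg (trace_even_nonneg _ ?_ p) (by positivity)
  ext S T
  simp only [Matrix.transpose_apply, prA]
  refine Finset.sum_congr rfl fun u _ => ?_
  rw [PL_symm r L ω u T.1 S.1, PL_symm r Lᶜ ω u T.2 S.2]; ring

theorem nbad_nonneg {n h : ℕ} (r : ℕ) {U J : Type*} (B dm : ℝ) (L : Finset J)
    (ω : J → Om U n h) : 0 ≤ nbad r B dm L ω := by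
  unfold nbad
  refine Finset.sum_nonneg fun T _ => ?_
  rcases gd_or B dm L ω T with h | h <;> rw [h] <;> norm_num

theorem poly_split {n d h : ℕ} {U J : Type*} [Fintype U] [DecidableEq U] [Nonempty U]
    [Fintype J] [Nonempty J]
    (E : PseudoExpectation n d) (hd : 4 * h ≤ d) (hh : 1 ≤ h) (hn : 0 < n)
    (f : U → MvPolynomial (Fin n) ℝ) (hf : ∀ u, (f u).totalDegree ≤ 1)
    (hf1 : ∀ u, E.toFun (f u ^ 2) ≤ 1) (ω : J → Om U n h) :
    E.toFun (∑ i, f (ω i).1 * fmon univ (ω i).2) / Fintype.card J -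
      E.toFun (∑ x : Om U n h, f x.1 * fmon univ x.2) / Fintype.card (Om U n h) ≤
    (E.toFun (∑ i, f (ω i).1 * Gp (ω i).2) -
      Fintype.card J * E.toFun (∑ u, (Fintype.card U : ℝ)⁻¹ • (f u * Gbar n h))) / Fintype.card J +
      (cnt univ (fun i => ¬ Function.Injective (ω i).2) : ℝ) / Fintype.card J +
      ((2 * h : ℕ) : ℝ) ^ 2 / n := by
  classical
  have : Nonempty (Fin n) := ⟨⟨0, hn⟩⟩
  have hν : (0 : ℝ) < Fintype.card U := by exact_mod_cast Fintype.card_pos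
  have hm : (0 : ℝ) < Fintype.card J := by exact_mod_cast Fintype.card_pos
  have hc : (0 : ℝ) < Fintype.card (Fin (2 * h) → Fin n) := by exact_mod_cast Fintype.card_pos
  have hn' : (0 : ℝ) < n := by exact_mod_cast hn
  have hcardΩ : (Fintype.card (Om U n h) : ℝ) =
      Fintype.card U * Fintype.card (Fin (2 * h) → Fin n) := by
    rw [Fintype.card_prod]; push_cast; rfl
  have habs : ∀ x : Om U n h, |E.toFun (f x.1 * fmon univ x.2)| ≤ 1 := by
    intro x
    refine PE_abs E _ _ ?_ ?_ (hf1 _) (PE_sq E _ _ ?_).le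
    · have := hf x.1; omega
    · have := fmon_deg univ x.2
      rw [Finset.card_univ, Fintype.card_fin] at this; omega
    · rw [Finset.card_univ, Fintype.card_fin]; omega
  have hd1 : ∀ x : Om U n h, |E.toFun (f x.1 * fmon univ x.2) - E.toFun (f x.1 * Gp x.2)| ≤
      if ¬ Function.Injective x.2 then 1 else 0 := by
    intro x
    unfold Gp
    by_cases hx : Function.Injective x.2
    · simp [hx]
    · simp only [hx, if_false, not_false_eq_true, if_true, mul_zero, map_zero, sub_zero]
      exact habs x
  have e1 : E.toFun (∑ i, f (ω i).1 * fmon univ (ω i).2) ≤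
      E.toFun (∑ i, f (ω i).1 * Gp (ω i).2) +
        (cnt univ (fun i => ¬ Function.Injective (ω i).2) : ℝ) := by
    rw [cnt_eq, ← Finset.sum_boole, map_sum, map_sum, ← Finset.sum_add_distrib]
    refine Finset.sum_le_sum fun i _ => ?_
    have := (abs_le.mp (hd1 (ω i))).2
    linarith
  have e2 : E.toFun (∑ x : Om U n h, f x.1 * Gp x.2) -
      E.toFun (∑ x : Om U n h, f x.1 * fmon univ x.2) ≤
        ((2 * h : ℕ) : ℝ) ^ 2 / n * Fintype.card (Om U n h) := by
    have a1 : E.toFun (∑ x : Om U n h, f x.1 * Gp x.2) -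
      E.toFun (∑ x : Om U n h, f x.1 * fmon univ x.2) ≤
        ∑ x : Om U n h, if ¬ Function.Injective x.2 then (1 : ℝ) else 0 := by
      rw [map_sum, map_sum, ← Finset.sum_sub_distrib]
      refine Finset.sum_le_sum fun x _ => ?_
      have := (abs_le.mp (hd1 x)).1
      linarith
    refine a1.trans ?_
    rw [Fintype.sum_prod_type]
    simp only [Finset.sum_boole, Finset.sum_const, Finset.card_univ, nsmul_eq_mul]
    rw [hcardΩ]
    have := noninj_count (n := n) (w := 2 * h)
    have h3 : ((univ.filter (fun C : Fin (2 * h) → Fin n => ¬ Function.Injective C)).card : ℝ) ≤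
        ((2 * h : ℕ) : ℝ) ^ 2 / n * Fintype.card (Fin (2 * h) → Fin n) := by
      rw [div_mul_eq_mul_div, le_div_iff₀ hn', mul_comm]
      convert this
    calc _ ≤ (Fintype.card U : ℝ) *
          (((2 * h : ℕ) : ℝ) ^ 2 / n * Fintype.card (Fin (2 * h) → Fin n)) := by gcongr
      _ = _ := by ring
  have e3 : E.toFun (∑ u, (Fintype.card U : ℝ)⁻¹ • (f u * Gbar n h)) =
      E.toFun (∑ x : Om U n h, f x.1 * Gp x.2) / Fintype.card (Om U n h) := by
    rw [div_eq_inv_mul, ← smul_eq_mul, ← map_smul, hcardΩ, Fintype.sum_prod_type,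
      Finset.smul_sum]
    congr 1
    refine Finset.sum_congr rfl fun u _ => ?_
    unfold Gbar
    simp only
    rw [← Finset.mul_sum, mul_inv, mul_smul, mul_smul_comm]
  have hΩ : (0 : ℝ) < Fintype.card (Om U n h) := by rw [hcardΩ]; positivity
  rw [e3]
  have f1 := div_le_div_of_nonneg_right e1 hm.le
  have f2 := div_le_div_of_nonneg_right e2 hΩ.le
  rw [add_div] at f1
  rw [sub_div, mul_div_cancel_right₀ _ hΩ.ne'] at f2
  rw [sub_div, mul_div_cancel_left₀ _ hm.ne']
  linarith

theorem nat_le_two_rpow (x s : ℝ) : x ≤ s + 2 ^ (-s) * 2 ^ x := by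
  rw [← Real.rpow_add (by norm_num)]
  have h1 : -s + x = x - s := by ring
  rw [h1]
  rcases le_or_gt (x - s) 0 with h | h
  · have : (0 : ℝ) < 2 ^ (x - s) := by positivity
    linarith
  · have := one_add_mul_self_le_rpow_one_add (s := 1) (by norm_num) (p := max (x - s) 1)
      (le_max_right _ _)
    rcases le_or_gt (x - s) 1 with h2 | h2
    · have : (1 : ℝ) ≤ 2 ^ (x - s) := Real.one_le_rpow (by norm_num) h.le
      linarith
    · rw [max_eq_left h2.le] at this
      norm_num at this
      linarith

/-- the random error term -/
noncomputable def Yerr {n h : ℕ} (r : ℕ) {U J : Type*} [Fintype U] [DecidableEq U] [Fintype J]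
    [DecidableEq J] (B dm : ℝ) (p : ℕ) (t s α γ : ℝ) (ω : J → Om U n h) : ℝ :=
  α * (((2 : ℝ) ^ Fintype.card J)⁻¹ * ∑ L : Finset J, tau r B dm p t L ω) +
  γ * (((2 : ℝ) ^ Fintype.card J)⁻¹ * ∑ L : Finset J, nbad r B dm L ω / Fintype.card (KV n r)) +
  2 ^ (-s) * 2 ^ cnt univ (fun i => ¬ Function.Injective (ω i).2) / Fintype.card J

theorem det_bound {n d r h : ℕ} {U J : Type*} [Fintype U] [DecidableEq U] [Nonempty U] [Fintype J]
    [DecidableEq J] [Nonempty J]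
    (E : PseudoExpectation n d) (hrd : 4 * r ≤ d) (hn : 0 < n) (hh : 1 ≤ h) (hrh : 2 * h ≤ r)
    (hrn : 4 * r ≤ n)
    (ω : J → Om U n h) (B dm : ℝ) (p : ℕ) (hp : 0 < p) (t : ℝ) (ht : 0 < t)
    (f : U → MvPolynomial (Fin n) ℝ) (hf : ∀ u, (f u).totalDegree ≤ 1)
    (hf1 : ∀ u, E.toFun (f u ^ 2) ≤ 1) (η : ℝ) (hη : 0 < η) (s β : ℝ)
    (hβ : β = ((r : ℝ) / (4 * n)) ^ h) :
    E.toFun (∑ i, f (ω i).1 * fmon univ (ω i).2) / Fintype.card J -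
      E.toFun (∑ x : Om U n h, f x.1 * fmon univ x.2) / Fintype.card (Om U n h) ≤
    η / 2 + 2 * Fintype.card U / (η * Fintype.card J) +
      2 * Fintype.card U * t / (η * (Fintype.card J : ℝ) ^ 2 * β ^ 2) + s / Fintype.card J +
      ((2 * h : ℕ) : ℝ) ^ 2 / n +
      Yerr r B dm p t s (2 * Fintype.card U * t / (η * (Fintype.card J : ℝ) ^ 2 * β ^ 2))
        (16 * Fintype.card U / (η * β)) ω := by
  have hν : (0 : ℝ) < Fintype.card U := by exact_mod_cast Fintype.card_pos
  have hm : (0 : ℝ) < Fintype.card J := by exact_mod_cast Fintype.card_pos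
  have hn' : (0 : ℝ) < n := by exact_mod_cast hn
  have hr' : (0 : ℝ) < r := by
    have : 0 < r := by omega
    exact_mod_cast this
  have hβ0 : 0 < β := by rw [hβ]; positivity
  have hKD := KD_lower n r h hrh hrn hn
  rw [← hβ] at hKD
  have hN : (0 : ℝ) < Fintype.card (KV n r) := by
    rw [Fintype.card_finset_len, Fintype.card_fin]
    exact_mod_cast Nat.choose_pos (by omega)
  have hDr : (0 : ℝ) < KD n r h := lt_of_lt_of_le (by positivity) hKD
  have hD : 0 < KD n r h := by exact_mod_cast hDr
  have h1 := poly_split E (by omega) hh hn f hf hf1 ω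
  have h2 := cert_all E hrd hn hh (by omega) ω B dm p hp t ht f hf hf1 η hη hD
  have h3 := div_le_div_of_nonneg_right h2 hm.le
  have h4 := div_le_div_of_nonneg_right
    (nat_le_two_rpow (cnt univ (fun i => ¬ Function.Injective (ω i).2) : ℝ) s) hm.le
  rw [Real.rpow_natCast, add_div] at h4
  have h5 : ∀ L : Finset J, ((Fintype.card (KV n r) : ℝ) ^ 2 * (t * (1 + tau r B dm p t L ω))
          + 8 * (Fintype.card J : ℝ) ^ 2 * KD n r h * nbad r B dm L ω) / (KD n r h : ℝ) ^ 2 ≤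
      t / β ^ 2 * (1 + tau r B dm p t L ω) +
        8 * (Fintype.card J : ℝ) ^ 2 / β * (nbad r B dm L ω / Fintype.card (KV n r)) := by
    intro L
    have ht0 := tau_nonneg r B dm p t ht L ω
    have hb0 := nbad_nonneg r B dm L ω
    rw [add_div]
    refine add_le_add ?_ ?_
    · rw [div_le_iff₀ (by positivity)]
      have : (β * Fintype.card (KV n r)) ^ 2 ≤ (KD n r h : ℝ) ^ 2 := by gcongr
      calc (Fintype.card (KV n r) : ℝ) ^ 2 * (t * (1 + tau r B dm p t L ω))
          = t / β ^ 2 * (1 + tau r B dm p t L ω) * (β * Fintype.card (KV n r)) ^ 2 := by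
            field_simp
        _ ≤ _ := by gcongr
    · rw [div_le_iff₀ (by positivity)]
      calc 8 * (Fintype.card J : ℝ) ^ 2 * KD n r h * nbad r B dm L ω
          = 8 * (Fintype.card J : ℝ) ^ 2 / β * (nbad r B dm L ω / Fintype.card (KV n r)) *
            ((β * Fintype.card (KV n r)) * KD n r h) := by field_simp
        _ ≤ 8 * (Fintype.card J : ℝ) ^ 2 / β * (nbad r B dm L ω / Fintype.card (KV n r)) *
            (KD n r h * KD n r h) := by gcongr
        _ = _ := by ring
  have h6 := Finset.sum_le_sum (s := univ) fun L _ => h5 L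
  rw [Finset.sum_add_distrib, ← Finset.mul_sum, ← Finset.mul_sum, Finset.sum_add_distrib,
    Finset.sum_const, Finset.card_univ, Fintype.card_finset, nsmul_eq_mul, mul_one] at h6
  set sτ := ∑ L : Finset J, tau r B dm p t L ω with hsτ
  set sb := ∑ L : Finset J, nbad r B dm L ω / Fintype.card (KV n r) with hsb
  have h7 : (η * Fintype.card J / 2 + Fintype.card U / (2 * η * Fintype.card J) *
      (4 * Fintype.card J + 4 * ((2 : ℝ) ^ Fintype.card J)⁻¹ * ∑ L : Finset J,
        ((Fintype.card (KV n r) : ℝ) ^ 2 * (t * (1 + tau r B dm p t L ω))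
          + 8 * (Fintype.card J : ℝ) ^ 2 * KD n r h * nbad r B dm L ω) / (KD n r h : ℝ) ^ 2)) /
          Fintype.card J ≤
      (η * Fintype.card J / 2 + Fintype.card U / (2 * η * Fintype.card J) *
      (4 * Fintype.card J + 4 * ((2 : ℝ) ^ Fintype.card J)⁻¹ * (t / β ^ 2 *
        (((2 ^ Fintype.card J : ℕ) : ℝ) + sτ) + 8 * (Fintype.card J : ℝ) ^ 2 / β * sb))) /
          Fintype.card J := by
    gcongr
  have h8 : (η * Fintype.card J / 2 + Fintype.card U / (2 * η * Fintype.card J) *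
      (4 * Fintype.card J + 4 * ((2 : ℝ) ^ Fintype.card J)⁻¹ * (t / β ^ 2 *
        (((2 ^ Fintype.card J : ℕ) : ℝ) + sτ) + 8 * (Fintype.card J : ℝ) ^ 2 / β * sb))) /
          Fintype.card J =
      η / 2 + 2 * Fintype.card U / (η * Fintype.card J) +
      2 * Fintype.card U * t / (η * (Fintype.card J : ℝ) ^ 2 * β ^ 2) +
      ((2 * Fintype.card U * t / (η * (Fintype.card J : ℝ) ^ 2 * β ^ 2)) *
        (((2 : ℝ) ^ Fintype.card J)⁻¹ * sτ) +
      (16 * Fintype.card U / (η * β)) * (((2 : ℝ) ^ Fintype.card J)⁻¹ * sb)) := by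
    push_cast
    field_simp
    ring
  unfold Yerr
  rw [← hsτ, ← hsb]
  linarith

theorem Yerr_nonneg {n h : ℕ} (r : ℕ) {U J : Type*} [Fintype U] [DecidableEq U] [Fintype J]
    [DecidableEq J] (B dm : ℝ) (p : ℕ) (t s α γ : ℝ) (ht : 0 < t) (hα : 0 ≤ α) (hγ : 0 ≤ γ)
    (ω : J → Om U n h) : 0 ≤ Yerr r B dm p t s α γ ω := by
  unfold Yerr
  have h1 : 0 ≤ ∑ L : Finset J, tau r B dm p t L ω :=
    Finset.sum_nonneg fun L _ => tau_nonneg r B dm p t ht L ω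
  have h2 : 0 ≤ ∑ L : Finset J, nbad r B dm L ω / (Fintype.card (KV n r) : ℝ) :=
    Finset.sum_nonneg fun L _ => div_nonneg (nbad_nonneg r B dm L ω) (by positivity)
  positivity

theorem noninj_Om {n h : ℕ} {U : Type*} [Fintype U] [DecidableEq U] [Nonempty U] (hn : 0 < n) :
    (cnt univ (fun x : Om U n h => ¬ Function.Injective x.2) : ℝ) ≤
      ((2 * h : ℕ) : ℝ) ^ 2 / n * Fintype.card (Om U n h) := by
  classical
  have hn' : (0 : ℝ) < n := by exact_mod_cast hn
  have hcardΩ : (Fintype.card (Om U n h) : ℝ) =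
      Fintype.card U * Fintype.card (Fin (2 * h) → Fin n) := by
    rw [Fintype.card_prod]; push_cast; rfl
  rw [cnt_eq, ← Finset.sum_boole, Fintype.sum_prod_type]
  simp only [Finset.sum_boole, Finset.sum_const, Finset.card_univ, nsmul_eq_mul]
  rw [hcardΩ]
  have := noninj_count (n := n) (w := 2 * h)
  have h3 : ((univ.filter (fun C : Fin (2 * h) → Fin n => ¬ Function.Injective C)).card : ℝ) ≤
      ((2 * h : ℕ) : ℝ) ^ 2 / n * Fintype.card (Fin (2 * h) → Fin n) := by
    rw [div_mul_eq_mul_div, le_div_iff₀ hn', mul_comm]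
    convert this
  calc _ ≤ (Fintype.card U : ℝ) *
        (((2 * h : ℕ) : ℝ) ^ 2 / n * Fintype.card (Fin (2 * h) → Fin n)) := by gcongr
    _ = _ := by ring

theorem Yerr_avg {n r h : ℕ} {U J : Type*} [Fintype U] [DecidableEq U] [Nonempty U] [Fintype J]
    [DecidableEq J] [Nonempty J] (hn : 0 < n) (hrn : r ≤ n) (B dm qb : ℝ)
    (hqb : qb = (4 * (r : ℝ) / n) ^ h) (hqb0 : 0 < qb)
    (hB : 0 ≤ B) (hdm : 0 ≤ dm) (p : ℕ) (hp : 0 < p) (t : ℝ) (ht : 0 < t)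
    (hpb : p * (B + Fintype.card J * qb / Fintype.card U) ≤
      Fintype.card J * ((dm + Fintype.card J * qb) * qb / Fintype.card U))
    (s α γ : ℝ) (hα : 0 ≤ α) (hγ : 0 ≤ γ) :
    ∑ ω : J → Om U n h, Yerr r B dm p t s α γ ω ≤ Fintype.card (J → Om U n h) *
      (α * ((Fintype.card (KV n r)) ^ 2 *
      (36 * (Fintype.card J * ((dm + Fintype.card J * qb) * qb / Fintype.card U)) *
        (B + Fintype.card J * qb / Fintype.card U) * p / t ^ 2) ^ p) +
       γ * (Fintype.card U * (Real.exp (Fintype.card J * (qb / Fintype.card U)) * 2 ^ (-B)) +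
          Real.exp (Fintype.card J * qb) * 2 ^ (-dm)) +
       2 ^ (-s) * Real.exp (Fintype.card J * (((2 * h : ℕ) : ℝ) ^ 2 / n)) / Fintype.card J) := by
  have hm : (0 : ℝ) < Fintype.card J := by exact_mod_cast Fintype.card_pos
  have hN : (0 : ℝ) < Fintype.card (KV n r) := by
    rw [Fintype.card_finset_len, Fintype.card_fin]
    exact_mod_cast Nat.choose_pos (by omega)
  unfold Yerr
  rw [Finset.sum_add_distrib, Finset.sum_add_distrib, ← Finset.mul_sum, ← Finset.mul_sum,
    ← Finset.mul_sum, ← Finset.mul_sum, Finset.sum_comm, ← Finset.sum_div, ← Finset.mul_sum]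
  rw [Finset.sum_comm (s := univ) (t := univ)
    (f := fun (ω : J → Om U n h) (L : Finset J) => nbad r B dm L ω / (Fintype.card (KV n r) : ℝ))]
  have h1 := Finset.sum_le_sum (s := univ) fun (L : Finset J) _ =>
    tau_avg (U := U) hn L B dm qb hqb hqb0 hB hdm p hp t ht hpb
  have h2 := Finset.sum_le_sum (s := univ) fun (L : Finset J) _ =>
    div_le_div_of_nonneg_right (nbad_avg (U := U) hn L B dm qb hqb hqb0) hN.le
  have h3 := two_pow_count (J := J) univ (fun x : Om U n h => ¬ Function.Injective x.2)
    (((2 * h : ℕ) : ℝ) ^ 2 / n) (by positivity) (noninj_Om hn)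
  simp only [← Finset.sum_div] at h2 ⊢
  rw [Finset.sum_const, Finset.card_univ, Fintype.card_finset, nsmul_eq_mul] at h1 h2
  rw [mul_add, mul_add]
  push_cast at h1 h2
  have h2m : (0 : ℝ) < 2 ^ Fintype.card J := by positivity
  refine add_le_add (add_le_add ?_ ?_) ?_
  · rw [mul_left_comm (Fintype.card (J → Om U n h) : ℝ) α]
    refine mul_le_mul_of_nonneg_left ?_ hα
    rw [inv_mul_le_iff₀ h2m]
    exact h1
  · rw [mul_left_comm (Fintype.card (J → Om U n h) : ℝ) γ]
    refine mul_le_mul_of_nonneg_left ?_ hγ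
    rw [inv_mul_le_iff₀ h2m]
    refine h2.trans (le_of_eq ?_)
    field_simp
  · rw [← mul_div_assoc]
    refine div_le_div_of_nonneg_right ?_ hm.le
    rw [mul_left_comm (Fintype.card (J → Om U n h) : ℝ)]
    exact mul_le_mul_of_nonneg_left h3 (by positivity)

theorem markov {Ω : Type*} [Fintype Ω] (Y : Ω → ℝ) (hY : ∀ ω, 0 ≤ Y ω) (a ε : ℝ) (ha : 0 < a)
    (h : ∑ ω, Y ω ≤ Fintype.card Ω * (a * ε)) (P : Ω → Prop) (hP : ∀ ω, Y ω ≤ a → P ω) :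
    (1 - ε) * Fintype.card Ω ≤ (Nat.card {ω // P ω} : ℝ) := by
  classical
  rw [Nat.card_eq_fintype_card, Fintype.card_subtype]
  have h1 : ∑ ω, (if P ω then (0:ℝ) else a) ≤ ∑ ω, Y ω := by
    refine Finset.sum_le_sum fun ω _ => ?_
    split_ifs with hp
    · exact hY ω
    · by_contra hc
      exact hp (hP ω (by linarith))
  have h2 : ∑ ω, (if P ω then (0:ℝ) else a) =
      a * (Fintype.card Ω - (univ.filter P).card) := by
    have : ∀ ω, (if P ω then (0:ℝ) else a) = a * (1 - if P ω then 1 else 0) := by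
      intro ω; split_ifs <;> simp
    simp only [this]
    rw [← Finset.mul_sum, Finset.sum_sub_distrib, Finset.sum_boole]
    simp
  rw [h2] at h1
  have h3 : a * (Fintype.card Ω - (univ.filter P).card : ℝ) ≤ a * (ε * Fintype.card Ω) := by
    linarith
  have := le_of_mul_le_mul_left h3 ha
  linarith

theorem main_U {n r h : ℕ} {U J : Type*} [Fintype U] [DecidableEq U] [Nonempty U] [Fintype J]
    [DecidableEq J] [Nonempty J] (hn : 0 < n) (hh : 1 ≤ h) (hrh : 2 * h ≤ r)
    (hrn : 4 * r ≤ n) (B dm qb β : ℝ)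
    (hqb : qb = (4 * (r : ℝ) / n) ^ h) (hβ : β = ((r : ℝ) / (4 * n)) ^ h)
    (hB : 0 ≤ B) (hdm : 0 ≤ dm) (p : ℕ) (hp : 0 < p) (t : ℝ) (ht : 0 < t)
    (hpb : p * (B + Fintype.card J * qb / Fintype.card U) ≤
      Fintype.card J * ((dm + Fintype.card J * qb) * qb / Fintype.card U))
    (s η δ R ε : ℝ) (hη : 0 < η) (hδ : 0 < δ)
    (f : U → MvPolynomial (Fin n) ℝ) (hf : ∀ u, (f u).totalDegree ≤ 1)
    (hf1 : ∀ d, 4 * r ≤ d → ∀ E : PseudoExpectation n d, ∀ u, E.toFun (f u ^ 2) ≤ 1)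
    (hR : η / 2 + 2 * Fintype.card U / (η * Fintype.card J) +
      2 * Fintype.card U * t / (η * (Fintype.card J : ℝ) ^ 2 * β ^ 2) + s / Fintype.card J +
      ((2 * h : ℕ) : ℝ) ^ 2 / n + δ / 2 ≤ R)
    (hε : (2 * Fintype.card U * t / (η * (Fintype.card J : ℝ) ^ 2 * β ^ 2)) *
        ((Fintype.card (KV n r)) ^ 2 *
      (36 * (Fintype.card J * ((dm + Fintype.card J * qb) * qb / Fintype.card U)) *
        (B + Fintype.card J * qb / Fintype.card U) * p / t ^ 2) ^ p) +
       (16 * Fintype.card U / (η * β)) *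
        (Fintype.card U * (Real.exp (Fintype.card J * (qb / Fintype.card U)) * 2 ^ (-B)) +
          Real.exp (Fintype.card J * qb) * 2 ^ (-dm)) +
       2 ^ (-s) * Real.exp (Fintype.card J * (((2 * h : ℕ) : ℝ) ^ 2 / n)) / Fintype.card J ≤
       δ / 2 * ε) :
    (1 - ε) * Fintype.card (J → Om U n h) ≤
      (Nat.card {ω : J → Om U n h // ∀ d, 4 * r ≤ d → ∀ E : PseudoExpectation n d,
        E.toFun (∑ i, f (ω i).1 * fmon univ (ω i).2) / Fintype.card J -
      E.toFun (∑ x : Om U n h, f x.1 * fmon univ x.2) / Fintype.card (Om U n h) ≤ R} : ℝ) := by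
  have hn' : (0 : ℝ) < n := by exact_mod_cast hn
  have hr' : (0 : ℝ) < r := by
    have : 0 < r := by omega
    exact_mod_cast this
  have hm : (0 : ℝ) < Fintype.card J := by exact_mod_cast Fintype.card_pos
  have hβ0 : 0 < β := by rw [hβ]; positivity
  have hqb0 : 0 < qb := by rw [hqb]; positivity
  refine markov _ (fun ω => Yerr_nonneg r B dm p t s
    (2 * Fintype.card U * t / (η * (Fintype.card J : ℝ) ^ 2 * β ^ 2))
        (16 * Fintype.card U / (η * β)) ht (by positivity) (by positivity) ω) (δ / 2) ε
    (by positivity) ?_ _ ?_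
  · refine (Yerr_avg hn (by omega) B dm qb hqb hqb0 hB hdm p hp t ht hpb s _ _
      (by positivity) (by positivity)).trans ?_
    exact mul_le_mul_of_nonneg_left hε (by positivity)
  · intro ω hω d hd E
    have := det_bound E hd hn hh hrh hrn ω B dm p hp t ht f hf (hf1 d hd E) η hη s β hβ
    linarith

theorem num_B1 (κ A L δ ℓ ν M p : ℝ) (hκ : 16 ≤ κ) (hA : κ ^ 30 ≤ A) (hL : 1 ≤ L)
    (hδ : 0 < δ) (hℓ : 1 ≤ ℓ) (hν : 0 < ν) (hM : 0 < M)
    (hM1 : A * L / δ ^ 4 * ℓ ≤ M * κ) (hp : 0 < p) (hp2 : p ≤ 2 * (ℓ * L)) :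
    4 * (κ * M / ν) ≤ δ ^ 4 * M ^ 2 / (2 ^ 22 * (ν * κ ^ 2 * p)) := by
  have hκ0 : 0 < κ := by linarith
  have hA' : 2 ^ 25 * κ ^ 4 ≤ A := by
    refine le_trans ?_ hA
    have : (2:ℝ) ^ 25 ≤ κ ^ 26 := by
      calc (2:ℝ) ^ 25 ≤ 16 ^ 26 := by norm_num
        _ ≤ κ ^ 26 := by gcongr
    calc 2 ^ 25 * κ ^ 4 ≤ κ ^ 26 * κ ^ 4 := by gcongr
      _ = κ ^ 30 := by ring
  rw [div_mul_eq_mul_div, div_le_iff₀ (by positivity)] at hM1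
  rw [mul_div_assoc', div_le_div_iff₀ (by positivity) (by positivity)]
  have h1 : 2 ^ 25 * κ ^ 4 * L * ℓ ≤ M * κ * δ ^ 4 := by
    refine le_trans ?_ hM1
    gcongr
  have h2 : 2 ^ 24 * κ ^ 3 * p ≤ M * δ ^ 4 := by
    have : κ * (2 ^ 24 * κ ^ 3 * p) ≤ κ * (M * δ ^ 4) := by
      calc κ * (2 ^ 24 * κ ^ 3 * p) ≤ κ * (2 ^ 24 * κ ^ 3 * (2 * (ℓ * L))) := by gcongr
        _ = 2 ^ 25 * κ ^ 4 * L * ℓ := by ring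
        _ ≤ _ := by linarith
    exact le_of_mul_le_mul_left this hκ0
  calc 4 * (κ * M) * (2 ^ 22 * (ν * κ ^ 2 * p)) = (2 ^ 24 * κ ^ 3 * p) * (M * ν) := by ring
    _ ≤ (M * δ ^ 4) * (M * ν) := by gcongr
    _ = _ := by ring

theorem num_B2 (κ A L δ ℓ ν M p : ℝ) (hκ : 16 ≤ κ) (hA : κ ^ 30 ≤ A) (hL : 1 ≤ L)
    (hδ : 0 < δ) (hδ1 : δ < 1) (hℓ : 1 ≤ ℓ) (hν : 0 < ν) (hM : 0 < M)
    (hM2 : (A * L / δ ^ 4) ^ 2 * (ν * ℓ) ≤ (M * κ) ^ 2) (hp : 0 < p) (hp2 : p ≤ 2 * (ℓ * L)) :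
    κ ^ 10 * (L / δ ^ 4) ≤ δ ^ 4 * M ^ 2 / (2 ^ 22 * (ν * κ ^ 2 * p)) := by
  have hκ0 : 0 < κ := by linarith
  have hA' : 2 ^ 23 * κ ^ 14 ≤ A := by
    refine le_trans ?_ hA
    have : (2:ℝ) ^ 23 ≤ κ ^ 16 := by
      calc (2:ℝ) ^ 23 ≤ 16 ^ 16 := by norm_num
        _ ≤ κ ^ 16 := by gcongr
    calc 2 ^ 23 * κ ^ 14 ≤ κ ^ 16 * κ ^ 14 := by gcongr
      _ = κ ^ 30 := by ring
  have hA1 : 1 ≤ A := by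
    have : (1:ℝ) ≤ 2 ^ 23 * κ ^ 14 := by
      have : (1:ℝ) ≤ κ ^ 14 := one_le_pow₀ (by linarith)
      linarith
    linarith
  have hAsq : 2 ^ 23 * κ ^ 14 ≤ A ^ 2 := by nlinarith
  rw [le_div_iff₀ (by positivity)]
  have hZ : (A * L / δ ^ 4) ^ 2 = A ^ 2 * L ^ 2 / (δ ^ 4 * δ ^ 4) := by
    rw [div_pow, mul_pow]; ring
  rw [hZ, div_mul_eq_mul_div, div_le_iff₀ (by positivity)] at hM2
  have h3 : κ ^ 10 * (L / δ ^ 4) * (2 ^ 22 * (ν * κ ^ 2 * p)) =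
      (2 ^ 22 * κ ^ 12 * L * ν * p) / δ ^ 4 := by ring
  rw [h3, div_le_iff₀ (by positivity)]
  have : κ ^ 2 * (2 ^ 22 * κ ^ 12 * L * ν * p) ≤ κ ^ 2 * (δ ^ 4 * M ^ 2 * δ ^ 4) := by
    calc κ ^ 2 * (2 ^ 22 * κ ^ 12 * L * ν * p)
        ≤ κ ^ 2 * (2 ^ 22 * κ ^ 12 * L * ν * (2 * (ℓ * L))) := by gcongr
      _ = (2 ^ 23 * κ ^ 14) * L ^ 2 * (ν * ℓ) := by ring
      _ ≤ A ^ 2 * L ^ 2 * (ν * ℓ) := by gcongr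
      _ ≤ _ := hM2
      _ = _ := by ring
  exact le_of_mul_le_mul_left this (by positivity)

theorem two_rpow_neg_le (x : ℝ) (hx : 0 ≤ x) : (2 : ℝ) ^ (-x) ≤ Real.exp (-(x / 2)) := by
  rw [Real.rpow_def_of_pos (by norm_num), Real.exp_le_exp]
  have := Real.log_two_gt_d9
  nlinarith

/-- generic tail smallness -/
theorem num_tail (κ L δ y : ℝ) (hκ : 16 ≤ κ) (hL : 1 ≤ L) (hδ : 0 < δ) (hδ1 : δ < 1)
    (hy : κ ^ 10 * (L / δ ^ 4) ≤ y) :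
    32 / δ * Real.exp (κ * L) * Real.exp (2 * L) * Real.exp (-(y / 4)) ≤
      δ / 8 * Real.exp (-(L / 2)) := by
  have h1 : 32 * 8 / δ ^ 2 ≤ Real.exp (6 + 2 / δ) := by
    have e1 : 32 * 8 ≤ Real.exp 6 := by
      have := Real.exp_one_gt_d9
      have h6 : Real.exp 6 = Real.exp 1 ^ 6 := by rw [← Real.exp_nat_mul]; norm_num
      rw [h6]
      calc (32 * 8 : ℝ) ≤ 2.7 ^ 6 := by norm_num
        _ ≤ Real.exp 1 ^ 6 := by gcongr; linarith
    have e2 : (1 / δ) ≤ Real.exp (1 / δ) := by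
      have := Real.add_one_le_exp (1 / δ); linarith
    have e3 : (1 / δ) ^ 2 ≤ Real.exp (1 / δ) ^ 2 := by gcongr
    rw [Real.exp_add]
    have e4 : Real.exp (2 / δ) = Real.exp (1 / δ) ^ 2 := by
      rw [← Real.exp_nat_mul]; congr 1; push_cast; ring
    rw [e4]
    calc 32 * 8 / δ ^ 2 = 32 * 8 * (1 / δ) ^ 2 := by rw [div_pow]; ring
      _ ≤ _ := by gcongr
  set Z := L / δ ^ 4 with hZ
  have hδ4 : δ ^ 4 ≤ 1 := pow_le_one₀ hδ.le hδ1.le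
  have hδ4' : δ ^ 4 ≤ δ := by
    calc δ ^ 4 = δ ^ 3 * δ := by ring
      _ ≤ 1 * δ := by gcongr; exact pow_le_one₀ hδ.le hδ1.le
      _ = δ := one_mul _
  have hZL : L ≤ Z := by
    rw [hZ, le_div_iff₀ (by positivity)]; nlinarith
  have hZδ : 1 / δ ≤ Z := by
    rw [hZ]; gcongr
  have hκ9 : (16:ℝ) ^ 9 ≤ κ ^ 9 := by gcongr
  have hκ10 : 16 * κ ≤ κ ^ 10 := by
    have : κ ^ 10 = κ ^ 9 * κ := by ring
    rw [this]
    have : (16:ℝ) ≤ κ ^ 9 := by linarith [show (16:ℝ) ≤ 16 ^ 9 by norm_num]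
    gcongr
  have key : 6 + 2 / δ + κ * L + 2 * L + L / 2 ≤ y / 4 := by
    have : 2 / δ = 2 * (1 / δ) := by ring
    have h4 : 16 * κ * Z ≤ y := le_trans (by gcongr) hy
    have h5 : κ * L ≤ κ * Z := by gcongr
    have h6 : 16 * Z ≤ κ * Z := by gcongr
    linarith
  calc 32 / δ * Real.exp (κ * L) * Real.exp (2 * L) * Real.exp (-(y / 4))
      = δ / 8 * (32 * 8 / δ ^ 2 * Real.exp (κ * L) * Real.exp (2 * L) * Real.exp (-(y / 4))) := by
        field_simp
    _ ≤ δ / 8 * (Real.exp (6 + 2 / δ) * Real.exp (κ * L) * Real.exp (2 * L) *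
        Real.exp (-(y / 4))) := by gcongr
    _ ≤ _ := by
      rw [← Real.exp_add, ← Real.exp_add, ← Real.exp_add]
      gcongr
      linarith

theorem num_T3 (κ L δ m θ : ℝ) (hκ : 16 ≤ κ) (hL : 1 ≤ L) (hδ : 0 < δ) (hδ1 : δ < 1)
    (hm1 : 1 ≤ m) (hθ0 : 0 ≤ θ) (hmδ : κ ^ 10 * (L / δ ^ 3) ≤ m * δ) :
    2 ^ (-(4 * (m * θ) + m * δ / 16)) * Real.exp (m * θ) / m ≤ δ / 8 * Real.exp (-(L / 2)) := by
  have hm' : 0 < m := by linarith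
  have hκ10 : (16:ℝ) ^ 10 ≤ κ ^ 10 := by gcongr
  have hmθ : 0 ≤ m * θ := by positivity
  have d1 : (2:ℝ) ^ (-(4 * (m * θ) + m * δ / 16)) * Real.exp (m * θ) ≤
      Real.exp (-(m * δ / 32)) := by
    calc _ ≤ Real.exp (-((4 * (m * θ) + m * δ / 16) / 2)) * Real.exp (m * θ) := by
          gcongr; exact two_rpow_neg_le _ (by positivity)
      _ ≤ _ := by rw [← Real.exp_add]; gcongr; linarith
  have d2 : 8 / δ ≤ Real.exp (7 + 1 / δ) := by
    rw [Real.exp_add]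
    have g1 := Real.add_one_le_exp (1 / δ)
    have g2 := Real.add_one_le_exp (7:ℝ)
    calc 8 / δ = 8 * (1 / δ) := by ring
      _ ≤ _ := by gcongr <;> linarith
  have d3 : 7 + 1 / δ + L / 2 ≤ m * δ / 32 := by
    have g1 : L ≤ L / δ ^ 3 := by
      rw [le_div_iff₀ (by positivity)]
      have : δ ^ 3 ≤ 1 := pow_le_one₀ hδ.le hδ1.le
      nlinarith
    have g2 : 1 / δ ≤ L / δ ^ 3 := by
      have : δ ^ 3 ≤ δ ^ 1 := pow_le_pow_of_le_one hδ.le hδ1.le (by norm_num)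
      rw [pow_one] at this
      gcongr
    have g3 : 16 ^ 10 * (L / δ ^ 3) ≤ κ ^ 10 * (L / δ ^ 3) := by gcongr
    linarith
  calc 2 ^ (-(4 * (m * θ) + m * δ / 16)) * Real.exp (m * θ) / m
      ≤ 2 ^ (-(4 * (m * θ) + m * δ / 16)) * Real.exp (m * θ) / 1 := by gcongr
    _ ≤ Real.exp (-(m * δ / 32)) := by rw [div_one]; exact d1
    _ = δ / 8 * (8 / δ * Real.exp (-(m * δ / 32))) := by field_simp
    _ ≤ δ / 8 * (Real.exp (7 + 1 / δ) * Real.exp (-(m * δ / 32))) := by gcongr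
    _ ≤ _ := by
      rw [← Real.exp_add]
      gcongr
      linarith

set_option maxHeartbeats 1600000 in
theorem main_V {n r h ℓ m : ℕ} {U : Type*} [Fintype U] [DecidableEq U] [Nonempty U]
    (hn : 0 < n) (hm : 0 < m) (hh : 1 ≤ h) (hrh : 2 * h ≤ r) (hr1 : 2 * r ≤ ℓ) (hr2 : ℓ ≤ 4 * r)
    (hℓn : 2 * ℓ ≤ n) (L A δ : ℝ) (hLdef : L = Real.log n) (hL : 1 ≤ L)
    (hA : ((16:ℝ) ^ h) ^ 30 ≤ A) (hδ : 0 < δ) (hδ1 : δ < 1)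
    (hνn : Fintype.card U ≤ n)
    (F1 : A * L / δ ^ 4 * ℓ ≤ m * ((ℓ : ℝ) / n) ^ h)
    (F2 : (A * L / δ ^ 4) ^ 2 * (Fintype.card U * ℓ) ≤ (m * ((ℓ : ℝ) / n) ^ h) ^ 2)
    (F3 : A * L / δ ^ 4 * n ≤ m)
    (f : U → MvPolynomial (Fin n) ℝ) (hf : ∀ u, (f u).totalDegree ≤ 1)
    (hf1 : ∀ d, 4 * r ≤ d → ∀ E : PseudoExpectation n d, ∀ u, E.toFun (f u ^ 2) ≤ 1) :
    (1 - Real.exp (-(L / 2))) * Fintype.card (Fin m → Om U n h) ≤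
      (Nat.card {ω : Fin m → Om U n h // ∀ d, 4 * r ≤ d → ∀ E : PseudoExpectation n d,
        E.toFun (∑ i, f (ω i).1 * fmon univ (ω i).2) / Fintype.card (Fin m) -
      E.toFun (∑ x : Om U n h, f x.1 * fmon univ x.2) / Fintype.card (Om U n h) ≤
        δ + 5 * (((2 * h : ℕ) : ℝ) ^ 2 / n)} : ℝ) := by
  have : Nonempty (Fin m) := ⟨⟨0, hm⟩⟩
  have hn' : (0 : ℝ) < n := by exact_mod_cast hn
  have hm' : (0 : ℝ) < m := by exact_mod_cast hm
  have hm1 : (1 : ℝ) ≤ m := by exact_mod_cast hm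
  have hr2' : (2 : ℝ) ≤ r := by
    have : 2 ≤ r := by omega
    exact_mod_cast this
  have hℓ1 : (1 : ℝ) ≤ ℓ := by
    have : 1 ≤ ℓ := by omega
    exact_mod_cast this
  have hnL : Real.exp L = n := by rw [hLdef, Real.exp_log hn']
  set κ : ℝ := 16 ^ h with hκdef
  have hκ : 16 ≤ κ := by
    calc (16:ℝ) = 16 ^ 1 := by norm_num
      _ ≤ 16 ^ h := pow_le_pow_right₀ (by norm_num) hh
  have hκh : 2 * (h : ℝ) ≤ κ := by
    have h1 : h < 2 ^ h := Nat.lt_two_pow_self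
    have h2 : (h : ℝ) ≤ 2 ^ h := by exact_mod_cast h1.le
    have h3 : (2:ℝ) ^ h * 2 ^ h ≤ κ := by
      rw [← mul_pow, hκdef]; gcongr; norm_num
    have h4 : (2:ℝ) ≤ 2 ^ h := by
      calc (2:ℝ) = 2 ^ 1 := by norm_num
        _ ≤ 2 ^ h := pow_le_pow_right₀ (by norm_num) hh
    nlinarith
  have hκ0 : 0 < κ := by linarith
  set ν : ℝ := ((Fintype.card U : ℕ) : ℝ) with hνdef
  have hν1 : 1 ≤ ν := by
    have : 0 < Fintype.card U := Fintype.card_pos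
    rw [hνdef]
    exact_mod_cast this
  have hν0 : 0 < ν := by linarith
  have hνL : ν ≤ Real.exp L := by rw [hnL, hνdef]; exact_mod_cast hνn
  clear_value κ ν
  obtain ⟨β, hβ⟩ : ∃ β : ℝ, β = ((r : ℝ) / (4 * n)) ^ h := ⟨_, rfl⟩
  obtain ⟨qb, hqb⟩ : ∃ qb : ℝ, qb = (4 * (r : ℝ) / n) ^ h := ⟨_, rfl⟩
  have hβ0 : 0 < β := by rw [hβ]; positivity
  have hqβ : qb = κ * β := by
    rw [hqb, hβ, hκdef, ← mul_pow]; congr 1; field_simp; norm_num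
  have hρ : ((ℓ : ℝ) / n) ^ h ≤ κ * β := by
    rw [← hqβ, hqb]; gcongr; exact_mod_cast hr2
  have hβinv : 1 / β ≤ Real.exp (κ * L) := by
    have e1 : 1 / β = (4 * (n : ℝ) / r) ^ h := by
      rw [hβ, ← one_div_pow]; congr 1; field_simp
    have e2 : (4 * (n : ℝ) / r) ≤ (n : ℝ) ^ 2 := by
      rw [div_le_iff₀ (by positivity)]
      have hn2 : (2:ℝ) ≤ n := by
        have : 2 ≤ n := by omega
        exact_mod_cast this
      nlinarith [mul_pos hn' hn']
    rw [e1]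
    calc (4 * (n : ℝ) / r) ^ h ≤ ((n : ℝ) ^ 2) ^ h := by gcongr
      _ = Real.exp (2 * h * L) := by
        rw [← pow_mul, ← hnL, ← Real.exp_nat_mul]; push_cast; rfl
      _ ≤ _ := by gcongr
  obtain ⟨M, hMdef⟩ : ∃ M : ℝ, M = m * β := ⟨_, rfl⟩
  have hM0 : 0 < M := by rw [hMdef]; positivity
  have hMκ : m * ((ℓ : ℝ) / n) ^ h ≤ M * κ := by
    rw [hMdef]
    calc m * ((ℓ : ℝ) / n) ^ h ≤ m * (κ * β) := by gcongr
      _ = _ := by ring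
  have hM1 := F1.trans hMκ
  have hM2 : (A * L / δ ^ 4) ^ 2 * (ν * ℓ) ≤ (M * κ) ^ 2 := F2.trans (by gcongr)
  obtain ⟨p, hpdef⟩ : ∃ p : ℕ, p = ⌈(ℓ : ℝ) * L⌉₊ := ⟨_, rfl⟩
  have hℓL : 1 ≤ (ℓ : ℝ) * L := by nlinarith
  have hp1 : (ℓ : ℝ) * L ≤ p := by rw [hpdef]; exact Nat.le_ceil _
  have hp2 : (p : ℝ) ≤ 2 * (ℓ * L) := by
    have := Nat.ceil_lt_add_one (show 0 ≤ (ℓ : ℝ) * L by linarith)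
    rw [← hpdef] at this; linarith
  have hp0' : (0 : ℝ) < p := by linarith
  have hp0 : 0 < p := by exact_mod_cast hp0'
  obtain ⟨B, hBdef⟩ : ∃ B : ℝ, B = δ ^ 4 * M ^ 2 / (2 ^ 22 * (ν * κ ^ 2 * p)) := ⟨_, rfl⟩
  have hB1 : 4 * (κ * M / ν) ≤ B := by
    rw [hBdef]; exact num_B1 κ A L δ ℓ ν M p hκ hA hL hδ hℓ1 hν0 hM0 hM1 hp0' hp2
  have hB2 : κ ^ 10 * (L / δ ^ 4) ≤ B := by
    rw [hBdef]; exact num_B2 κ A L δ ℓ ν M p hκ hA hL hδ hδ1 hℓ1 hν0 hM0 hM2 hp0' hp2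
  have hB0 : 0 < B := by rw [hBdef]; positivity
  have hA0 : 0 < A := lt_of_lt_of_le (by positivity) hA
  have hA10 : κ ^ 10 ≤ A := le_trans (pow_le_pow_right₀ (by linarith) (by norm_num)) hA
  have hx : κ ^ 10 * (L / δ ^ 4) ≤ κ * M := by
    calc κ ^ 10 * (L / δ ^ 4) ≤ A * (L / δ ^ 4) := by gcongr
      _ = A * L / δ ^ 4 * 1 := by ring
      _ ≤ A * L / δ ^ 4 * ℓ := by gcongr
      _ ≤ M * κ := hM1
      _ = _ := mul_comm _ _
  obtain ⟨t, htdef⟩ : ∃ t : ℝ, t = δ ^ 2 * M ^ 2 / (32 * ν) := ⟨_, rfl⟩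
  have ht0 : 0 < t := by rw [htdef]; positivity
  obtain ⟨θ, hθdef⟩ : ∃ θ : ℝ, θ = ((2 * h : ℕ) : ℝ) ^ 2 / n := ⟨_, rfl⟩
  have hθ0 : 0 ≤ θ := by rw [hθdef]; positivity
  have hmq : (m : ℝ) * qb = κ * M := by rw [hqβ, hMdef]; ring
  have hmw : (m : ℝ) * (qb / ν) = κ * M / ν := by rw [← mul_div_assoc, hmq]
  have hmw' : (m : ℝ) * qb / ν = κ * M / ν := by rw [hmq]
  have hQ : (m : ℝ) * ((4 * (κ * M) + κ * M) * qb / ν) = 5 * κ ^ 2 * M ^ 2 / ν := by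
    calc (m : ℝ) * ((4 * (κ * M) + κ * M) * qb / ν) = 5 * (κ * M) * (m * qb) / ν := by ring
      _ = _ := by rw [hmq]; ring
  have hα : 2 * ν * t / (δ / 2 * (m : ℝ) ^ 2 * β ^ 2) = δ / 8 := by
    have : δ / 2 * (m : ℝ) ^ 2 * β ^ 2 = δ / 2 * M ^ 2 := by rw [hMdef]; ring
    rw [this, htdef]; field_simp; norm_num
  have hb2 : B + κ * M / ν ≤ 2 * B := by
    have : 0 < κ * M / ν := by positivity
    linarith
  have hBp : B * p = δ ^ 4 * M ^ 2 / (2 ^ 22 * (ν * κ ^ 2)) := by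
    rw [hBdef]; field_simp
  rw [← hθdef]
  have hmδ : κ ^ 10 * (L / δ ^ 3) ≤ m * δ := by
    have hn1 : (1:ℝ) ≤ n := by exact_mod_cast hn
    calc κ ^ 10 * (L / δ ^ 3) ≤ A * (L / δ ^ 3) := by gcongr
      _ = A * L / δ ^ 4 * 1 * δ := by field_simp
      _ ≤ A * L / δ ^ 4 * n * δ := by gcongr
      _ ≤ m * δ := by gcongr
  have hδ4 : δ ^ 4 ≤ 1 := pow_le_one₀ hδ.le hδ1.le
  have hκ10 : (16:ℝ) ^ 10 ≤ κ ^ 10 := by gcongr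
  refine main_U hn hh hrh (by omega) B (4 * (κ * M)) qb β hqb hβ hB0.le (by positivity) p hp0 t ht0
    ?_ (4 * (m * θ) + m * δ / 16) (δ / 2) δ (δ + 5 * θ) _ (by positivity) hδ f hf hf1 ?_ ?_
  · rw [Fintype.card_fin, ← hνdef, hmq, hQ]
    calc p * (B + κ * M / ν) ≤ p * (2 * B) := by gcongr
      _ = 2 * (B * p) := by ring
      _ = (2 * δ ^ 4 / (2 ^ 22 * κ ^ 2)) * (M ^ 2 / ν) := by rw [hBp]; field_simp
      _ ≤ (5 * κ ^ 2) * (M ^ 2 / ν) := by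
        gcongr
        rw [div_le_iff₀ (by positivity)]
        have : 1 ≤ κ ^ 2 := one_le_pow₀ (by linarith)
        have h22 : (1:ℝ) ≤ 2 ^ 22 * κ ^ 2 := by linarith [show (1:ℝ) ≤ 2 ^ 22 by norm_num]
        calc 2 * δ ^ 4 ≤ 5 * 1 * 1 := by linarith
          _ ≤ 5 * κ ^ 2 * (2 ^ 22 * κ ^ 2) := by gcongr
      _ = _ := by ring
  · rw [Fintype.card_fin, ← hνdef, hα, ← hθdef]
    have e1 : 2 * ν / (δ / 2 * m) ≤ δ / 16 := by
      rw [div_le_iff₀ (by positivity)]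
      have : ν ≤ n := by rw [hνdef]; exact_mod_cast hνn
      rw [div_mul_eq_mul_div, div_le_iff₀ (by positivity)] at F3
      have h5 : 64 * ν ≤ m * δ ^ 4 := by
        refine le_trans ?_ F3
        calc 64 * ν ≤ A * 1 * n := by
              have : (64:ℝ) ≤ A := by
                have : (64:ℝ) ≤ 16 ^ 10 := by norm_num
                linarith
              rw [mul_one]; gcongr
          _ ≤ _ := by gcongr
      have h6 : δ ^ 4 ≤ δ ^ 2 := pow_le_pow_of_le_one hδ.le hδ1.le (by norm_num)
      have h7 : (m:ℝ) * δ ^ 4 ≤ m * δ ^ 2 := by gcongr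
      have h8 : δ / 16 * (δ / 2 * m) = m * δ ^ 2 / 32 := by ring
      rw [h8]
      linarith
    have e2 : (4 * (m * θ) + m * δ / 16) / m = 4 * θ + δ / 16 := by field_simp
    rw [e2]
    linarith
  · rw [Fintype.card_fin, ← hνdef, hα, ← hθdef, hmq, hmw, hQ]
    have T1 : δ / 8 * ((Fintype.card (KV n r)) ^ 2 *
        (36 * (5 * κ ^ 2 * M ^ 2 / ν) * (B + κ * M / ν) * p / t ^ 2) ^ p) ≤
        δ / 8 * Real.exp (-(L / 2)) := by
      have a1 : 36 * (5 * κ ^ 2 * M ^ 2 / ν) * (B + κ * M / ν) * p / t ^ 2 ≤ Real.exp (-2) := by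
        have b1 : 36 * (5 * κ ^ 2 * M ^ 2 / ν) * (B + κ * M / ν) * p / t ^ 2 ≤
            36 * (5 * κ ^ 2 * M ^ 2 / ν) * (2 * B) * p / t ^ 2 := by gcongr
        have b2 : 36 * (5 * κ ^ 2 * M ^ 2 / ν) * (2 * B) * p / t ^ 2 = 368640 / 2 ^ 22 := by
          have : 36 * (5 * κ ^ 2 * M ^ 2 / ν) * (2 * B) * p / t ^ 2 =
            36 * (5 * κ ^ 2 * M ^ 2 / ν) * 2 * (B * p) / t ^ 2 := by ring
          rw [this, hBp, htdef]; field_simp; norm_num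
        have b3 : (368640 / 2 ^ 22 : ℝ) ≤ Real.exp (-2) := by
          have h2 : Real.exp (-2) = (Real.exp 1 ^ 2)⁻¹ := by
            rw [← Real.exp_nat_mul, ← Real.exp_neg]; norm_num
          rw [h2]
          have := Real.exp_one_lt_d9
          have h3 : Real.exp 1 ^ 2 ≤ 2.72 ^ 2 := by gcongr; linarith
          calc (368640 / 2 ^ 22 : ℝ) ≤ (2.72 ^ 2)⁻¹ := by norm_num
            _ ≤ _ := by gcongr
        linarith
      have a0 : 0 ≤ 36 * (5 * κ ^ 2 * M ^ 2 / ν) * (B + κ * M / ν) * p / t ^ 2 := by positivity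
      have a2 : ((Fintype.card (KV n r) : ℝ)) ^ 2 ≤ Real.exp (ℓ * L) := by
        have c1 : (Fintype.card (KV n r) : ℝ) ≤ (n : ℝ) ^ r := by
          rw [Fintype.card_finset_len, Fintype.card_fin]
          exact_mod_cast Nat.choose_le_pow n r
        calc ((Fintype.card (KV n r) : ℝ)) ^ 2 ≤ ((n : ℝ) ^ r) ^ 2 := by gcongr
          _ = Real.exp (((r * 2 : ℕ) : ℝ) * L) := by
            rw [← pow_mul, ← hnL, ← Real.exp_nat_mul]
          _ ≤ _ := by
            gcongr; omega
      gcongr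
      calc ((Fintype.card (KV n r) : ℝ)) ^ 2 *
        (36 * (5 * κ ^ 2 * M ^ 2 / ν) * (B + κ * M / ν) * p / t ^ 2) ^ p
          ≤ Real.exp (ℓ * L) * (Real.exp (-2)) ^ p := by gcongr
        _ = Real.exp (ℓ * L + p * (-2)) := by rw [← Real.exp_nat_mul, ← Real.exp_add]
        _ ≤ _ := by
          gcongr
          have hLℓ : L ≤ ℓ * L := le_mul_of_one_le_left (by linarith) hℓ1
          linarith
    have hn2 : ν * ν ≤ Real.exp (2 * L) := by
      have : Real.exp (2 * L) = Real.exp L * Real.exp L := by rw [← Real.exp_add]; ring_nf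
      rw [this]; gcongr
    have hn3 : ν ≤ Real.exp (2 * L) := le_trans (le_mul_of_one_le_left hν0.le hν1) hn2
    have e16 : 16 * ν / (δ / 2 * β) = 32 / δ * (1 / β) * ν := by field_simp; norm_num
    have T2 : 16 * ν / (δ / 2 * β) * (ν * (Real.exp (κ * M / ν) * 2 ^ (-B))) ≤
        δ / 8 * Real.exp (-(L / 2)) := by
      have d1 : Real.exp (κ * M / ν) * 2 ^ (-B) ≤ Real.exp (-(B / 4)) := by
        calc Real.exp (κ * M / ν) * 2 ^ (-B) ≤ Real.exp (κ * M / ν) * Real.exp (-(B / 2)) := by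
              gcongr; exact two_rpow_neg_le B hB0.le
          _ ≤ _ := by rw [← Real.exp_add]; gcongr; linarith
      refine le_trans ?_ (num_tail κ L δ B hκ hL hδ hδ1 hB2)
      rw [e16]
      calc 32 / δ * (1 / β) * ν * (ν * (Real.exp (κ * M / ν) * 2 ^ (-B)))
          = 32 / δ * (1 / β) * (ν * ν) * (Real.exp (κ * M / ν) * 2 ^ (-B)) := by ring
        _ ≤ _ := by gcongr
    have T2' : 16 * ν / (δ / 2 * β) * (Real.exp (κ * M) * 2 ^ (-(4 * (κ * M)))) ≤
        δ / 8 * Real.exp (-(L / 2)) := by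
      have hx0 : 0 < κ * M := by positivity
      have d1 : Real.exp (κ * M) * 2 ^ (-(4 * (κ * M))) ≤ Real.exp (-(κ * M / 4)) := by
        calc _ ≤ Real.exp (κ * M) * Real.exp (-(4 * (κ * M) / 2)) := by
              gcongr; exact two_rpow_neg_le _ (by positivity)
          _ ≤ _ := by rw [← Real.exp_add]; gcongr; linarith
      refine le_trans ?_ (num_tail κ L δ (κ * M) hκ hL hδ hδ1 hx)
      rw [e16]
      gcongr
    have T3 := num_T3 κ L δ m θ hκ hL hδ hδ1 hm1 hθ0 hmδ
    rw [mul_add (16 * ν / (δ / 2 * β))]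
    linarith

theorem final_U {n m k ℓ r h : ℕ} {U : Type*} [Fintype U] (hrℓ : 4 * r ≤ 2 * ℓ)
    (f : U → MvPolynomial (Fin n) ℝ) (e : (Fin k → Fin n) ≃ Om U n h)
    (he : ∀ C : Fin k → Fin n, ∏ j, X (C j) = f (e C).1 * fmon univ (e C).2)
    (R R' ε : ℝ) (hR : R ≤ R')
    (hmain : (1 - ε) * Fintype.card (Fin m → Om U n h) ≤
      (Nat.card {ω : Fin m → Om U n h // ∀ d, 4 * r ≤ d → ∀ E : PseudoExpectation n d,
        E.toFun (∑ i, f (ω i).1 * fmon univ (ω i).2) / Fintype.card (Fin m) -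
      E.toFun (∑ x : Om U n h, f x.1 * fmon univ x.2) / Fintype.card (Om U n h) ≤ R} : ℝ)) :
    (1 - ε) * (Fintype.card (Fin m → (Fin k → Fin n)) : ℝ) ≤
    ((Nat.card {H : Fin m → (Fin k → Fin n) //
        ∀ d : ℕ, 2 * ℓ ≤ d → ∀ E : PseudoExpectation n d,
          E.toFun ((MvPolynomial.C ((m : ℝ)⁻¹) *
              ∑ i : Fin m, ∏ j : Fin k, X (H i j)) -
            (MvPolynomial.C (((n : ℝ) ^ k)⁻¹) *
              ∑ C : Fin k → Fin n, ∏ j : Fin k, X (C j))) ≤ R'} : ℝ)) := by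
  have hc : Fintype.card (Fin k → Fin n) = Fintype.card (Om U n h) := Fintype.card_congr e
  have hc2 : (Fintype.card (Om U n h) : ℝ) = (n : ℝ) ^ k := by
    rw [← hc]; simp
  have hc3 : Fintype.card (Fin m → (Fin k → Fin n)) = Fintype.card (Fin m → Om U n h) :=
    Fintype.card_congr (Equiv.arrowCongr (Equiv.refl _) e)
  rw [hc3]
  refine hmain.trans ?_
  rw [Nat.cast_le]
  refine Nat.card_le_card_of_injective
    (fun ω => ⟨fun i => e.symm (ω.1 i), ?_⟩) ?_
  · obtain ⟨w, hw⟩ := ω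
    intro d hd E
    have h1 := hw d (by omega) E
    simp only
    rw [map_sub, MvPolynomial.C_mul', MvPolynomial.C_mul', map_smul, map_smul, smul_eq_mul,
      smul_eq_mul, ← div_eq_inv_mul, ← div_eq_inv_mul]
    have e1 : ∑ i : Fin m, ∏ j : Fin k, (X (e.symm (w i) j) : MvPolynomial (Fin n) ℝ) =
        ∑ i, f (w i).1 * fmon univ (w i).2 := by
      refine Finset.sum_congr rfl fun i _ => ?_
      rw [he, Equiv.apply_symm_apply]
    have e2 : ∑ C : Fin k → Fin n, ∏ j : Fin k, (X (C j) : MvPolynomial (Fin n) ℝ) =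
        ∑ x : Om U n h, f x.1 * fmon univ x.2 := by
      refine Fintype.sum_equiv e _ _ fun C => he C
    rw [e1, e2, ← hc2]
    rw [Fintype.card_fin] at h1
    linarith
  · intro ω ω' hw
    simp only [Subtype.mk.injEq] at hw
    apply Subtype.ext
    funext i
    exact e.symm.injective (congrFun hw i)

theorem hyp_facts (W m n ℓ : ℝ) (k : ℕ) (hW : 0 < W) (hm : 0 < m) (hn : 0 < n) (hℓ : 0 < ℓ)
    (h : W * (n ^ ((k:ℝ) / 2) / m) ≤ ℓ ^ ((k:ℝ) / 2 - 1)) :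
    W * ℓ ≤ m * (ℓ / n) ^ ((k:ℝ) / 2) := by
  rw [Real.rpow_sub_one hℓ.ne', le_div_iff₀ hℓ] at h
  rw [Real.div_rpow hℓ.le hn.le, mul_div_assoc', le_div_iff₀ (by positivity)]
  rw [mul_div_assoc', div_mul_eq_mul_div, div_le_iff₀ hm] at h
  linarith

theorem F3_of_F1 (W m n ℓ : ℝ) (h : ℕ) (hh : 1 ≤ h) (hm : 0 < m) (hn : 0 < n)
    (hℓ : 0 < ℓ) (hℓn : ℓ ≤ n) (F1 : W * ℓ ≤ m * (ℓ / n) ^ h) : W * n ≤ m := by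
  have hx : (ℓ / n) ^ h ≤ ℓ / n := by
    have : (ℓ / n) ^ h ≤ (ℓ / n) ^ 1 :=
      pow_le_pow_of_le_one (by positivity) (by rw [div_le_one hn]; exact hℓn) hh
    simpa using this
  have h1 : W * ℓ ≤ m * (ℓ / n) := F1.trans (by gcongr)
  rw [mul_div_assoc', le_div_iff₀ hn] at h1
  have h2 : ℓ * (W * n) ≤ ℓ * m := by linarith
  exact le_of_mul_le_mul_left h2 hℓ

set_option maxHeartbeats 1000000 in
theorem stmt11 :
    ∃ a c : ℝ, 0 < a ∧ 0 < c ∧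
    ∀ (n m k ℓ : ℕ), 0 < n → 0 < m → 0 < ℓ → 2 ≤ k → a * (k : ℝ) ^ 4 ≤ (n : ℝ) →
    ∀ δ : ℝ, 0 < δ → δ < 1 / 2 →
    2 * k ≤ ℓ → (ℓ : ℝ) ≤ (n : ℝ) / 8 →
    (ℓ : ℝ) ^ ((k : ℝ) / 2 - 1) ≥
      (2 : ℝ) ^ (a * (k : ℝ)) * ((n : ℝ) ^ ((k : ℝ) / 2) / (m : ℝ)) * Real.log n / δ ^ 4 →
    ((Nat.card {H : Fin m → (Fin k → Fin n) //
        ∀ d : ℕ, 2 * ℓ ≤ d → ∀ E : PseudoExpectation n d,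
          E.toFun ((MvPolynomial.C ((m : ℝ)⁻¹) *
              ∑ i : Fin m, ∏ j : Fin k, X (H i j)) -
            (MvPolynomial.C (((n : ℝ) ^ k)⁻¹) *
              ∑ C : Fin k → Fin n, ∏ j : Fin k, X (C j))) ≤
            δ + a / Real.sqrt n} : ℝ)) ≥
      (1 - (n : ℝ) ^ (-c)) * (Fintype.card (Fin m → (Fin k → Fin n)) : ℝ) := by
  refine ⟨60, 1 / 2, by norm_num, by norm_num, ?_⟩
  intro n m k ℓ hn hm hℓ hk hkn δ hδ hδ1 hkℓ hℓn hyp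
  have hn' : (0 : ℝ) < n := by exact_mod_cast hn
  have hm' : (0 : ℝ) < m := by exact_mod_cast hm
  have hℓ' : (0 : ℝ) < ℓ := by exact_mod_cast hℓ
  have hℓ1 : (1 : ℝ) ≤ ℓ := by exact_mod_cast hℓ
  have hk' : (2 : ℝ) ≤ k := by exact_mod_cast hk
  have hk4 : (16 : ℝ) ≤ (k : ℝ) ^ 4 := by
    calc (16 : ℝ) = 2 ^ 4 := by norm_num
      _ ≤ (k : ℝ) ^ 4 := by gcongr
  obtain ⟨L, hL⟩ : ∃ L : ℝ, L = Real.log n := ⟨_, rfl⟩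
  have hL1 : 1 ≤ L := by
    rw [hL, Real.le_log_iff_exp_le hn']
    have := Real.exp_one_lt_d9
    linarith
  have hε : (n : ℝ) ^ (-(1 / 2 : ℝ)) = Real.exp (-(L / 2)) := by
    rw [Real.rpow_def_of_pos hn', ← hL]; congr 1; ring
  obtain ⟨A, hA⟩ : ∃ A : ℝ, A = (2 : ℝ) ^ ((60 : ℝ) * (k : ℝ)) := ⟨_, rfl⟩
  have hA0 : 0 < A := by rw [hA]; positivity
  have hW0 : 0 < A * L / δ ^ 4 := by positivity
  have hG : A * L / δ ^ 4 * ℓ ≤ m * ((ℓ : ℝ) / n) ^ ((k : ℝ) / 2) := by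
    refine hyp_facts _ _ _ _ k hW0 hm' hn' hℓ' ?_
    rw [← hA, ← hL] at hyp
    refine le_trans (le_of_eq ?_) hyp
    ring
  have hℓn8 : 2 * ℓ ≤ n := by
    have : (2 : ℝ) * ℓ ≤ n := by linarith
    exact_mod_cast this
  have hR : ∀ h : ℕ, 2 * h ≤ k →
      δ + 5 * (((2 * h : ℕ) : ℝ) ^ 2 / n) ≤ δ + 60 / Real.sqrt n := by
    intro h hhk
    have hs : Real.sqrt n * Real.sqrt n = n := Real.mul_self_sqrt hn'.le
    have hs0 : 0 < Real.sqrt n := Real.sqrt_pos.2 hn'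
    have h1 : ((2 * h : ℕ) : ℝ) ^ 2 ≤ (k : ℝ) ^ 2 := by
      have : ((2 * h : ℕ) : ℝ) ≤ k := by exact_mod_cast hhk
      gcongr
    have h2 : (k : ℝ) ^ 2 ≤ Real.sqrt n := by
      apply Real.le_sqrt_of_sq_le
      have : ((k : ℝ) ^ 2) ^ 2 = (k : ℝ) ^ 4 := by ring
      rw [this]; linarith
    have h3 : 5 * (((2 * h : ℕ) : ℝ) ^ 2 / n) ≤ 60 / Real.sqrt n := by
      rw [mul_div_assoc', div_le_div_iff₀ hn' hs0]
      calc 5 * ((2 * h : ℕ) : ℝ) ^ 2 * Real.sqrt n ≤ 60 * Real.sqrt n * Real.sqrt n := by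
            gcongr <;> linarith
        _ = 60 * n := by rw [mul_assoc, hs]
    linarith
  have hAκ : ∀ h : ℕ, 2 * h ≤ k → ((16:ℝ) ^ h) ^ 30 ≤ A := by
    intro h hhk
    have h1 : ((16:ℝ) ^ h) ^ 30 = (2:ℝ) ^ ((60 * (2 * h) : ℕ) : ℝ) := by
      rw [Real.rpow_natCast, ← pow_mul, show (16:ℝ) = 2 ^ 4 by norm_num, ← pow_mul]
      congr 1; ring
    rw [h1, hA]
    apply Real.rpow_le_rpow_of_exponent_le (by norm_num)
    have : ((2 * h : ℕ) : ℝ) ≤ k := by exact_mod_cast hhk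
    push_cast at this ⊢
    linarith
  have hx0 : 0 ≤ (ℓ : ℝ) / n := by positivity
  have hx1 : (ℓ : ℝ) / n ≤ 1 := by rw [div_le_one hn']; linarith
  rw [hε, ge_iff_le]
  have hr1 : 2 * (ℓ / 2) ≤ ℓ := by omega
  have hr2 : ℓ ≤ 4 * (ℓ / 2) := by omega
  rcases Nat.even_or_odd' k with ⟨h, hkh | hkh⟩
  · have hG' : A * L / δ ^ 4 * ℓ ≤ m * ((ℓ : ℝ) / n) ^ h := by
      have : (k : ℝ) / 2 = (h : ℕ) := by rw [hkh]; push_cast; ring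
      rwa [this, Real.rpow_natCast] at hG
    have F2 : (A * L / δ ^ 4) ^ 2 * ((Fintype.card Unit : ℕ) * ℓ : ℝ) ≤
        (m * ((ℓ : ℝ) / n) ^ h) ^ 2 := by
      calc (A * L / δ ^ 4) ^ 2 * ((Fintype.card Unit : ℕ) * ℓ : ℝ)
          = (A * L / δ ^ 4) ^ 2 * (1 * ℓ) := by simp
        _ ≤ (A * L / δ ^ 4) ^ 2 * (ℓ * ℓ) := by gcongr
        _ = (A * L / δ ^ 4 * ℓ) ^ 2 := by ring
        _ ≤ _ := by gcongr
    have := main_V (n := n) (r := ℓ / 2) (h := h) (ℓ := ℓ) (m := m) (U := Unit) hn hm (by omega)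
      (by omega) hr1 hr2 hℓn8 L A δ hL hL1 (hAκ h (by omega)) hδ (by linarith)
      (by rw [Fintype.card_unit]; exact hn) hG' F2
      (F3_of_F1 _ _ _ _ h (by omega) hm' hn' hℓ' (by linarith) hG')
      (fun _ => 1) (fun _ => by simp) (fun d _ E _ => by rw [one_pow, E.normalized])
    subst hkh
    refine final_U (by omega) (fun _ : Unit => (1 : MvPolynomial (Fin n) ℝ))
      (Equiv.uniqueProd (Fin (2 * h) → Fin n) Unit).symm ?_ (δ + 5 * (((2 * h : ℕ) : ℝ) ^ 2 / n))
      (δ + 60 / Real.sqrt n) (Real.exp (-(L / 2))) (hR h le_rfl) this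
    intro C
    simp [fmon]
  · have hG' : A * L / δ ^ 4 * ℓ ≤ m * (((ℓ : ℝ) / n) ^ h * Real.sqrt ((ℓ : ℝ) / n)) := by
      have h1 : (k : ℝ) / 2 = (h : ℕ) + 1 / 2 := by rw [hkh]; push_cast; ring
      rwa [h1, Real.rpow_add (by positivity), Real.rpow_natCast, ← Real.sqrt_eq_rpow] at hG
    have F1 : A * L / δ ^ 4 * ℓ ≤ m * ((ℓ : ℝ) / n) ^ h := by
      refine hG'.trans ?_
      have : Real.sqrt ((ℓ : ℝ) / n) ≤ 1 := Real.sqrt_le_one.2 hx1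
      gcongr
      exact mul_le_of_le_one_right (by positivity) this
    have F2 : (A * L / δ ^ 4) ^ 2 * ((Fintype.card (Fin n) : ℕ) * ℓ : ℝ) ≤
        (m * ((ℓ : ℝ) / n) ^ h) ^ 2 := by
      rw [Fintype.card_fin]
      have h1 : (A * L / δ ^ 4 * ℓ) ^ 2 ≤
          (m * (((ℓ : ℝ) / n) ^ h * Real.sqrt ((ℓ : ℝ) / n))) ^ 2 := by gcongr
      have h2 : (m * (((ℓ : ℝ) / n) ^ h * Real.sqrt ((ℓ : ℝ) / n))) ^ 2 =
          (m * ((ℓ : ℝ) / n) ^ h) ^ 2 * ℓ / n := by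
        rw [← mul_assoc, mul_pow _ (Real.sqrt _), Real.sq_sqrt hx0]; ring
      rw [h2, le_div_iff₀ hn'] at h1
      have h3 : ℓ * ((A * L / δ ^ 4) ^ 2 * (n * ℓ)) ≤ ℓ * (m * ((ℓ : ℝ) / n) ^ h) ^ 2 := by
        calc ℓ * ((A * L / δ ^ 4) ^ 2 * (n * ℓ)) = (A * L / δ ^ 4 * ℓ) ^ 2 * n := by ring
          _ ≤ _ := h1
          _ = _ := by ring
      exact le_of_mul_le_mul_left h3 hℓ'
    have : Nonempty (Fin n) := ⟨⟨0, hn⟩⟩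
    have := main_V (n := n) (r := ℓ / 2) (h := h) (ℓ := ℓ) (m := m) (U := Fin n) hn hm (by omega)
      (by omega) hr1 hr2 hℓn8 L A δ hL hL1 (hAκ h (by omega)) hδ (by linarith)
      (by simp) F1 F2
      (F3_of_F1 _ _ _ _ h (by omega) hm' hn' hℓ' (by linarith) F1)
      (fun u => X u) (fun u => by simp [MvPolynomial.totalDegree_X]) (fun d hd E u => by
        have := E.boolean u 1 (by rw [MvPolynomial.totalDegree_one]; omega)
        rw [mul_one, E.normalized] at this
        exact this.le)
    subst hkh
    refine final_U (by omega) (fun u : Fin n => (X u : MvPolynomial (Fin n) ℝ))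
      (Fin.consEquiv (fun _ : Fin (2 * h + 1) => Fin n)).symm ?_
      (δ + 5 * (((2 * h : ℕ) : ℝ) ^ 2 / n))
      (δ + 60 / Real.sqrt n) (Real.exp (-(L / 2))) (hR h (by omega)) this
    intro C
    rw [Fin.prod_univ_succ]
    simp [fmon, Fin.consEquiv, Fin.tail]
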